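/- Let n ≥ 1, let V : ℝⁿ → ℝ be a smooth long-range potential, and let I ⊂ (0, ∞) be a compact interval such that for some δ₀ > 0 every global Hamiltonian trajectory whose energy lies within distance δ₀ of I satisfies |z(t)| → ∞ as t → ±∞. Then for every ε > 0 there exist constants C > 0 and h₀ > 0 such that for all h ∈ (0, h₀), all λ ∈ I, all t > 0, and all Schwartz functions u ∈ 𝒮(ℝⁿ; ℂ), the following a priori estimate holds: ‖(1+|z|)^{−1/2−ε} u‖_{L²(ℝⁿ)} ≤ C h^{−1} ‖(1+|z|)^{1/2+ε} (−h²Δu + Vu − (λ + it)u)‖_{L²(ℝⁿ)}, where Δ denotes the Euclidean Laplacian Δu = Σⱼ ∂²u/∂zⱼ². -/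

import Mathlib

open Filter MeasureTheory

/-- `V` is a smooth long-range potential: it is smooth and for some `γ > 0` all of its
iterated derivatives satisfy `‖D^k V(z)‖ ≤ C_k (1+|z|)^{−γ−k}`. -/
def IsLongRangePotential {n : ℕ} (V : EuclideanSpace ℝ (Fin n) → ℝ) : Prop :=
  ContDiff ℝ (⊤ : ℕ∞) V ∧ ∃ γ : ℝ, 0 < γ ∧ ∀ k : ℕ, ∃ C : ℝ, 0 < C ∧
    ∀ z : EuclideanSpace ℝ (Fin n),
      ‖iteratedFDeriv ℝ k V z‖ ≤ C * (1 + ‖z‖) ^ (-γ - (k : ℝ))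

/-- The Euclidean Laplacian `Δu(z) = Σⱼ ∂²u/∂zⱼ²` of a function `u : ℝⁿ → ℂ`. -/
noncomputable def euclideanLaplacian {n : ℕ} (u : EuclideanSpace ℝ (Fin n) → ℂ)
    (z : EuclideanSpace ℝ (Fin n)) : ℂ :=
  ∑ j : Fin n,
    fderiv ℝ (fun w => fderiv ℝ u w (EuclideanSpace.single j 1)) z
      (EuclideanSpace.single j 1)

section
open Filter MeasureTheory SchwartzMap LineDeriv

abbrev SRE (n : ℕ) := EuclideanSpace ℝ (Fin n)

def NullInt {n : ℕ} (D : SRE n → ℝ) : Prop := Integrable D volume ∧ ∫ z, D z = 0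

theorem NullInt.add {n : ℕ} {D D' : SRE n → ℝ} (h : NullInt D) (h' : NullInt D') :
    NullInt (fun z => D z + D' z) :=
  ⟨h.1.add h'.1, by rw [integral_add h.1 h'.1, h.2, h'.2, add_zero]⟩

theorem NullInt.smul {n : ℕ} {D : SRE n → ℝ} (c : ℝ) (h : NullInt D) :
    NullInt (fun z => c * D z) :=
  ⟨h.1.const_mul c, by rw [integral_const_mul, h.2, mul_zero]⟩

theorem NullInt.sum {n : ℕ} {ι : Type*} (s : Finset ι) {D : ι → SRE n → ℝ}
    (h : ∀ i ∈ s, NullInt (D i)) : NullInt (fun z => ∑ i ∈ s, D i z) :=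
  ⟨integrable_finsetSum s fun i hi => (h i hi).1, by
    rw [integral_finsetSum s fun i hi => (h i hi).1]
    exact Finset.sum_eq_zero fun i hi => (h i hi).2⟩

theorem NullInt.congr {n : ℕ} {D D' : SRE n → ℝ} (h : NullInt D) (h' : ∀ z, D z = D' z) :
    NullInt D' := by
  have : D = D' := funext h'
  rwa [← this]

/-- coordinate vector -/
noncomputable abbrev ebv {n : ℕ} (j : Fin n) : SRE n := EuclideanSpace.single j (1 : ℝ)

noncomputable def innerB : ℂ →L[ℝ] ℂ →L[ℝ] ℝ := innerSL ℝ
theorem innerB_apply (a b : ℂ) : innerB a b = inner ℝ a b := rfl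

/-- integrability of a pairing of Schwartz functions with a temperate weight -/
theorem sr_integrable_inner {n : ℕ} {w : SRE n → ℝ} (hw : w.HasTemperateGrowth)
    (a b : 𝓢(SRE n, ℂ)) : Integrable (fun z => w z * inner ℝ (a z) (b z)) volume := by
  have h := (SchwartzMap.pairing innerB
    (smulLeftCLM ℂ w a) b).integrable (μ := volume)
  refine h.congr (Filter.Eventually.of_forall fun z => ?_)
  simp only [SchwartzMap.pairing_apply_apply, smulLeftCLM_apply_apply hw, innerB_apply,
    real_inner_smul_left]

theorem sr_ibp {n : ℕ} {w : SRE n → ℝ} (hw : w.HasTemperateGrowth)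
    (a b : 𝓢(SRE n, ℂ)) (m : SRE n) :
    NullInt (fun z => fderiv ℝ w z m * inner ℝ (a z) (b z)
      + w z * inner ℝ ((∂_{m} a : 𝓢(SRE n, ℂ)) z) (b z)
      + w z * inner ℝ (a z) ((∂_{m} b : 𝓢(SRE n, ℂ)) z)) := by
  have key := SchwartzMap.integral_bilinear_lineDerivOp_right_eq_neg_left
    (smulLeftCLM ℂ w a) b innerB m (μ := volume)
  have hd : ∀ z, (∂_{m} (smulLeftCLM ℂ w a) : 𝓢(SRE n, ℂ)) z
      = fderiv ℝ w z m • a z + w z • (∂_{m} a : 𝓢(SRE n, ℂ)) z := by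
    intro z
    rw [SchwartzMap.lineDerivOp_apply_eq_fderiv, SchwartzMap.lineDerivOp_apply_eq_fderiv]
    have e : (⇑(smulLeftCLM ℂ w a) : SRE n → ℂ) = fun z => w z • a z := by
      ext z; exact smulLeftCLM_apply_apply hw a z
    have hwd : DifferentiableAt ℝ w z := (hw.1.differentiable (by simp)).differentiableAt
    rw [e, fderiv_fun_smul hwd a.differentiableAt]
    simp [add_comm]
  have i1 := (SchwartzMap.pairing innerB
    (∂_{m} (smulLeftCLM ℂ w a) : 𝓢(SRE n, ℂ)) b).integrable (μ := volume)
  have i2 := (SchwartzMap.pairing innerB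
    (smulLeftCLM ℂ w a) (∂_{m} b : 𝓢(SRE n, ℂ))).integrable (μ := volume)
  replace i1 := i1.congr (Filter.Eventually.of_forall fun z =>
    SchwartzMap.pairing_apply_apply _ _ _ z)
  replace i2 := i2.congr (Filter.Eventually.of_forall fun z =>
    SchwartzMap.pairing_apply_apply _ _ _ z)
  have : NullInt (fun z => innerB ((∂_{m} (smulLeftCLM ℂ w a) : 𝓢(SRE n, ℂ)) z) (b z)
      + innerB (smulLeftCLM ℂ w a z) ((∂_{m} b : 𝓢(SRE n, ℂ)) z)) := by
    refine ⟨i1.add i2, ?_⟩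
    rw [integral_add i1 i2, key]; ring
  refine this.congr fun z => ?_
  rw [hd, smulLeftCLM_apply_apply hw]
  simp only [innerB_apply, inner_add_left, real_inner_smul_left]

theorem sr_comm {n : ℕ} (u : 𝓢(SRE n, ℂ)) (m m' : SRE n) (z : SRE n) :
    (∂_{m} (∂_{m'} u : 𝓢(SRE n, ℂ)) : 𝓢(SRE n, ℂ)) z
      = (∂_{m'} (∂_{m} u : 𝓢(SRE n, ℂ)) : 𝓢(SRE n, ℂ)) z := by
  have hs : ∀ m m' : SRE n, (∂_{m} (∂_{m'} u : 𝓢(SRE n, ℂ)) : 𝓢(SRE n, ℂ)) z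
      = fderiv ℝ (fderiv ℝ u) z m m' := by
    intro m m'
    rw [SchwartzMap.lineDerivOp_apply_eq_fderiv]
    have : (⇑(∂_{m'} u : 𝓢(SRE n, ℂ)) : SRE n → ℂ) = fun z => fderiv ℝ u z m' := by
      ext z; exact SchwartzMap.lineDerivOp_apply_eq_fderiv _ _ _
    rw [this, fderiv_clm_apply]
    · simp
    · have := (u.smooth 2).fderiv_right (m := 1) (by norm_num)
      exact (this.differentiable (by simp)).differentiableAt
    · fun_prop
  rw [hs, hs]
  have : IsSymmSndFDerivAt ℝ (⇑u) z :=
    ((u.smooth 2).contDiffAt).isSymmSndFDerivAt (by simp)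
  exact this m m'

/-- the weight -/
noncomputable def Aw {n : ℕ} (z : SRE n) : ℝ := 1 + ‖z‖ ^ 2

theorem Aw_pos {n : ℕ} (z : SRE n) : 0 < Aw z := by unfold Aw; positivity
theorem Aw_one_le {n : ℕ} (z : SRE n) : 1 ≤ Aw z := by
  unfold Aw; nlinarith [sq_nonneg ‖z‖]

theorem Aw_temp {n : ℕ} (α : ℝ) : (fun z : SRE n => Aw z ^ α).HasTemperateGrowth :=
  Function.hasTemperateGrowth_one_add_norm_sq_rpow (SRE n) α

theorem coord_temp {n : ℕ} (j : Fin n) : (fun z : SRE n => z j).HasTemperateGrowth :=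
  (EuclideanSpace.proj j : SRE n →L[ℝ] ℝ).hasTemperateGrowth

theorem Aw_deriv {n : ℕ} (α : ℝ) (z : SRE n) (j : Fin n) :
    fderiv ℝ (fun z : SRE n => Aw z ^ α) z (ebv j) = 2 * α * Aw z ^ (α - 1) * z j := by
  have h1 : HasFDerivAt (fun z : SRE n => Aw z) (2 • (innerSL ℝ z)) z := by
    have := (hasStrictFDerivAt_norm_sq z).hasFDerivAt.const_add 1
    exact this
  have h2 := h1.rpow_const (p := α) (Or.inl (Aw_pos z).ne')
  rw [h2.fderiv]
  simp [EuclideanSpace.inner_single_right]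
  ring

theorem sum_coord_sq {n : ℕ} (z : SRE n) : ∑ j, z j * z j = Aw z - 1 := by
  unfold Aw
  rw [EuclideanSpace.norm_sq_eq]
  simp [sq]
end

section
open Filter MeasureTheory SchwartzMap LineDeriv

noncomputable def dj {n : ℕ} (j : Fin n) (u : 𝓢(SRE n, ℂ)) : 𝓢(SRE n, ℂ) := ∂_{ebv j} u
noncomputable def slap {n : ℕ} (u : 𝓢(SRE n, ℂ)) : 𝓢(SRE n, ℂ) := ∑ j, dj j (dj j u)
noncomputable def Zf {n : ℕ} (u : 𝓢(SRE n, ℂ)) (z : SRE n) : ℂ := ∑ k, (z k) • dj k u z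
noncomputable def Gf {n : ℕ} (u : 𝓢(SRE n, ℂ)) (z : SRE n) : ℝ := ∑ j, ‖dj j u z‖ ^ 2

theorem slap_apply {n : ℕ} (u : 𝓢(SRE n, ℂ)) (z : SRE n) :
    slap u z = ∑ j, dj j (dj j u) z := by
  simp [slap]

theorem dj_comm {n : ℕ} (u : 𝓢(SRE n, ℂ)) (j k : Fin n) (z : SRE n) :
    dj j (dj k u) z = dj k (dj j u) z := sr_comm u _ _ z

theorem sr_ibp' {n : ℕ} {w : SRE n → ℝ} (hw : w.HasTemperateGrowth)
    (a b : 𝓢(SRE n, ℂ)) (j : Fin n) :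
    NullInt (fun z => fderiv ℝ w z (ebv j) * inner ℝ (a z) (b z)
      + w z * inner ℝ (dj j a z) (b z) + w z * inner ℝ (a z) (dj j b z)) :=
  sr_ibp hw a b (ebv j)

theorem ebv_coord {n : ℕ} (j k : Fin n) : (ebv j : SRE n) k = if k = j then 1 else 0 := by
  simp [ebv, Pi.single_apply]

theorem Aw_diff {n : ℕ} (α : ℝ) (z : SRE n) : DifferentiableAt ℝ (fun z : SRE n => Aw z ^ α) z :=
  ((Aw_temp α).1.differentiable (by simp)).differentiableAt

theorem coord_diff {n : ℕ} (k : Fin n) (z : SRE n) : DifferentiableAt ℝ (fun z : SRE n => z k) z :=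
  ((coord_temp k).1.differentiable (by simp)).differentiableAt

theorem coord_fderiv {n : ℕ} (k j : Fin n) (z : SRE n) :
    fderiv ℝ (fun z : SRE n => z k) z (ebv j) = if k = j then 1 else 0 := by
  have : (fun z : SRE n => z k) = ⇑(EuclideanSpace.proj k : SRE n →L[ℝ] ℝ) := rfl
  rw [this, ContinuousLinearMap.fderiv]
  simp [Pi.single_apply]

theorem Awz_temp {n : ℕ} (α : ℝ) (k : Fin n) :
    (fun z : SRE n => Aw z ^ α * z k).HasTemperateGrowth := (Aw_temp α).mul (coord_temp k)

theorem Awz_deriv {n : ℕ} (α : ℝ) (z : SRE n) (k j : Fin n) :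
    fderiv ℝ (fun z : SRE n => Aw z ^ α * z k) z (ebv j)
      = 2 * α * Aw z ^ (α - 1) * z j * z k + Aw z ^ α * (if k = j then 1 else 0) := by
  rw [fderiv_fun_mul (Aw_diff α z) (coord_diff k z)]
  simp only [add_apply, smul_apply, smul_eq_mul,
    coord_fderiv, Aw_deriv]
  ring

theorem Aw_mul_self {n : ℕ} (α : ℝ) (z : SRE n) : Aw z ^ (α - 1) * Aw z = Aw z ^ α := by
  rw [← Real.rpow_add_one (Aw_pos z).ne']; congr 1; ring

/-- Laplacian of the weight -/
noncomputable def ellw (n : ℕ) (α : ℝ) (A : ℝ) : ℝ :=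
  2 * α * (n + 2 * α - 2) * A ^ (α - 1) - 4 * α * (α - 1) * A ^ (α - 2)
noncomputable def dw (n : ℕ) (α : ℝ) (A : ℝ) : ℝ :=
  (n + 2 * α) * A ^ α - 2 * α * A ^ (α - 1)

theorem sr_I3 {n : ℕ} (α : ℝ) (u : 𝓢(SRE n, ℂ)) :
    NullInt (fun z => Aw z ^ α * Gf u z + Aw z ^ α * inner ℝ (u z) (slap u z)
      - 1 / 2 * ellw n α (Aw z) * ‖u z‖ ^ 2) := by
  have h1 := NullInt.sum Finset.univ fun j _ => sr_ibp' (Aw_temp α) u (dj j u) j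
  have h2 := NullInt.sum Finset.univ fun j (_ : j ∈ Finset.univ) =>
    (sr_ibp' (Awz_temp (α - 1) j) u u j).smul (2 * α)
  refine (h1.add (h2.smul (-1 / 2))).congr fun z => ?_
  have e1 : ∀ j, inner ℝ (dj j u z) (u z) = inner ℝ (u z) (dj j u z) :=
    fun j => real_inner_comm _ _
  simp only [Aw_deriv, Awz_deriv, slap_apply, inner_sum, Gf, if_true, e1,
    real_inner_self_eq_norm_sq]
  simp only [Finset.mul_sum]
  have e2 : ellw n α (Aw z) = ∑ j, 2 * α * (2 * (α - 1) * Aw z ^ (α - 1 - 1) * (z j * z j)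
      + Aw z ^ (α - 1)) := by
    rw [← Finset.mul_sum, Finset.sum_add_distrib, ← Finset.mul_sum, sum_coord_sq]
    have := Aw_mul_self (α - 1) z
    simp only [Finset.sum_const, Finset.card_univ, Fintype.card_fin, nsmul_eq_mul, ellw]
    rw [show α - 2 = α - 1 - 1 by ring, ← this]
    ring
  rw [e2]
  simp only [Finset.mul_sum, Finset.sum_mul, ← Finset.sum_add_distrib, ← Finset.sum_sub_distrib]
  refine Finset.sum_congr rfl fun j _ => ?_
  ring

theorem sr_I2 {n : ℕ} (α : ℝ) (u : 𝓢(SRE n, ℂ)) :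
    NullInt (fun z => Aw z ^ α * inner ℝ (Complex.I * u z) (slap u z)
      + 2 * α * Aw z ^ (α - 1) * inner ℝ (Complex.I * u z) (Zf u z)) := by
  have h1 := NullInt.sum Finset.univ fun j _ =>
    sr_ibp' (Aw_temp α) (Complex.I • u) (dj j u) j
  refine h1.congr fun z => ?_
  have e1 : ∀ j, dj j (Complex.I • u) z = Complex.I * dj j u z := by
    intro j
    simp only [dj, lineDerivOp_smul]
    rfl
  have e2 : ∀ c : ℂ, inner ℝ (Complex.I * c) c = (0 : ℝ) := by
    intro c; simp [Complex.inner]; ring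
  have e3 : (Complex.I • u) z = Complex.I * u z := rfl
  simp only [Aw_deriv, slap_apply, Zf, inner_sum, e1, e2, e3, inner_smul_right, mul_zero, add_zero]
  simp only [Finset.mul_sum, ← Finset.sum_add_distrib]
  refine Finset.sum_congr rfl fun j _ => ?_
  ring

theorem sr_J {n : ℕ} (α : ℝ) (u : 𝓢(SRE n, ℂ)) :
    NullInt (fun z => 4 * α * Aw z ^ (α - 1) * ‖Zf u z‖ ^ 2 + 2 * Aw z ^ α * Gf u z
      + 2 * Aw z ^ α * inner ℝ (slap u z) (Zf u z) - dw n α (Aw z) * Gf u z) := by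
  have h1 := NullInt.sum Finset.univ fun j (_ : j ∈ Finset.univ) =>
    NullInt.sum Finset.univ fun k (_ : k ∈ Finset.univ) =>
    sr_ibp' (Awz_temp α k) (dj j u) (dj k u) j
  have h2 := NullInt.sum Finset.univ fun j (_ : j ∈ Finset.univ) =>
    NullInt.sum Finset.univ fun k (_ : k ∈ Finset.univ) =>
    sr_ibp' (Awz_temp α k) (dj j u) (dj j u) k
  refine ((h1.smul 2).add (h2.smul (-1))).congr fun z => ?_
  have e1 : ∀ j k, inner ℝ (dj k (dj j u) z) (dj j u z) = inner ℝ (dj j u z) (dj k (dj j u) z) :=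
    fun j k => real_inner_comm _ _
  have e0 : ∀ j k, dj j (dj k u) z = dj k (dj j u) z := fun j k => dj_comm u j k z
  have hZ : ‖Zf u z‖ ^ 2 = ∑ j, ∑ k, z j * z k * inner ℝ (dj j u z) (dj k u z) := by
    rw [← real_inner_self_eq_norm_sq, Zf, sum_inner]
    refine Finset.sum_congr rfl fun j _ => ?_
    rw [inner_sum]
    refine Finset.sum_congr rfl fun k _ => ?_
    rw [real_inner_smul_left, real_inner_smul_right]; ring
  have hL : inner ℝ (slap u z) (Zf u z)
      = ∑ j, ∑ k, z k * inner ℝ (dj j (dj j u) z) (dj k u z) := by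
    rw [slap_apply, Zf, sum_inner]
    refine Finset.sum_congr rfl fun j _ => ?_
    rw [inner_sum]
    refine Finset.sum_congr rfl fun k _ => ?_
    rw [real_inner_smul_right]
  have hG : Gf u z = ∑ j, ∑ k, (if k = j then 1 else 0) * inner ℝ (dj j u z) (dj k u z) := by
    unfold Gf
    refine Finset.sum_congr rfl fun j _ => ?_
    simp only [ite_mul, one_mul, zero_mul, Finset.sum_ite_eq', Finset.mem_univ, if_true,
      real_inner_self_eq_norm_sq]
  have hd : dw n α (Aw z) * Gf u z = ∑ j, ∑ k, (2 * α * Aw z ^ (α - 1) * z k * z k + Aw z ^ α)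
      * ‖dj j u z‖ ^ 2 := by
    unfold Gf
    rw [Finset.mul_sum]
    refine Finset.sum_congr rfl fun j _ => ?_
    rw [← Finset.sum_mul]
    congr 1
    rw [Finset.sum_add_distrib]
    simp only [mul_assoc, ← Finset.mul_sum, sum_coord_sq]
    have := Aw_mul_self α z
    simp only [Finset.sum_const, Finset.card_univ, Fintype.card_fin, nsmul_eq_mul, dw]
    rw [← this]
    ring
  rw [hd, hZ, hL, hG]
  simp only [Awz_deriv, real_inner_self_eq_norm_sq, if_true]
  simp only [Finset.mul_sum, ← Finset.sum_add_distrib, ← Finset.sum_sub_distrib]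
  refine Finset.sum_congr rfl fun j _ => Finset.sum_congr rfl fun k _ => ?_
  rw [e1, e0 j k]
  ring

theorem sr_I4 {n : ℕ} (α : ℝ) (u : 𝓢(SRE n, ℂ)) {V : SRE n → ℝ} (hV : V.HasTemperateGrowth) :
    NullInt (fun z => (dw n α (Aw z) * V z + Aw z ^ α * fderiv ℝ V z z) * ‖u z‖ ^ 2
      + 2 * Aw z ^ α * V z * inner ℝ (u z) (Zf u z)) := by
  have h1 := NullInt.sum Finset.univ fun k (_ : k ∈ Finset.univ) =>
    sr_ibp' ((Awz_temp α k).mul hV) u u k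
  refine h1.congr fun z => ?_
  have hVd : DifferentiableAt ℝ V z := (hV.1.differentiable (by simp)).differentiableAt
  have e1 : ∀ j, inner ℝ (dj j u z) (u z) = inner ℝ (u z) (dj j u z) :=
    fun j => real_inner_comm _ _
  have hd : ∀ k, fderiv ℝ ((fun z : SRE n => Aw z ^ α * z k) * V) z (ebv k)
      = (2 * α * Aw z ^ (α - 1) * z k * z k + Aw z ^ α) * V z
        + Aw z ^ α * (z k * fderiv ℝ V z (ebv k)) := by
    intro k
    rw [fderiv_mul (c := fun z : SRE n => Aw z ^ α * z k) ((Aw_diff α z).mul (coord_diff k z)) hVd]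
    simp only [add_apply, smul_apply, smul_eq_mul,
      Awz_deriv, if_true]
    ring
  have hz : fderiv ℝ V z z = ∑ k, z k * fderiv ℝ V z (ebv k) := by
    have hz' : z = ∑ k, z k • (ebv k : SRE n) := by
      ext i; simp [Pi.single_apply]
    generalize fderiv ℝ V z = T
    conv_lhs => rw [hz']
    simp [map_sum]
  have hdw : dw n α (Aw z) = ∑ k, (2 * α * Aw z ^ (α - 1) * z k * z k + Aw z ^ α) := by
    rw [Finset.sum_add_distrib]
    simp only [mul_assoc, ← Finset.mul_sum, sum_coord_sq]
    have := Aw_mul_self α z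
    simp only [Finset.sum_const, Finset.card_univ, Fintype.card_fin, nsmul_eq_mul, dw]
    rw [← this]
    ring
  rw [hdw, hz, Zf, inner_sum]
  simp only [hd, e1, Pi.mul_apply, real_inner_smul_right, real_inner_self_eq_norm_sq]
  simp only [Finset.mul_sum, Finset.sum_mul, ← Finset.sum_add_distrib]
  refine Finset.sum_congr rfl fun j _ => ?_
  ring
end

section
open Filter MeasureTheory SchwartzMap LineDeriv

/-- the right-hand side as a Schwartz function -/
noncomputable def ff {n : ℕ} (V : SRE n → ℝ) (h lam t : ℝ) (u : 𝓢(SRE n, ℂ)) : 𝓢(SRE n, ℂ) :=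
  (-((h : ℂ) ^ 2)) • slap u + smulLeftCLM ℂ V u - ((lam : ℂ) + (t : ℂ) * Complex.I) • u

theorem ff_apply {n : ℕ} {V : SRE n → ℝ} (hV : V.HasTemperateGrowth) (h lam t : ℝ)
    (u : 𝓢(SRE n, ℂ)) (z : SRE n) : ff V h lam t u z =
    -((h : ℂ) ^ 2) * slap u z + (V z : ℂ) * u z - ((lam : ℂ) + (t : ℂ) * Complex.I) * u z := by
  have : ff V h lam t u z = (-((h : ℂ) ^ 2)) • slap u z + smulLeftCLM ℂ V u z
    - ((lam : ℂ) + (t : ℂ) * Complex.I) • u z := rfl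
  rw [this, smulLeftCLM_apply_apply hV]
  simp

theorem lap_eq {n : ℕ} {V : SRE n → ℝ} (hV : V.HasTemperateGrowth) (h lam t : ℝ)
    (u : 𝓢(SRE n, ℂ)) (z : SRE n) : (h ^ 2) • slap u z =
      (V z - lam) • u z - t • (Complex.I * u z) - ff V h lam t u z := by
  rw [ff_apply hV]
  simp only [Complex.real_smul]
  push_cast
  ring

theorem inner_I_self (c : ℂ) : inner ℝ (Complex.I * c) c = (0 : ℝ) := by
  simp [Complex.inner]; ring
theorem inner_I_self' (c : ℂ) : inner ℝ c (Complex.I * c) = (0 : ℝ) := by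
  rw [real_inner_comm, inner_I_self]
theorem norm_I_mul (c : ℂ) : ‖Complex.I * c‖ = ‖c‖ := by simp

noncomputable def qw (n : ℕ) (α : ℝ) (A : ℝ) : ℝ :=
  (n + 2 * α) * ellw n α A - 2 * α * ellw n (α - 1) A

theorem sr_D3 {n : ℕ} {V : SRE n → ℝ} (hV : V.HasTemperateGrowth) (h lam t α : ℝ)
    (u : 𝓢(SRE n, ℂ)) :
    NullInt (fun z => Aw z ^ α * (h ^ 2 * Gf u z) + Aw z ^ α * ((V z - lam) * ‖u z‖ ^ 2
      - inner ℝ (u z) (ff V h lam t u z)) - 1 / 2 * h ^ 2 * ellw n α (Aw z) * ‖u z‖ ^ 2) := by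
  refine ((sr_I3 α u).smul (h ^ 2)).congr fun z => ?_
  have e : h ^ 2 * inner ℝ (u z) (slap u z) = (V z - lam) * ‖u z‖ ^ 2
      - inner ℝ (u z) (ff V h lam t u z) := by
    rw [← real_inner_smul_right, lap_eq hV h lam t, inner_sub_right, inner_sub_right,
      real_inner_smul_right, real_inner_smul_right, inner_I_self', real_inner_self_eq_norm_sq]
    ring
  rw [← e]; ring

theorem sr_D2 {n : ℕ} {V : SRE n → ℝ} (hV : V.HasTemperateGrowth) (h lam t α : ℝ)
    (u : 𝓢(SRE n, ℂ)) :
    NullInt (fun z => - (t * Aw z ^ α * ‖u z‖ ^ 2)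
      - Aw z ^ α * inner ℝ (Complex.I * u z) (ff V h lam t u z)
      + 2 * α * Aw z ^ (α - 1) * (h ^ 2 * inner ℝ (Complex.I * u z) (Zf u z))) := by
  refine ((sr_I2 α u).smul (h ^ 2)).congr fun z => ?_
  have e : h ^ 2 * inner ℝ (Complex.I * u z) (slap u z) = - (t * ‖u z‖ ^ 2)
      - inner ℝ (Complex.I * u z) (ff V h lam t u z) := by
    rw [← real_inner_smul_right, lap_eq hV h lam t, inner_sub_right, inner_sub_right,
      real_inner_smul_right, real_inner_smul_right, inner_I_self, real_inner_self_eq_norm_sq,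
      norm_I_mul]
    ring
  have e' : Aw z ^ α * (h ^ 2 * inner ℝ (Complex.I * u z) (slap u z)) = Aw z ^ α * (- (t * ‖u z‖ ^ 2)
      - inner ℝ (Complex.I * u z) (ff V h lam t u z)) := by rw [e]
  linear_combination e'

theorem sr_D1 {n : ℕ} {V : SRE n → ℝ} (hV : V.HasTemperateGrowth) (h lam t α : ℝ)
    (u : 𝓢(SRE n, ℂ)) :
    NullInt (fun z => 4 * α * Aw z ^ (α - 1) * (h ^ 2 * ‖Zf u z‖ ^ 2)
      + 2 * Aw z ^ α * (h ^ 2 * Gf u z)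
      - 2 * t * Aw z ^ α * inner ℝ (Complex.I * u z) (Zf u z)
      - 2 * Aw z ^ α * inner ℝ (ff V h lam t u z) (Zf u z)
      - Aw z ^ α * fderiv ℝ V z z * ‖u z‖ ^ 2
      - dw n α (Aw z) * inner ℝ (u z) (ff V h lam t u z)
      - 1 / 2 * h ^ 2 * qw n α (Aw z) * ‖u z‖ ^ 2) := by
  have k1 := (sr_J α u).smul (h ^ 2)
  have k2 := (sr_I4 α u hV).smul (-1)
  have k3 := (sr_I4 α u (Function.HasTemperateGrowth.const (1 : ℝ))).smul lam
  have k4 := (sr_D3 hV h lam t α u).smul (n + 2 * α)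
  have k5 := (sr_D3 hV h lam t (α - 1) u).smul (-(2 * α))
  refine ((((k1.add k2).add k3).add k4).add k5).congr fun z => ?_
  have e : h ^ 2 * inner ℝ (slap u z) (Zf u z) = (V z - lam) * inner ℝ (u z) (Zf u z)
      - t * inner ℝ (Complex.I * u z) (Zf u z) - inner ℝ (ff V h lam t u z) (Zf u z) := by
    rw [← real_inner_smul_left, lap_eq hV h lam t, inner_sub_left, inner_sub_left,
      real_inner_smul_left, real_inner_smul_left]
  simp only [fderiv_fun_const, Pi.zero_apply, zero_apply, dw, qw]
  linear_combination (2 * Aw z ^ α) * e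

theorem sr_main_ge (e p q g m U y k β σ r : ℝ) (he : 0 ≤ e) (hp : 0 ≤ p) (hq : 0 ≤ q)
    (hq1 : q ≤ 1) (hm : m ≤ g) (hβ : 0 ≤ β) (hβ' : β ≤ 1 / 2) (hσ : 0 ≤ σ) (hσ' : σ ≤ 1 / 2)
    (hr : r ≤ 1) (hU : 0 ≤ U) :
    2 * β * (p * e) * (g - 2 * k * y + k ^ 2 * r * U) + 2 * σ * (q * e) * (g + k ^ 2 * U) ≤
    (p * e) * (2 * g + (4 * β - 2) * m) - 4 * k * β * (p * e) * y + 2 * e * (2 * g - 2 * m)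
      - (q * e) * (2 * g - (2 + 4 * σ) * m) - 2 * β * (p * e) * (g - k ^ 2 * U)
      - 2 * σ * (q * e) * (g - k ^ 2 * U) := by
  have h1 : 0 ≤ p * e * (2 * (1 - 2 * β) * (g - m) + 2 * β * (k ^ 2 * ((1 - r) * U))) := by
    have : 0 ≤ 1 - 2 * β := by linarith
    have : 0 ≤ g - m := by linarith
    have : 0 ≤ 1 - r := by linarith
    positivity
  have h2 : 0 ≤ e * ((4 - 2 * q - 4 * σ * q) * (g - m)) := by
    have : 0 ≤ 4 - 2 * q - 4 * σ * q := by nlinarith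
    have : 0 ≤ g - m := by linarith
    positivity
  linear_combination h1 + h2

/-- the terms with a factor `t/h` -/
theorem sr_t_ge (p q g U y k vV l : ℝ) (k₀ Cv : ℝ) (hk₀ : 0 < k₀) (hk : k₀ ≤ k)
    (hp : 0 ≤ p) (hq : 0 ≤ q) (hq1 : q ≤ 1) (hg : 0 ≤ g) (hU : 0 ≤ U) (hy : y ^ 2 ≤ g * U)
    (hv : p * |vV| ≤ Cv) (hv' : |vV| ≤ Cv) (hl : p * |l| ≤ Cv) (lam : ℝ) (hlam : k ^ 2 = lam)
    (C : ℝ) (hC : 2 * Cv / k₀ + 2 + 2 * Cv + 2 * lam ≤ C) :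
    0 ≤ -2 * p * y - 4 * y + 2 * q * y + 2 * k * p * U
      + (p / k) * (g + (vV - lam) * U - l * U) + 2 * (g + (vV - lam) * U) + C * U := by
  have hk' : 0 < k := lt_of_lt_of_le hk₀ hk
  have hyk : 0 ≤ g + k ^ 2 * U - 2 * k * y := by
    have h1 : (2 * k * y) ^ 2 ≤ (g + k ^ 2 * U) ^ 2 := by
      have : k ^ 2 * y ^ 2 ≤ k ^ 2 * (g * U) := by gcongr
      nlinarith [sq_nonneg (g - k ^ 2 * U)]
    have := abs_le_of_sq_le_sq' h1 (by positivity)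
    linarith [this.2]
  have hy2 : |y| ≤ (g + U) / 2 := by
    apply abs_le_of_sq_le_sq _ (by positivity)
    nlinarith [sq_nonneg (g - U)]
  have h1 : 0 ≤ (p / k) * (g + k ^ 2 * U - 2 * k * y) := by positivity
  have h1' : (p / k) * (g + k ^ 2 * U - 2 * k * y)
      = (p / k) * (g - lam * U) + 2 * k * p * U - 2 * p * y := by
    rw [← hlam]; field_simp; ring
  have hq2 : -(2 * (g + U)) ≤ - 4 * y + 2 * q * y := by
    have : |(4 - 2 * q) * y| ≤ 4 * ((g + U) / 2) := by
      rw [abs_mul]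
      have : |4 - 2 * q| ≤ 4 := by rw [abs_le]; constructor <;> linarith
      gcongr
    have := (abs_le.mp this).2
    linarith
  have hpk : -(2 * Cv / k₀) ≤ (p / k) * (vV - l) := by
    have h2 : |(p / k) * (vV - l)| ≤ 2 * Cv / k₀ := by
      rw [abs_mul, abs_of_nonneg (by positivity : 0 ≤ p / k)]
      calc p / k * |vV - l| ≤ p / k * (|vV| + |l|) := by gcongr; exact abs_sub _ _
        _ = (p * |vV| + p * |l|) / k := by ring
        _ ≤ (Cv + Cv) / k := by gcongr
        _ ≤ (Cv + Cv) / k₀ := by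
          have : 0 ≤ Cv := le_trans (abs_nonneg _) hv'
          gcongr
        _ = _ := by ring
    exact (abs_le.mp h2).1
  have h3 : -(2 * Cv / k₀) * U ≤ (p / k) * (vV - l) * U := by gcongr
  have h4 : -Cv * U ≤ vV * U := by
    have := (abs_le.mp hv').1
    gcongr
  have h5 : (2 * Cv / k₀ + 2 + 2 * Cv + 2 * lam) * U ≤ C * U := by gcongr
  linarith [h1, h1']

theorem sr_ell_le (n : ℕ) (α A : ℝ) (hα : |α| ≤ 2) (hA : 1 ≤ A) :
    |ellw n α A| ≤ (4 * n + 48) * A ^ (α - 1) := by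
  unfold ellw
  have hn : (0 : ℝ) ≤ n := Nat.cast_nonneg n
  obtain ⟨h1, h2⟩ := abs_le.mp hα
  have hp : 0 < A ^ (α - 1) := Real.rpow_pos_of_pos (by linarith) _
  have hp2 : 0 < A ^ (α - 2) := Real.rpow_pos_of_pos (by linarith) _
  have hle : A ^ (α - 2) ≤ A ^ (α - 1) := Real.rpow_le_rpow_of_exponent_le hA (by linarith)
  have b1 : |2 * α * (n + 2 * α - 2)| ≤ 4 * n + 24 := by
    rw [abs_mul]
    have : |2 * α| ≤ 4 := by rw [abs_le]; constructor <;> linarith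
    have : |(n : ℝ) + 2 * α - 2| ≤ n + 6 := by rw [abs_le]; constructor <;> linarith
    calc _ ≤ 4 * ((n : ℝ) + 6) := by gcongr
      _ = _ := by ring
  have b2 : |4 * α * (α - 1)| ≤ 24 := by
    rw [abs_mul]
    have : |4 * α| ≤ 8 := by rw [abs_le]; constructor <;> linarith
    have : |α - 1| ≤ 3 := by rw [abs_le]; constructor <;> linarith
    calc _ ≤ 8 * (3 : ℝ) := by gcongr
      _ = _ := by ring
  calc _ ≤ |2 * α * (n + 2 * α - 2) * A ^ (α - 1)| + |4 * α * (α - 1) * A ^ (α - 2)| := abs_sub _ _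
    _ = |2 * α * (n + 2 * α - 2)| * A ^ (α - 1) + |4 * α * (α - 1)| * A ^ (α - 2) := by
      rw [abs_mul, abs_mul (4 * α * (α - 1)), abs_of_pos hp, abs_of_pos hp2]
    _ ≤ (4 * n + 24) * A ^ (α - 1) + 24 * A ^ (α - 1) := by gcongr
    _ = _ := by ring

theorem sr_q_le (n : ℕ) (α A : ℝ) (hα : |α| ≤ 1) (hA : 1 ≤ A) :
    |qw n α A| ≤ ((n + 4) * (4 * n + 48)) * A ^ (α - 1) := by
  unfold qw
  have hn : (0 : ℝ) ≤ n := Nat.cast_nonneg n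
  obtain ⟨h1, h2⟩ := abs_le.mp hα
  have i1 := sr_ell_le n α A (by linarith) hA
  have i2 := sr_ell_le n (α - 1) A (by rw [abs_le]; constructor <;> linarith) hA
  have hle : A ^ (α - 1 - 1) ≤ A ^ (α - 1) := Real.rpow_le_rpow_of_exponent_le hA (by linarith)
  have hp : 0 < A ^ (α - 1) := Real.rpow_pos_of_pos (by linarith) _
  calc _ ≤ |(n + 2 * α) * ellw n α A| + |2 * α * ellw n (α - 1) A| := abs_sub _ _
    _ = |n + 2 * α| * |ellw n α A| + |2 * α| * |ellw n (α - 1) A| := by rw [abs_mul, abs_mul (2 * α)]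
    _ ≤ (n + 2) * ((4 * n + 48) * A ^ (α - 1)) + 2 * ((4 * n + 48) * A ^ (α - 1)) := by
      have : |(n : ℝ) + 2 * α| ≤ n + 2 := by rw [abs_le]; constructor <;> linarith
      have : |2 * α| ≤ 2 := by rw [abs_le]; constructor <;> linarith
      have i3 : |ellw n (α - 1) A| ≤ (4 * n + 48) * A ^ (α - 1) := i2.trans (by gcongr)
      gcongr
    _ = _ := by ring

theorem sr_d_le (n : ℕ) (α A : ℝ) (hα : |α| ≤ 1) (hA : 1 ≤ A) :
    |dw n α A| ≤ (n + 4) * A ^ α := by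
  unfold dw
  have hn : (0 : ℝ) ≤ n := Nat.cast_nonneg n
  obtain ⟨h1, h2⟩ := abs_le.mp hα
  have hle : A ^ (α - 1) ≤ A ^ α := Real.rpow_le_rpow_of_exponent_le hA (by linarith)
  have hp : 0 < A ^ (α - 1) := Real.rpow_pos_of_pos (by linarith) _
  have hp2 : 0 < A ^ α := Real.rpow_pos_of_pos (by linarith) _
  calc _ ≤ |(n + 2 * α) * A ^ α| + |2 * α * A ^ (α - 1)| := abs_sub _ _
    _ = |n + 2 * α| * A ^ α + |2 * α| * A ^ (α - 1) := by
      rw [abs_mul, abs_mul (2 * α), abs_of_pos hp, abs_of_pos hp2]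
    _ ≤ (n + 2) * A ^ α + 2 * A ^ α := by
      have : |(n : ℝ) + 2 * α| ≤ n + 2 := by rw [abs_le]; constructor <;> linarith
      have : |2 * α| ≤ 2 := by rw [abs_le]; constructor <;> linarith
      gcongr
    _ = _ := by ring
end

section
open Filter MeasureTheory SchwartzMap LineDeriv

theorem sr_alg (h k : ℝ) (hh : h ≠ 0) (hk : k ≠ 0) (p e q g M2 X U vd vV Fr Fi FZ d1 d2 d3 q1 q2 q3
    l1 l3 lb lam t C β σ : ℝ) (hlam : k ^ 2 = lam) :
    (4 * (β - 1 / 2) * (p * e * e ^ 2) * M2 + 2 * (p * e) * g - 2 * t * (p * e) * X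
      - 2 * (p * e) * FZ - (p * e) * vd * U - d1 * Fr - 1 / 2 * h ^ 2 * q1 * U)
    + 2 * (4 * (-(1 / 2)) * (e * e ^ 2) * M2 + 2 * e * g - 2 * t * e * X
      - 2 * e * FZ - e * vd * U - d2 * Fr - 1 / 2 * h ^ 2 * q2 * U)
    + (-1) * (4 * (-(1 / 2) - σ) * (q * e * e ^ 2) * M2 + 2 * (q * e) * g - 2 * t * (q * e) * X
      - 2 * (q * e) * FZ - (q * e) * vd * U - d3 * Fr - 1 / 2 * h ^ 2 * q3 * U)
    + (-(2 * k / h)) * (-(t * p * U) - p * Fi + 2 * β * (p * e ^ 2) * (h ^ 2 * X))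
    + (-(2 * β)) * ((p * e) * g + (p * e) * ((vV - lam) * U - Fr) - 1 / 2 * h ^ 2 * l1 * U)
    + (-(2 * σ)) * ((q * e) * g + (q * e) * ((vV - lam) * U - Fr) - 1 / 2 * h ^ 2 * l3 * U)
    + (t / (h * k)) * (p * g + p * ((vV - lam) * U - Fr) - 1 / 2 * h ^ 2 * lb * U)
    + (2 * (t / h)) * (1 * g + 1 * ((vV - lam) * U - Fr) - 1 / 2 * h ^ 2 * 0 * U)
    + (-(C / h)) * (-(t * 1 * U) - 1 * Fi + 2 * 0 * 1 * (h ^ 2 * X))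
    = ((p * e) * (2 * g + (4 * β - 2) * (M2 * e ^ 2)) - 4 * k * β * (p * e) * (h * X * e)
        + 2 * e * (2 * g - 2 * (M2 * e ^ 2))
      - (q * e) * (2 * g - (2 + 4 * σ) * (M2 * e ^ 2)) - 2 * β * (p * e) * (g - k ^ 2 * U)
      - 2 * σ * (q * e) * (g - k ^ 2 * U))
    + (t / h) * (-2 * p * (h * X * e) - 4 * (h * X * e) + 2 * q * (h * X * e) + 2 * k * p * U
      + (p / k) * (g + (vV - lam) * U - (1 / 2 * h ^ 2 * lb / p) * U)
      + 2 * (g + (vV - lam) * U) + C * U)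
    + (-(2 * p + 4 - 2 * q) * (e * FZ) + (-(d1 + 2 * d2 - d3) + (2 * β * (p * e) + 2 * σ * (q * e))
        - t / (h * k) * p - 2 * (t / h)) * Fr + (2 * k / h * p + C / h) * Fi)
    + (-(p * e + 2 * e - q * e) * vd - (2 * β * (p * e) + 2 * σ * (q * e)) * vV) * U
    + h ^ 2 * (-(1 / 2) * (q1 + 2 * q2 - q3) + β * l1 + σ * l3) * U
    + t / (h * k) * (1 / 2 * h ^ 2 * lb * (p / p - 1)) * U  := by
  subst hlam
  field_simp
  ring

noncomputable def Qf {n : ℕ} (h lam : ℝ) (u : 𝓢(SRE n, ℂ)) (z : SRE n) : ℝ :=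
  ∑ j, ‖h • dj j u z - (√lam * Aw z ^ (-(1 / 2) : ℝ) * z j) • (Complex.I * u z)‖ ^ 2

theorem Qf_eq {n : ℕ} (h lam : ℝ) (u : 𝓢(SRE n, ℂ)) (z : SRE n) :
    Qf h lam u z = h ^ 2 * Gf u z
      - 2 * √lam * (h * inner ℝ (Complex.I * u z) (Zf u z) * Aw z ^ (-(1 / 2) : ℝ))
      + √lam ^ 2 * ((Aw z ^ (-(1 / 2) : ℝ)) ^ 2 * (Aw z - 1)) * ‖u z‖ ^ 2 := by
  unfold Qf Gf Zf
  rw [← sum_coord_sq, inner_sum]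
  simp only [norm_sub_sq_real, real_inner_smul_left, real_inner_smul_right, norm_smul, norm_I_mul,
    mul_pow, Real.norm_eq_abs, sq_abs, Finset.mul_sum, Finset.sum_mul, ← Finset.sum_add_distrib,
    ← Finset.sum_sub_distrib]
  refine Finset.sum_congr rfl fun j _ => ?_
  rw [real_inner_comm (Complex.I * u z)]
  ring

theorem Zf_le {n : ℕ} (u : 𝓢(SRE n, ℂ)) (z : SRE n) : ‖Zf u z‖ ^ 2 ≤ (Aw z - 1) * Gf u z := by
  unfold Zf Gf
  rw [← sum_coord_sq]
  have h1 : ‖∑ k, z k • dj k u z‖ ≤ ∑ k, |z k| * ‖dj k u z‖ := by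
    refine (norm_sum_le _ _).trans (le_of_eq ?_)
    refine Finset.sum_congr rfl fun j _ => ?_
    rw [norm_smul, Real.norm_eq_abs]
  calc _ ≤ (∑ k, |z k| * ‖dj k u z‖) ^ 2 := by gcongr
    _ ≤ _ := by
      refine (Finset.sum_mul_sq_le_sq_mul_sq _ _ _).trans (le_of_eq ?_)
      simp only [sq_abs, ← sq]

set_option maxHeartbeats 1600000 in
theorem partA_lower {n : ℕ} {V : SRE n → ℝ} (hV : V.HasTemperateGrowth) (γ Cv : ℝ)
    (hVb : ∀ z, |V z| ≤ Cv * Aw z ^ (-(γ / 2))) (hVd : ∀ z, |fderiv ℝ V z z| ≤ Cv * Aw z ^ (-(γ / 2)))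
    (a b : ℝ) (ha : 0 < a) (β σ : ℝ) (hβ : 0 < β) (hβ4 : β ≤ 1 / 4) (hσ : 0 < σ)
    (hσ4 : σ ≤ 1 / 4) (hβγ : β ≤ γ / 2) :
    ∃ C1 C2 : ℝ, 0 < C1 ∧ 0 < C2 ∧ ∀ h : ℝ, 0 < h → h ≤ 1 → ∀ lam ∈ Set.Icc a b, ∀ t : ℝ, 0 < t →
      t ≤ 1 → ∀ u : 𝓢(SRE n, ℂ), ∃ D : SRE n → ℝ, NullInt D ∧ ∀ z,
        2 * β * Aw z ^ (β - 1 / 2) * Qf h lam u z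
          + 2 * σ * Aw z ^ (-(1 / 2) - σ) * (h ^ 2 * Gf u z + lam * ‖u z‖ ^ 2)
          - C1 * Aw z ^ (β - 1 / 2) * (Aw z ^ (-(γ / 2)) + h ^ 2 * (Aw z)⁻¹) * ‖u z‖ ^ 2
          - C2 / h * Aw z ^ β * (‖ff V h lam t u z‖ * (‖u z‖ + √(h ^ 2 * Gf u z))) ≤ D z := by
  have hCv : 0 ≤ Cv := by
    have := (abs_nonneg _).trans (hVb 0)
    exact nonneg_of_mul_nonneg_left this (Real.rpow_pos_of_pos (Aw_pos _) _)
  set cl : ℝ := 4 * n + 48 with hcl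
  have hcl0 : 0 ≤ cl := by positivity
  set C : ℝ := 2 * (Cv + cl) / √a + 2 + 2 * (Cv + cl) + 2 * b with hC
  set cq : ℝ := (n + 4) * cl with hcq
  refine ⟨5 * Cv + 2 * cq + cl + 1, 8 + (4 * (n + 4) + 2 * √b + 1 + 1 / √a + 2 + |C|), by positivity,
    by positivity, ?_⟩
  intro h h0 h1 lam hlam t t0 t1 u
  have hlam0 : 0 < lam := lt_of_lt_of_le ha hlam.1
  set k := √lam with hkdef
  have hk2 : k ^ 2 = lam := Real.sq_sqrt hlam0.le
  have ka : √a ≤ k := Real.sqrt_le_sqrt hlam.1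
  have kb : k ≤ √b := Real.sqrt_le_sqrt hlam.2
  have sa : 0 < √a := Real.sqrt_pos.2 ha
  have k0 : 0 < k := lt_of_lt_of_le sa ka
  refine ⟨_, ((((((((sr_D1 hV h lam t (β - 1 / 2) u).add ((sr_D1 hV h lam t (-(1 / 2)) u).smul 2)).add
    ((sr_D1 hV h lam t (-(1 / 2) - σ) u).smul (-1))).add
    ((sr_D2 hV h lam t β u).smul (-(2 * k / h)))).add
    ((sr_D3 hV h lam t (β - 1 / 2) u).smul (-(2 * β)))).add
    ((sr_D3 hV h lam t (-(1 / 2) - σ) u).smul (-(2 * σ)))).add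
    ((sr_D3 hV h lam t β u).smul (t / (h * k)))).add
    ((sr_D3 hV h lam t 0 u).smul (2 * (t / h)))).add
    ((sr_D2 hV h lam t 0 u).smul (-(C / h))), fun z => ?_⟩
  have A1 := Aw_one_le z
  have A0 := Aw_pos z
  have hVbz := hVb z
  have hVdz := hVd z
  have hZle := Zf_le u z
  rw [Qf_eq, ← hkdef]
  have b1 := sr_q_le n (β - 1 / 2) (Aw z) (by rw [abs_le]; constructor <;> linarith) A1
  have b2 := sr_q_le n (-(1 / 2)) (Aw z) (by rw [abs_le]; constructor <;> norm_num) A1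
  have b3 := sr_q_le n (-(1 / 2) - σ) (Aw z) (by rw [abs_le]; constructor <;> linarith) A1
  have b4 := sr_d_le n (β - 1 / 2) (Aw z) (by rw [abs_le]; constructor <;> linarith) A1
  have b5 := sr_d_le n (-(1 / 2)) (Aw z) (by rw [abs_le]; constructor <;> norm_num) A1
  have b6 := sr_d_le n (-(1 / 2) - σ) (Aw z) (by rw [abs_le]; constructor <;> linarith) A1
  have b7 := sr_ell_le n (β - 1 / 2) (Aw z) (by rw [abs_le]; constructor <;> linarith) A1
  have b8 := sr_ell_le n (-(1 / 2) - σ) (Aw z) (by rw [abs_le]; constructor <;> linarith) A1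
  have b9 := sr_ell_le n β (Aw z) (by rw [abs_le]; constructor <;> linarith) A1
  have hl0 : ellw n 0 (Aw z) = 0 := by simp [ellw]
  have hpg : Aw z ^ β * Aw z ^ (-(γ / 2)) ≤ 1 := by
    rw [← Real.rpow_add A0]
    exact Real.rpow_le_one_of_one_le_of_nonpos A1 (by linarith)
  have hpb : Aw z ^ β * Aw z ^ (β - 1) ≤ Aw z ^ β := by
    have : Aw z ^ (β - 1) ≤ 1 := Real.rpow_le_one_of_one_le_of_nonpos A1 (by linarith)
    exact mul_le_of_le_one_right (Real.rpow_pos_of_pos A0 β).le this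
  rw [hl0]
  set A := Aw z with hA
  have r1 : A ^ (β - 1 / 2) = A ^ β * A ^ (-(1 / 2) : ℝ) := by
    rw [← Real.rpow_add A0]; congr 1
  have re2 : (A ^ (-(1 / 2) : ℝ)) ^ 2 = A⁻¹ := by
    rw [← Real.rpow_natCast, ← Real.rpow_mul A0.le]; norm_num [Real.rpow_neg_one]
  have r2 : A ^ (β - 1 / 2 - 1) = A ^ β * A ^ (-(1 / 2) : ℝ) * (A ^ (-(1 / 2) : ℝ)) ^ 2 := by
    rw [re2, ← Real.rpow_neg_one, ← Real.rpow_add A0, ← Real.rpow_add A0]; congr 1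
  have r3 : A ^ (-(1 / 2) - 1 : ℝ) = A ^ (-(1 / 2) : ℝ) * (A ^ (-(1 / 2) : ℝ)) ^ 2 := by
    rw [re2, ← Real.rpow_neg_one, ← Real.rpow_add A0]; congr 1
  have r4 : A ^ (-(1 / 2) - σ) = A ^ (-σ) * A ^ (-(1 / 2) : ℝ) := by
    rw [← Real.rpow_add A0]; congr 1; ring
  have r5 : A ^ (-(1 / 2) - σ - 1) = A ^ (-σ) * A ^ (-(1 / 2) : ℝ) * (A ^ (-(1 / 2) : ℝ)) ^ 2 := by
    rw [re2, ← Real.rpow_neg_one, ← Real.rpow_add A0, ← Real.rpow_add A0]; congr 1; ring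
  have r6 : A ^ (β - 1) = A ^ β * (A ^ (-(1 / 2) : ℝ)) ^ 2 := by
    rw [re2, ← Real.rpow_neg_one, ← Real.rpow_add A0]; congr 1
  have re1 : A ^ (-(1 / 2) : ℝ) ≤ 1 := Real.rpow_le_one_of_one_le_of_nonpos A1 (by norm_num)
  have re0 : 0 < A ^ (-(1 / 2) : ℝ) := Real.rpow_pos_of_pos A0 _
  have rp : 1 ≤ A ^ β := Real.one_le_rpow A1 hβ.le
  have rq0 : 0 < A ^ (-σ) := Real.rpow_pos_of_pos A0 _
  have rq1 : A ^ (-σ) ≤ 1 := Real.rpow_le_one_of_one_le_of_nonpos A1 (by linarith)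
  have rg0 : 0 < A ^ (-(γ / 2)) := Real.rpow_pos_of_pos A0 _
  have rg1 : A ^ (-(γ / 2)) ≤ 1 := Real.rpow_le_one_of_one_le_of_nonpos A1 (by linarith)
  simp only [r2, r1, r3, r5, r4, r6, Real.rpow_zero, ← re2] at b1 b2 b3 b4 b5 b6 b7 b8 b9 hpb ⊢
  have reA : (A ^ (-(1 / 2) : ℝ)) ^ 2 * A = 1 := by rw [re2]; field_simp
  have hFr : |inner ℝ (u z) (ff V h lam t u z)| ≤ ‖u z‖ * ‖ff V h lam t u z‖ :=
    abs_real_inner_le_norm _ _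
  have hFi : |inner ℝ (Complex.I * u z) (ff V h lam t u z)| ≤ ‖u z‖ * ‖ff V h lam t u z‖ := by
    have := abs_real_inner_le_norm (Complex.I * u z) (ff V h lam t u z)
    rwa [norm_I_mul] at this
  have hFZ : |inner ℝ (ff V h lam t u z) (Zf u z)| ≤ ‖ff V h lam t u z‖ * ‖Zf u z‖ :=
    abs_real_inner_le_norm _ _
  have hX : (inner ℝ (Complex.I * u z) (Zf u z)) ^ 2 ≤ ‖Zf u z‖ ^ 2 * ‖u z‖ ^ 2 := by
    have := abs_real_inner_le_norm (Complex.I * u z) (Zf u z)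
    rw [norm_I_mul] at this
    calc _ = |inner ℝ (Complex.I * u z) (Zf u z)| ^ 2 := (sq_abs _).symm
      _ ≤ (‖u z‖ * ‖Zf u z‖) ^ 2 := by gcongr
      _ = _ := by ring
  have hG0 : 0 ≤ Gf u z := Finset.sum_nonneg fun _ _ => by positivity
  have hz0 : A ^ (0 - 1 : ℝ) * inner ℝ (Complex.I * u z) (Zf u z) * 0 = 0 := by ring
  generalize inner ℝ (u z) (ff V h lam t u z) = Fr at *
  generalize inner ℝ (Complex.I * u z) (ff V h lam t u z) = Fi at *
  generalize inner ℝ (ff V h lam t u z) (Zf u z) = FZ at *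
  generalize inner ℝ (Complex.I * u z) (Zf u z) = X at *
  generalize ‖Zf u z‖ = NZ at *
  have hF0 : 0 ≤ ‖ff V h lam t u z‖ := norm_nonneg _
  have hU0 : 0 ≤ ‖u z‖ := norm_nonneg _
  generalize ‖ff V h lam t u z‖ = F at *
  generalize ‖u z‖ = U at *
  generalize fderiv ℝ V z z = vd at *
  generalize V z = vV at *
  generalize A ^ (-(1 / 2) : ℝ) = e at *
  generalize A ^ β = p at *
  generalize A ^ (-σ) = q at *
  generalize A ^ (-(γ / 2)) = w at *
  generalize A ^ (0 - 1 : ℝ) = A00 at *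
  generalize qw n (β - 1 / 2) A = q1 at *
  generalize qw n (-(1 / 2)) A = q2 at *
  generalize qw n (-(1 / 2) - σ) A = q3 at *
  generalize dw n (β - 1 / 2) A = d1 at *
  generalize dw n (-(1 / 2)) A = d2 at *
  generalize dw n (-(1 / 2) - σ) A = d3 at *
  generalize ellw n (β - 1 / 2) A = l1 at *
  generalize ellw n (-(1 / 2) - σ) A = l3 at *
  generalize ellw n β A = lb at *
  generalize Gf u z = G at *
  have cq0 : 0 ≤ cq := by positivity
  rw [← hcl] at b1 b2 b3 b7 b8 b9
  rw [← hcq] at b1 b2 b3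
  clear_value A k cq cl C
  clear hVb hVd r1 r2 r3 r4 r5 r6 re2
  have he2 : e ^ 2 * (A - 1) ≤ 1 := by
    have := sq_nonneg e
    linarith
  have hm : h ^ 2 * NZ ^ 2 * e ^ 2 ≤ h ^ 2 * G := by
    calc h ^ 2 * NZ ^ 2 * e ^ 2 ≤ h ^ 2 * ((A - 1) * G) * e ^ 2 := by gcongr
      _ = h ^ 2 * G * (e ^ 2 * (A - 1)) := by ring
      _ ≤ h ^ 2 * G * 1 := by gcongr
      _ = _ := by ring
  have hy : (h * X * e) ^ 2 ≤ h ^ 2 * G * U ^ 2 := by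
    calc (h * X * e) ^ 2 = h ^ 2 * e ^ 2 * X ^ 2 := by ring
      _ ≤ h ^ 2 * e ^ 2 * (NZ ^ 2 * U ^ 2) := by gcongr
      _ = (h ^ 2 * NZ ^ 2 * e ^ 2) * U ^ 2 := by ring
      _ ≤ _ := by gcongr
  have p0 : 0 < p := by linarith
  have hpe : p * e ^ 2 ≤ 1 := le_of_mul_le_mul_left (by linarith : p * (p * e ^ 2) ≤ p * 1) p0
  have hh2 : h ^ 2 ≤ 1 := pow_le_one₀ h0.le h1
  have hlb : |lb| ≤ cl := b9.trans (mul_le_of_le_one_right hcl0 hpe)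
  set S := √(h ^ 2 * G) with hS
  clear_value S
  have hS0 : 0 ≤ S := hS ▸ Real.sqrt_nonneg _
  have hh : 1 ≤ 1 / h := by rw [le_div_iff₀ h0]; linarith
  have heF : |e * FZ| ≤ 1 / h * (F * S) := by
    have h3 : |h * e * FZ| ≤ F * S := by
      have h4 : |h * e * NZ| ≤ S := by
        rw [hS]
        apply Real.abs_le_sqrt
        calc _ = h ^ 2 * NZ ^ 2 * e ^ 2 := by ring
          _ ≤ _ := hm
      have he0 : 0 ≤ h * e := by positivity
      calc |h * e * FZ| = h * e * |FZ| := by rw [abs_mul, abs_of_nonneg he0]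
        _ ≤ h * e * (F * NZ) := by gcongr
        _ = F * (h * e * NZ) := by ring
        _ ≤ F * |h * e * NZ| := by gcongr; exact le_abs_self _
        _ ≤ _ := by gcongr
    rw [show e * FZ = 1 / h * (h * e * FZ) by field_simp, abs_mul,
      abs_of_nonneg (by positivity : 0 ≤ 1 / h)]
    gcongr
  have pe1 : p * e ≤ p := mul_le_of_le_one_right p0.le re1
  have qe1 : q * e ≤ p := (mul_le_one₀ rq1 re0.le re1).trans rp
  have e1p : e ≤ p := by linarith
  have f1 : |(2 * p + 4 - 2 * q) * (e * FZ)| ≤ 8 * (p * (1 / h)) * (F * S) := by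
    rw [abs_mul]
    have : |2 * p + 4 - 2 * q| ≤ 8 * p := by rw [abs_le]; constructor <;> linarith
    calc _ ≤ 8 * p * (1 / h * (F * S)) := by gcongr
      _ = _ := by ring
  have hp1 : p ≤ p * (1 / h) := le_mul_of_one_le_right p0.le hh
  have f2 : |(-(d1 + 2 * d2 - d3) + (2 * β * (p * e) + 2 * σ * (q * e))
        - t / (h * k) * p - 2 * (t / h)) * Fr| ≤
      ((4 * (n + 4) + 1 + 1 / √a + 2) * (p * (1 / h))) * (F * U) := by
    rw [abs_mul, mul_comm F U]
    have c1 : |d1| ≤ (n + 4) * p := b4.trans (by gcongr)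
    have c2 : |d2| ≤ (n + 4) * p := b5.trans (by gcongr)
    have c3 : |d3| ≤ (n + 4) * p := b6.trans (by gcongr)
    have c4 : 2 * β * (p * e) ≤ 1 / 2 * p := by
      calc 2 * β * (p * e) ≤ 2 * (1 / 4) * p := by gcongr
        _ = _ := by ring
    have c5 : 2 * σ * (q * e) ≤ 1 / 2 * p := by
      calc 2 * σ * (q * e) ≤ 2 * (1 / 4) * p := by gcongr
        _ = _ := by ring
    have c4' : 0 ≤ 2 * β * (p * e) := by positivity
    have c5' : 0 ≤ 2 * σ * (q * e) := by positivity
    have c6 : t / (h * k) * p ≤ 1 / √a * (p * (1 / h)) := by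
      calc t / (h * k) * p ≤ 1 / (h * √a) * p := by gcongr
        _ = _ := by field_simp
    have c6' : 0 ≤ t / (h * k) * p := by positivity
    have c7 : 2 * (t / h) ≤ 2 * (p * (1 / h)) := by
      have h3 : t / h ≤ 1 / h := by gcongr
      have h4 : 1 / h ≤ p * (1 / h) := le_mul_of_one_le_left (by positivity) rp
      linarith
    have c7' : 0 ≤ 2 * (t / h) := by positivity
    have c8 : (4 * (n + 4) + 1 : ℝ) * p ≤ (4 * (n + 4) + 1) * (p * (1 / h)) := by gcongr
    have : |(-(d1 + 2 * d2 - d3) + (2 * β * (p * e) + 2 * σ * (q * e))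
        - t / (h * k) * p - 2 * (t / h))| ≤ (4 * (n + 4) + 1 + 1 / √a + 2) * (p * (1 / h)) := by
      rw [abs_le] at c1 c2 c3 ⊢
      constructor <;> linarith
    gcongr
  have f3 : |(2 * k / h * p + C / h) * Fi| ≤ ((2 * √b + |C|) * (p * (1 / h))) * (F * U) := by
    rw [abs_mul, mul_comm F U]
    have : |2 * k / h * p + C / h| ≤ (2 * √b + |C|) * (p * (1 / h)) := by
      calc _ ≤ |2 * k / h * p| + |C / h| := abs_add_le _ _
        _ = 2 * k * (p * (1 / h)) + |C| * (1 / h) := by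
          rw [abs_of_nonneg (by positivity), abs_div, abs_of_pos h0]; ring
        _ ≤ 2 * √b * (p * (1 / h)) + |C| * (p * (1 / h)) := by
          have : 1 / h ≤ p * (1 / h) := le_mul_of_one_le_left (by positivity) rp
          gcongr
        _ = _ := by ring
    gcongr
  have f4 : |(-(p * e + 2 * e - q * e) * vd - (2 * β * (p * e) + 2 * σ * (q * e)) * vV) * U ^ 2|
      ≤ 5 * Cv * (p * e) * w * U ^ 2 := by
    rw [abs_mul, abs_of_nonneg (by positivity : 0 ≤ U ^ 2)]
    have g1 : |-(p * e + 2 * e - q * e)| ≤ 3 * (p * e) := by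
      have h3 : e ≤ p * e := le_mul_of_one_le_left re0.le rp
      have h4 : q * e ≤ e := mul_le_of_le_one_left re0.le rq1
      have h5 : 0 < q * e := mul_pos rq0 re0
      rw [abs_le]; constructor <;> linarith
    have g2 : |2 * β * (p * e) + 2 * σ * (q * e)| ≤ p * e := by
      have h3 : q * e ≤ p * e := by gcongr; linarith
      rw [abs_of_nonneg (by positivity)]
      calc 2 * β * (p * e) + 2 * σ * (q * e) ≤ 2 * (1 / 4) * (p * e) + 2 * (1 / 4) * (p * e) := by gcongr
        _ = _ := by ring
    have : |-(p * e + 2 * e - q * e) * vd - (2 * β * (p * e) + 2 * σ * (q * e)) * vV|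
        ≤ 5 * Cv * (p * e) * w := by
      refine (abs_sub _ _).trans ?_
      rw [abs_mul, abs_mul]
      calc _ ≤ 3 * (p * e) * (Cv * w) + p * e * (Cv * w) := by gcongr
        _ ≤ _ := by
          have : 0 ≤ p * e * (Cv * w) := by positivity
          linarith
    gcongr
  have f5 : |h ^ 2 * (-(1 / 2) * (q1 + 2 * q2 - q3) + β * l1 + σ * l3) * U ^ 2|
      ≤ (2 * cq + cl) * (p * e) * (h ^ 2 * e ^ 2) * U ^ 2 := by
    rw [abs_mul, abs_mul, abs_of_nonneg (by positivity : 0 ≤ U ^ 2),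
      abs_of_nonneg (by positivity : 0 ≤ h ^ 2)]
    have m1 : e * e ^ 2 ≤ p * e * e ^ 2 := by
      have h3 : 1 * (e * e ^ 2) ≤ p * (e * e ^ 2) := by gcongr
      linarith
    have m2 : q * e * e ^ 2 ≤ p * e * e ^ 2 := by
      have : q ≤ p := by linarith
      gcongr
    have c1 : |q1| ≤ cq * (p * e * e ^ 2) := b1
    have c2 : |q2| ≤ cq * (p * e * e ^ 2) := b2.trans (by gcongr)
    have c3 : |q3| ≤ cq * (p * e * e ^ 2) := b3.trans (by gcongr)
    have c4 : |β * l1| ≤ 1 / 4 * (cl * (p * e * e ^ 2)) := by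
      rw [abs_mul, abs_of_pos hβ]; gcongr
    have c5 : |σ * l3| ≤ 1 / 4 * (cl * (p * e * e ^ 2)) := by
      rw [abs_mul, abs_of_pos hσ]; gcongr; exact b8.trans (by gcongr)
    have : |-(1 / 2) * (q1 + 2 * q2 - q3) + β * l1 + σ * l3| ≤ (2 * cq + cl) * (p * e * e ^ 2) := by
      have : 0 ≤ cl * (p * e * e ^ 2) := by positivity
      rw [abs_le] at c1 c2 c3 c4 c5 ⊢
      constructor <;> linarith
    calc _ ≤ h ^ 2 * ((2 * cq + cl) * (p * e * e ^ 2)) * U ^ 2 := by gcongr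
      _ = _ := by ring
  have ht := sr_t_ge p q (h ^ 2 * G) (U ^ 2) (h * X * e) k vV (1 / 2 * h ^ 2 * lb / p) (√a) (Cv + cl)
    sa ka p0.le rq0.le rq1 (by positivity) (by positivity) hy
    (by
      calc p * |vV| ≤ p * (Cv * w) := by gcongr
        _ = Cv * (p * w) := by ring
        _ ≤ Cv * 1 := by gcongr
        _ ≤ _ := by linarith)
    (by
      calc |vV| ≤ Cv * w := hVbz
        _ ≤ Cv * 1 := by gcongr
        _ ≤ _ := by linarith)
    (by
      rw [abs_div, abs_of_pos p0, abs_mul, abs_of_nonneg (by positivity : 0 ≤ 1 / 2 * h ^ 2)]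
      rw [mul_div_cancel₀ _ p0.ne']
      calc 1 / 2 * h ^ 2 * |lb| ≤ 1 / 2 * 1 * cl := by gcongr
        _ ≤ _ := by linarith)
    lam hk2 C (by rw [hC]; have := hlam.2; linarith)
  have ht' := mul_nonneg (by positivity : 0 ≤ t / h) ht
  have hmain := sr_main_ge e p q (h ^ 2 * G) (h ^ 2 * NZ ^ 2 * e ^ 2) (U ^ 2) (h * X * e) k β σ
    (e ^ 2 * (A - 1)) re0.le p0.le rq0.le rq1 hm hβ.le (by linarith) hσ.le (by linarith) he2
    (by positivity)
  have alg := sr_alg h k h0.ne' k0.ne' p e q (h ^ 2 * G) (h ^ 2 * NZ ^ 2) X (U ^ 2) vd vV Fr Fi FZ d1 d2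
    d3 q1 q2 q3 l1 l3 lb lam t C β σ hk2
  have hpp : p / p - 1 = 0 := by rw [div_self (by linarith)]; ring
  rw [hpp] at alg
  have g1 := (abs_le.mp f1).2
  have g2 := (abs_le.mp f2).1
  have g3 := (abs_le.mp f3).1
  have g4 := (abs_le.mp f4).1
  have g5 := (abs_le.mp f5).1
  have x1 : 0 ≤ (2 * cq + cl + 1) * (p * e) * w * U ^ 2 := by positivity
  have x2 : 0 ≤ (5 * Cv + 1) * (p * e) * (h ^ 2 * e ^ 2) * U ^ 2 := by positivity
  have x3 : 0 ≤ (4 * (n + 4) + 2 * √b + 1 + 1 / √a + 2 + |C|) * (p * (1 / h)) * (F * S) := by positivity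
  have x4 : 0 ≤ 8 * (p * (1 / h)) * (F * U) := by positivity
  rw [hk2] at hmain ⊢
  refine le_trans ?_ (le_of_eq (alg.symm.trans ?_))
  · rw [hk2]
    rw [show (8 + (4 * (n + 4) + 2 * √b + 1 + 1 / √a + 2 + |C|)) / h * p
      = (8 + (4 * (n + 4) + 2 * √b + 1 + 1 / √a + 2 + |C|)) * (p * (1 / h)) by ring]
    linarith only [hmain, ht', g1, g2, g3, g4, g5, x1, x2, x3, x4]
  · ring
end

section
open Filter MeasureTheory SchwartzMap LineDeriv

theorem sr_int_sq {n : ℕ} (α : ℝ) (a : 𝓢(SRE n, ℂ)) :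
    Integrable (fun z => Aw z ^ α * ‖a z‖ ^ 2) volume := by
  refine (sr_integrable_inner (Aw_temp α) a a).congr (Eventually.of_forall fun z => ?_)
  simp only [real_inner_self_eq_norm_sq]

theorem Gf_nonneg {n : ℕ} (u : 𝓢(SRE n, ℂ)) (z : SRE n) : 0 ≤ Gf u z :=
  Finset.sum_nonneg fun _ _ => by positivity

theorem sr_int_G {n : ℕ} (α : ℝ) (u : 𝓢(SRE n, ℂ)) :
    Integrable (fun z => Aw z ^ α * Gf u z) volume := by
  simp only [Gf, Finset.mul_sum]
  exact integrable_finsetSum _ fun j _ => sr_int_sq α (dj j u)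

theorem Qf_nonneg {n : ℕ} (h lam : ℝ) (u : 𝓢(SRE n, ℂ)) (z : SRE n) : 0 ≤ Qf h lam u z :=
  Finset.sum_nonneg fun _ _ => by positivity

theorem sr_int_Q {n : ℕ} (α h lam : ℝ) (u : 𝓢(SRE n, ℂ)) :
    Integrable (fun z => Aw z ^ α * Qf h lam u z) volume := by
  simp only [Qf, Finset.mul_sum]
  refine integrable_finsetSum _ fun j _ => ?_
  have hw : (fun z : SRE n => √lam * (Aw z ^ (-(1 / 2) : ℝ) * z j)).HasTemperateGrowth :=
    (Function.HasTemperateGrowth.const √lam).mul (Awz_temp _ j)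
  refine (sr_int_sq α ((h : ℂ) • dj j u - smulLeftCLM ℂ
    (fun z : SRE n => √lam * (Aw z ^ (-(1 / 2) : ℝ) * z j)) (Complex.I • u))).congr
    (Eventually.of_forall fun z => ?_)
  have e : ((h : ℂ) • dj j u - smulLeftCLM ℂ
    (fun z : SRE n => √lam * (Aw z ^ (-(1 / 2) : ℝ) * z j)) (Complex.I • u)) z
    = (h : ℂ) • dj j u z - smulLeftCLM ℂ
    (fun z : SRE n => √lam * (Aw z ^ (-(1 / 2) : ℝ) * z j)) (Complex.I • u) z := rfl
  have e2 : (Complex.I • u) z = Complex.I * u z := rfl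
  simp only [e, smulLeftCLM_apply_apply hw, e2, mul_assoc, Complex.real_smul, smul_eq_mul]

/-- the left-hand side density of the exterior estimate -/
noncomputable def Nd {n : ℕ} (β σ h lam : ℝ) (u : 𝓢(SRE n, ℂ)) (z : SRE n) : ℝ :=
  Aw z ^ (β - 1 / 2) * Qf h lam u z + Aw z ^ (-(1 / 2) - σ) * (h ^ 2 * Gf u z + ‖u z‖ ^ 2)

theorem Nd_int {n : ℕ} (β σ h lam : ℝ) (u : 𝓢(SRE n, ℂ)) : Integrable (Nd β σ h lam u) volume := by
  have := ((sr_int_Q (β - 1 / 2) h lam u).add ((sr_int_G (-(1 / 2) - σ) u).const_mul (h ^ 2))).add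
    (sr_int_sq (-(1 / 2) - σ) u)
  refine this.congr (Eventually.of_forall fun z => ?_)
  simp only [Nd, Pi.add_apply]
  ring

theorem sr_amgm (c x y K : ℝ) (hc : 0 < c) : K * (x * y) ≤ c * y ^ 2 + K ^ 2 / (4 * c) * x ^ 2 := by
  have h1 : 0 ≤ c * (y - K / (2 * c) * x) ^ 2 := by positivity
  have h2 : c * (y - K / (2 * c) * x) ^ 2 = c * y ^ 2 + K ^ 2 / (4 * c) * x ^ 2 - K * (x * y) := by
    field_simp; ring
  linarith

theorem propA {n : ℕ} {V : SRE n → ℝ} (hV : V.HasTemperateGrowth) (γ Cv : ℝ)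
    (hVb : ∀ z, |V z| ≤ Cv * Aw z ^ (-(γ / 2))) (hVd : ∀ z, |fderiv ℝ V z z| ≤ Cv * Aw z ^ (-(γ / 2)))
    (a b : ℝ) (ha : 0 < a) (β σ : ℝ) (hβ : 0 < β) (hβ4 : β ≤ 1 / 4) (hσ : 0 < σ)
    (hσ4 : σ ≤ 1 / 4) (hβγ : β + σ < γ / 2) :
    ∃ C R h₀ : ℝ, 0 < C ∧ 1 ≤ R ∧ 0 < h₀ ∧ ∀ h : ℝ, 0 < h → h ≤ 1 → h ≤ h₀ → ∀ lam ∈ Set.Icc a b,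
      ∀ t : ℝ, 0 < t → t ≤ 1 → ∀ u : 𝓢(SRE n, ℂ),
      ∫ z, Nd β σ h lam u z ≤ C * (∫ z in Metric.closedBall 0 R, ‖u z‖ ^ 2)
        + C / h ^ 2 * ∫ z, Aw z ^ (1 / 2 + σ + 2 * β) * ‖ff V h lam t u z‖ ^ 2 := by
  obtain ⟨C1, C2, C1p, C2p, H⟩ := partA_lower hV γ Cv hVb hVd a b ha β σ hβ hβ4 hσ hσ4 (by linarith)
  have htend : Tendsto (fun A : ℝ => A ^ (-(γ / 2 - β - σ))) atTop (nhds 0) :=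
    tendsto_rpow_neg_atTop (by linarith)
  have hev : ∀ᶠ A : ℝ in atTop, C1 * A ^ (-(γ / 2 - β - σ)) < σ * a / 2 := by
    have := htend.const_mul C1
    rw [mul_zero] at this
    exact this.eventually_lt_const (by positivity)
  obtain ⟨R0, hR0⟩ := eventually_atTop.1 hev
  set c : ℝ := min (2 * β) (min σ (σ * a / 2)) with hc
  have c0 : 0 < c := by rw [hc]; positivity
  set K : ℝ := C2 ^ 2 / (4 * (σ * a / 2)) + C2 ^ 2 / (4 * σ) with hK
  have K0 : 0 < K := by positivity
  refine ⟨(C1 + K) / c, max 1 R0, √(σ * a / 2 / C1), by positivity, le_max_left _ _,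
    Real.sqrt_pos.2 (by positivity), ?_⟩
  intro h h0 h1 hh0 lam hlam t t0 t1 u
  obtain ⟨D, hD, hle⟩ := H h h0 h1 lam hlam t t0 t1 u
  have hh2 : C1 * h ^ 2 ≤ σ * a / 2 := by
    have : h ^ 2 ≤ σ * a / 2 / C1 := by
      rw [← Real.sq_sqrt (by positivity : 0 ≤ σ * a / 2 / C1)]
      gcongr
    rw [le_div_iff₀ C1p] at this
    linarith
  set R := max 1 R0 with hR
  have hpt : ∀ z, c * Nd β σ h lam u z ≤ D z
      + C1 * (Metric.closedBall (0 : SRE n) R).indicator (fun z => ‖u z‖ ^ 2) z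
      + K / h ^ 2 * (Aw z ^ (1 / 2 + σ + 2 * β) * ‖ff V h lam t u z‖ ^ 2) := by
    intro z
    refine le_trans ?_ (add_le_add_left (add_le_add_left (hle z) _) _)
    have A1 := Aw_one_le z
    have A0 := Aw_pos z
    have hG0 := Gf_nonneg u z
    have hQ0 := Qf_nonneg h lam u z
    have hF0 := norm_nonneg (ff V h lam t u z)
    have hU0 := norm_nonneg (u z)
    have ind : C1 * Aw z ^ (β - 1 / 2) * Aw z ^ (-(γ / 2)) * ‖u z‖ ^ 2
        ≤ σ * a / 2 * Aw z ^ (-(1 / 2) - σ) * ‖u z‖ ^ 2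
        + C1 * (Metric.closedBall (0 : SRE n) R).indicator (fun z => ‖u z‖ ^ 2) z := by
      by_cases hz : z ∈ Metric.closedBall (0 : SRE n) R
      · rw [Set.indicator_of_mem hz]
        have : Aw z ^ (β - 1 / 2) * Aw z ^ (-(γ / 2)) ≤ 1 := by
          rw [← Real.rpow_add A0]
          exact Real.rpow_le_one_of_one_le_of_nonpos A1 (by linarith)
        have h3 : C1 * (Aw z ^ (β - 1 / 2) * Aw z ^ (-(γ / 2))) * ‖u z‖ ^ 2 ≤ C1 * 1 * ‖u z‖ ^ 2 := by
          gcongr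
        have h4 : 0 ≤ σ * a / 2 * Aw z ^ (-(1 / 2) - σ) * ‖u z‖ ^ 2 := by positivity
        linarith
      · rw [Set.indicator_of_notMem hz]
        have hzR : R < ‖z‖ := by simpa using hz
        have : R0 ≤ Aw z := by
          have : 1 ≤ ‖z‖ := (le_max_left _ _).trans hzR.le
          have : ‖z‖ ≤ Aw z := by unfold Aw; nlinarith
          exact ((le_max_right _ _).trans hzR.le).trans this
        have h3 := (hR0 _ this).le
        have h4 : C1 * Aw z ^ (β - 1 / 2) * Aw z ^ (-(γ / 2))
            ≤ σ * a / 2 * Aw z ^ (-(1 / 2) - σ) := by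
          calc C1 * Aw z ^ (β - 1 / 2) * Aw z ^ (-(γ / 2))
              = (C1 * Aw z ^ (-(γ / 2 - β - σ))) * Aw z ^ (-(1 / 2) - σ) := by
                rw [mul_assoc, mul_assoc, ← Real.rpow_add A0, ← Real.rpow_add A0]; congr 2; ring
            _ ≤ _ := by gcongr
        have h5 := mul_le_mul_of_nonneg_right h4 (sq_nonneg ‖u z‖)
        linarith
    have hhb : C1 * Aw z ^ (β - 1 / 2) * (h ^ 2 * (Aw z)⁻¹) * ‖u z‖ ^ 2
        ≤ σ * a / 2 * Aw z ^ (-(1 / 2) - σ) * ‖u z‖ ^ 2 := by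
      have h3 : Aw z ^ (β - 1 / 2) * (Aw z)⁻¹ ≤ Aw z ^ (-(1 / 2) - σ) := by
        rw [← Real.rpow_neg_one, ← Real.rpow_add A0]
        exact Real.rpow_le_rpow_of_exponent_le A1 (by linarith)
      calc C1 * Aw z ^ (β - 1 / 2) * (h ^ 2 * (Aw z)⁻¹) * ‖u z‖ ^ 2
          = (C1 * h ^ 2) * (Aw z ^ (β - 1 / 2) * (Aw z)⁻¹) * ‖u z‖ ^ 2 := by ring
        _ ≤ σ * a / 2 * Aw z ^ (-(1 / 2) - σ) * ‖u z‖ ^ 2 := by gcongr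
    set S := √(h ^ 2 * Gf u z) with hS
    have hS2 : S ^ 2 = h ^ 2 * Gf u z := Real.sq_sqrt (by positivity)
    have W0 : 0 < Aw z ^ (-(1 / 2) - σ) := Real.rpow_pos_of_pos A0 _
    have hpw : (Aw z ^ β) ^ 2 / Aw z ^ (-(1 / 2) - σ) = Aw z ^ (1 / 2 + σ + 2 * β) := by
      rw [← Real.rpow_natCast, ← Real.rpow_mul A0.le, ← Real.rpow_sub A0]; congr 1
      push_cast; ring
    have am1 := sr_amgm (σ * a / 2 * Aw z ^ (-(1 / 2) - σ)) ‖ff V h lam t u z‖ ‖u z‖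
      (C2 / h * Aw z ^ β) (by positivity)
    have am2 := sr_amgm (σ * Aw z ^ (-(1 / 2) - σ)) ‖ff V h lam t u z‖ S
      (C2 / h * Aw z ^ β) (by positivity)
    have e1 : (C2 / h * Aw z ^ β) ^ 2 / (4 * (σ * a / 2 * Aw z ^ (-(1 / 2) - σ)))
        = C2 ^ 2 / (4 * (σ * a / 2)) / h ^ 2 * Aw z ^ (1 / 2 + σ + 2 * β) := by
      rw [← hpw]; field_simp
    have e2 : (C2 / h * Aw z ^ β) ^ 2 / (4 * (σ * Aw z ^ (-(1 / 2) - σ)))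
        = C2 ^ 2 / (4 * σ) / h ^ 2 * Aw z ^ (1 / 2 + σ + 2 * β) := by
      rw [← hpw]; field_simp
    rw [e1] at am1
    rw [e2, hS2] at am2
    have lamU : a * (Aw z ^ (-(1 / 2) - σ) * ‖u z‖ ^ 2) ≤ lam * (Aw z ^ (-(1 / 2) - σ) * ‖u z‖ ^ 2) := by
      gcongr; exact hlam.1
    have n1 : c * (Aw z ^ (β - 1 / 2) * Qf h lam u z) ≤ 2 * β * (Aw z ^ (β - 1 / 2) * Qf h lam u z) := by
      gcongr; exact min_le_left _ _
    have n2 : c * (Aw z ^ (-(1 / 2) - σ) * (h ^ 2 * Gf u z))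
        ≤ σ * (Aw z ^ (-(1 / 2) - σ) * (h ^ 2 * Gf u z)) := by
      gcongr; exact (min_le_right _ _).trans (min_le_left _ _)
    have n3 : c * (Aw z ^ (-(1 / 2) - σ) * ‖u z‖ ^ 2)
        ≤ σ * a / 2 * (Aw z ^ (-(1 / 2) - σ) * ‖u z‖ ^ 2) := by
      gcongr; exact (min_le_right _ _).trans (min_le_right _ _)
    have lamU' := mul_le_mul_of_nonneg_left lamU hσ.le
    have hKs : K / h ^ 2 * (Aw z ^ (1 / 2 + σ + 2 * β) * ‖ff V h lam t u z‖ ^ 2)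
      = C2 ^ 2 / (4 * (σ * a / 2)) / h ^ 2 * Aw z ^ (1 / 2 + σ + 2 * β) * ‖ff V h lam t u z‖ ^ 2
      + C2 ^ 2 / (4 * σ) / h ^ 2 * Aw z ^ (1 / 2 + σ + 2 * β) * ‖ff V h lam t u z‖ ^ 2 := by
      rw [hK]; ring
    rw [hKs]
    unfold Nd
    linarith only [ind, hhb, am1, am2, n1, n2, n3, lamU']
  have iU : Integrable ((Metric.closedBall (0 : SRE n) R).indicator (fun z => ‖u z‖ ^ 2)) volume := by
    have := sr_int_sq 0 u
    simp only [Real.rpow_zero, one_mul] at this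
    exact this.indicator measurableSet_closedBall
  have iF := sr_int_sq (1 / 2 + σ + 2 * β) (ff V h lam t u)
  have i12 : Integrable (fun z => D z
      + C1 * (Metric.closedBall (0 : SRE n) R).indicator (fun z => ‖u z‖ ^ 2) z) volume :=
    hD.1.add (iU.const_mul C1)
  have i123 : Integrable (fun z => D z
      + C1 * (Metric.closedBall (0 : SRE n) R).indicator (fun z => ‖u z‖ ^ 2) z
      + K / h ^ 2 * (Aw z ^ (1 / 2 + σ + 2 * β) * ‖ff V h lam t u z‖ ^ 2)) volume :=
    i12.add (iF.const_mul (K / h ^ 2))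
  have hint := integral_mono ((Nd_int β σ h lam u).const_mul c) i123 hpt
  rw [integral_const_mul, integral_add i12 (iF.const_mul (K / h ^ 2)),
    integral_add hD.1 (iU.const_mul C1), hD.2, integral_const_mul, integral_const_mul,
    integral_indicator measurableSet_closedBall, zero_add] at hint
  set IU := ∫ z in Metric.closedBall (0 : SRE n) R, ‖u z‖ ^ 2
  set IF := ∫ z, Aw z ^ (1 / 2 + σ + 2 * β) * ‖ff V h lam t u z‖ ^ 2
  have IU0 : 0 ≤ IU := integral_nonneg fun z => by positivity
  have IF0 : 0 ≤ IF := integral_nonneg fun z =>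
    mul_nonneg (Real.rpow_nonneg (Aw_pos z).le _) (by positivity)
  have : ∫ z, Nd β σ h lam u z ≤ (C1 * IU + K / h ^ 2 * IF) / c := by
    rw [le_div_iff₀ c0]; linarith
  refine this.trans ?_
  have x1 : 0 ≤ K * IU / c := by positivity
  have x2 : 0 ≤ C1 / h ^ 2 * IF / c := by positivity
  have e1 : (C1 + K) / c * IU + (C1 + K) / c / h ^ 2 * IF
      = (C1 * IU + K / h ^ 2 * IF) / c + K * IU / c + C1 / h ^ 2 * IF / c := by
    field_simp; ring
  rw [e1]; linarith
end

section
open Filter MeasureTheory SchwartzMap LineDeriv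

structure VB {n : ℕ} (V : SRE n → ℝ) (γ Cv : ℝ) : Prop where
  cd : ContDiff ℝ (⊤ : ℕ∞) V
  temp : V.HasTemperateGrowth
  g0 : 0 < γ
  c0 : 0 < Cv
  b0 : ∀ z, |V z| ≤ Cv * (1 + ‖z‖) ^ (-γ)
  b1 : ∀ z, ‖fderiv ℝ V z‖ ≤ Cv * (1 + ‖z‖) ^ (-γ - 1)
  b2 : ∀ z, ‖fderiv ℝ (fderiv ℝ V) z‖ ≤ Cv

theorem VB_of {n : ℕ} {V : SRE n → ℝ} (hV : IsLongRangePotential V) :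
    ∃ γ Cv, VB V γ Cv := by
  obtain ⟨cd, γ, g0, H⟩ := hV
  obtain ⟨C0, p0, H0⟩ := H 0
  obtain ⟨C1, p1, H1⟩ := H 1
  obtain ⟨C2, p2, H2⟩ := H 2
  have pos : ∀ z : SRE n, (1 : ℝ) ≤ 1 + ‖z‖ := fun z => by linarith [norm_nonneg z]
  refine ⟨γ, C0 + C1 + C2, cd, ⟨cd, fun k => ?_⟩, g0, by positivity, fun z => ?_, fun z => ?_,
    fun z => ?_⟩
  · obtain ⟨C, hC, HC⟩ := H k
    refine ⟨0, C, fun x => (HC x).trans ?_⟩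
    rw [pow_zero]
    gcongr
    exact Real.rpow_le_one_of_one_le_of_nonpos (pos x) (by have : (0:ℝ) ≤ k := k.cast_nonneg
                                                           linarith)
  · have := H0 z
    rw [norm_iteratedFDeriv_zero, Real.norm_eq_abs] at this
    refine this.trans ?_
    simp only [Nat.cast_zero, sub_zero]
    gcongr; linarith
  · have := H1 z
    rw [norm_iteratedFDeriv_one] at this
    refine this.trans ?_
    simp only [Nat.cast_one]
    gcongr; linarith
  · have := H2 z
    rw [← norm_iteratedFDeriv_fderiv, norm_iteratedFDeriv_one] at this
    refine this.trans ?_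
    have h1 : (1 + ‖z‖) ^ (-γ - ((2 : ℕ) : ℝ)) ≤ 1 :=
      Real.rpow_le_one_of_one_le_of_nonpos (pos z) (by push_cast; linarith)
    calc C2 * (1 + ‖z‖) ^ (-γ - ((2 : ℕ) : ℝ)) ≤ C2 * 1 := by gcongr
      _ ≤ _ := by linarith

namespace VB
variable {n : ℕ} {V : SRE n → ℝ} {γ Cv : ℝ}

theorem one_le (z : SRE n) : (1 : ℝ) ≤ 1 + ‖z‖ := by linarith [norm_nonneg z]

theorem bV (H : VB V γ Cv) (z) : |V z| ≤ Cv := by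
  refine (H.b0 z).trans (mul_le_of_le_one_right H.c0.le ?_)
  exact Real.rpow_le_one_of_one_le_of_nonpos (one_le z) (by linarith [H.g0])

theorem bD (H : VB V γ Cv) (z) : ‖fderiv ℝ V z‖ ≤ Cv := by
  refine (H.b1 z).trans (mul_le_of_le_one_right H.c0.le ?_)
  exact Real.rpow_le_one_of_one_le_of_nonpos (one_le z) (by linarith [H.g0])

theorem diff (H : VB V γ Cv) : Differentiable ℝ V := H.cd.differentiable (by simp)

theorem cdD (H : VB V γ Cv) : ContDiff ℝ (⊤ : ℕ∞) (fderiv ℝ V) :=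
  H.cd.fderiv_right (by simp)

theorem lipD (H : VB V γ Cv) (x y) : ‖fderiv ℝ V x - fderiv ℝ V y‖ ≤ Cv * ‖x - y‖ :=
  Convex.norm_image_sub_le_of_norm_fderiv_le (𝕜 := ℝ) (s := Set.univ)
    (fun z _ => (H.cdD.differentiable (by simp)) z) (fun z _ => H.b2 z) convex_univ
    (Set.mem_univ y) (Set.mem_univ x)

theorem lipV (H : VB V γ Cv) (x y) : |V x - V y| ≤ Cv * ‖x - y‖ :=
  Convex.norm_image_sub_le_of_norm_fderiv_le (𝕜 := ℝ) (s := Set.univ)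
    (fun z _ => H.diff z) (fun z _ => H.bD z) convex_univ
    (Set.mem_univ y) (Set.mem_univ x)

theorem taylor (H : VB V γ Cv) (x w) : |V (x + w) - V x - fderiv ℝ V x w| ≤ Cv * ‖w‖ ^ 2 := by
  have := Convex.norm_image_sub_le_of_norm_hasFDerivWithin_le
    (f := fun y => V y - fderiv ℝ V x y) (f' := fun y => fderiv ℝ V y - fderiv ℝ V x)
    (C := Cv * ‖w‖) (s := Metric.closedBall x ‖w‖) (x := x) (y := x + w)
    (fun y _ => ((H.diff y).hasFDerivAt.sub (fderiv ℝ V x).hasFDerivAt).hasFDerivWithinAt)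
    (fun y hy => (H.lipD y x).trans (by
      have : ‖y - x‖ ≤ ‖w‖ := by simpa [dist_eq_norm] using hy
      have := H.c0
      gcongr)) (convex_closedBall _ _) (by simp) (by simp)
  simp only [map_add, add_sub_cancel_left, Real.norm_eq_abs] at this
  refine le_trans (le_of_eq ?_) (this.trans (le_of_eq (by ring)))
  congr 1; ring

theorem bzD (H : VB V γ Cv) (z) : |fderiv ℝ V z z| ≤ Cv * (1 + ‖z‖) ^ (-γ) := by
  have h1 := (fderiv ℝ V z).le_opNorm z
  rw [Real.norm_eq_abs] at h1
  have h0 : 0 < 1 + ‖z‖ := by linarith [one_le z]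
  calc |fderiv ℝ V z z| ≤ ‖fderiv ℝ V z‖ * ‖z‖ := h1
    _ ≤ (Cv * (1 + ‖z‖) ^ (-γ - 1)) * (1 + ‖z‖) := by
        gcongr
        · exact (norm_nonneg _).trans (H.b1 z)
        · exact H.b1 z
        · linarith
    _ = Cv * (1 + ‖z‖) ^ (-γ) := by
        rw [Real.rpow_sub_one h0.ne']; field_simp

theorem Aw_le (z : SRE n) : Aw z ^ (1 / 2 : ℝ) ≤ 1 + ‖z‖ := by
  rw [← Real.sqrt_eq_rpow, Real.sqrt_le_left (by linarith [one_le z])]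
  unfold Aw; nlinarith [norm_nonneg z]

theorem rp_le (g0 : 0 < γ) (z : SRE n) : (1 + ‖z‖) ^ (-γ) ≤ Aw z ^ (-(γ / 2)) := by
  have : Aw z ^ (-(γ / 2)) = (Aw z ^ (1 / 2 : ℝ)) ^ (-γ) := by
    rw [← Real.rpow_mul (Aw_pos z).le]; congr 1; ring
  rw [this]
  exact Real.rpow_le_rpow_of_nonpos (Real.rpow_pos_of_pos (Aw_pos z) _) (Aw_le z) (by linarith)

theorem hVb (H : VB V γ Cv) (z) : |V z| ≤ Cv * Aw z ^ (-(γ / 2)) :=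
  (H.b0 z).trans (mul_le_mul_of_nonneg_left (rp_le H.g0 z) H.c0.le)
theorem hVd (H : VB V γ Cv) (z) : |fderiv ℝ V z z| ≤ Cv * Aw z ^ (-(γ / 2)) :=
  (H.bzD z).trans (mul_le_mul_of_nonneg_left (rp_le H.g0 z) H.c0.le)

theorem grad_lip (H : VB V γ Cv) (x y) : ‖gradient V x - gradient V y‖ ≤ Cv * ‖x - y‖ := by
  unfold gradient
  rw [← map_sub, LinearIsometryEquiv.norm_map]
  exact H.lipD x y

theorem grad_cd (H : VB V γ Cv) : ContDiff ℝ (⊤ : ℕ∞) (gradient V) := by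
  unfold gradient
  exact (InnerProductSpace.toDual ℝ (SRE n)).symm.contDiff.comp H.cdD

theorem inner_grad (z w : SRE n) : inner ℝ (gradient V z) w = fderiv ℝ V z w := by
  unfold gradient
  exact InnerProductSpace.toDual_symm_apply

end VB

noncomputable def XV {n : ℕ} (V : SRE n → ℝ) (y : SRE n × SRE n) : SRE n × SRE n :=
  ((2 : ℝ) • y.2, -(gradient V y.1))

theorem XV_lip {n : ℕ} {V : SRE n → ℝ} {γ Cv : ℝ} (H : VB V γ Cv) :
    ∃ K : NNReal, LipschitzWith K (XV V) := by
  refine ⟨⟨2 + Cv, by linarith [H.c0]⟩, LipschitzWith.of_dist_le_mul fun y y' => ?_⟩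
  have c0 := H.c0
  simp only [dist_eq_norm, NNReal.coe_mk]
  have h1 : ‖y.1 - y'.1‖ ≤ ‖y - y'‖ := norm_fst_le (y - y')
  have h2 : ‖y.2 - y'.2‖ ≤ ‖y - y'‖ := norm_snd_le (y - y')
  refine (Prod.norm_def _).trans_le (max_le ?_ ?_)
  · simp only [XV, Prod.fst_sub, ← smul_sub, norm_smul]
    norm_num
    change _ ≤ (2 + Cv) * ‖y - y'‖
    nlinarith [norm_nonneg (y - y')]
  · simp only [XV, Prod.snd_sub, neg_sub_neg]
    rw [norm_sub_rev]
    refine (H.grad_lip _ _).trans ?_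
    change _ ≤ (2 + Cv) * ‖y - y'‖
    nlinarith [norm_nonneg (y - y')]

theorem global_ode {F : Type*} [NormedAddCommGroup F] [NormedSpace ℝ F] [CompleteSpace F]
    {X : F → F} (hX : ContDiff ℝ 1 X) {K : NNReal} (hK : LipschitzWith K X) (x : F) :
    ∃ c : ℝ → F, c 0 = x ∧ ∀ t, HasDerivAt c (X (c t)) t := by
  have key := exists_isMIntegralCurve_of_isMIntegralCurveOn (I := modelWithCornersSelf ℝ F)
    (M := F) (v := X) (contMDiff_vectorSpace_iff_contDiff.2 hX) (ε := 1 / (K + 1)) (by positivity)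
    (fun x => ?_) x
  · obtain ⟨c, c0, hc⟩ := key
    refine ⟨c, c0, fun t => ?_⟩
    have h1 : HasFDerivAt c (ContinuousLinearMap.smulRight (1 : ℝ →L[ℝ] ℝ) (X (c t))) t :=
      hasMFDerivAt_iff_hasFDerivAt.1 (hc t)
    have h2 := h1.hasDerivAt
    simpa using h2
  · set a : NNReal := ⟨‖X x‖, norm_nonneg _⟩ with ha
    have hpl : IsPicardLindelof (fun _ => X) (tmin := -(1 / ((K : ℝ) + 1)))
        (tmax := 1 / ((K : ℝ) + 1)) ⟨0, by constructor <;> simp <;> positivity⟩ x a 0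
        (a + K * a) K := by
      refine IsPicardLindelof.of_time_independent (fun y hy => ?_) hK.lipschitzOnWith ?_
      · have h1 := hK.dist_le_mul y x
        have h2 : dist y x ≤ a := hy
        have h3 : ‖X y‖ ≤ ‖X x‖ + dist (X y) (X x) := by
          rw [dist_eq_norm]
          simpa using norm_add_le (X x) (X y - X x)
        have h4 : (K : ℝ) * dist y x ≤ K * a := by gcongr
        have h5 : (a : ℝ) = ‖X x‖ := rfl
        push_cast
        linarith
      · have : (0 : ℝ) < K + 1 := by positivity
        push_cast
        simp only [sub_zero, zero_sub, neg_neg, max_self]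
        apply le_of_eq
        field_simp
        ring
    obtain ⟨c, c0, hc⟩ := hpl.exists_eq_forall_mem_Icc_hasDerivWithinAt₀
    refine ⟨c, c0, fun t ht => ?_⟩
    have := (hc t (Set.Ioo_subset_Icc_self ht)).hasDerivAt (Icc_mem_nhds ht.1 ht.2)
    exact (hasMFDerivAt_iff_hasFDerivAt.2 this.hasFDerivAt).hasMFDerivWithinAt

theorem XV_cd {n : ℕ} {V : SRE n → ℝ} {γ Cv : ℝ} (H : VB V γ Cv) : ContDiff ℝ 1 (XV V) := by
  unfold XV
  have := H.grad_cd.of_le (m := 1) (by norm_cast)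
  fun_prop

/-- existence of the flow with its basic properties -/
theorem flow_exists {n : ℕ} {V : SRE n → ℝ} {γ Cv : ℝ} (H : VB V γ Cv) :
    ∃ Φ : ℝ → SRE n × SRE n → SRE n × SRE n, (∀ y, Φ 0 y = y) ∧
      (∀ y t, HasDerivAt (fun s => Φ s y) (XV V (Φ t y)) t) ∧
      (∀ c : ℝ → SRE n × SRE n, (∀ t, HasDerivAt c (XV V (c t)) t) → ∀ t, c t = Φ t (c 0)) ∧
      (∃ K : ℝ, 0 ≤ K ∧ ∀ t, 0 ≤ t → ∀ y y', dist (Φ t y) (Φ t y') ≤ dist y y' * Real.exp (K * t))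
      := by
  obtain ⟨K, hK⟩ := XV_lip H
  choose Φ h0 hd using global_ode (XV_cd H) hK
  refine ⟨fun t y => Φ y t, h0, hd, fun c hc t => ?_, K, K.2, fun t ht y y' => ?_⟩
  · have := ODE_solution_unique_univ (v := fun _ => XV V) (s := fun _ => Set.univ) (K := K)
      (f := c) (g := Φ (c 0)) (t₀ := 0)
      (fun _ => hK.lipschitzOnWith) (fun t => ⟨hc t, trivial⟩) (fun t => ⟨hd _ t, trivial⟩)
      (h0 _).symm
    exact congrFun this t
  · have := dist_le_of_trajectories_ODE (v := fun _ => XV V) (K := K) (f := Φ y) (g := Φ y')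
      (a := 0) (b := t) (δ := dist y y') (fun _ => hK)
      (fun s _ => (hd y s).continuousAt.continuousWithinAt) (fun s _ => (hd y s).hasDerivWithinAt)
      (fun s _ => (hd y' s).continuousAt.continuousWithinAt) (fun s _ => (hd y' s).hasDerivWithinAt)
      (by rw [h0, h0]) t ⟨ht, le_rfl⟩
    simpa using this
end

section
open Filter MeasureTheory SchwartzMap LineDeriv

noncomputable def pE {n : ℕ} (V : SRE n → ℝ) (y : SRE n × SRE n) : ℝ := ‖y.2‖ ^ 2 + V y.1

structure IsFl {n : ℕ} (V : SRE n → ℝ) (Φ : ℝ → SRE n × SRE n → SRE n × SRE n) : Prop where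
  zero : ∀ y, Φ 0 y = y
  der : ∀ y t, HasDerivAt (fun s => Φ s y) (XV V (Φ t y)) t
  uniq : ∀ c : ℝ → SRE n × SRE n, (∀ t, HasDerivAt c (XV V (c t)) t) → ∀ t, c t = Φ t (c 0)
  lip : ∃ K : ℝ, 0 ≤ K ∧ ∀ t, 0 ≤ t → ∀ y y', dist (Φ t y) (Φ t y') ≤ dist y y' * Real.exp (K * t)

namespace IsFl
variable {n : ℕ} {V : SRE n → ℝ} {γ Cv : ℝ} {Φ : ℝ → SRE n × SRE n → SRE n × SRE n}

theorem cont (F : IsFl V Φ) (y) : Continuous (fun s => Φ s y) :=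
  continuous_iff_continuousAt.2 fun t => (F.der y t).continuousAt

theorem contY (F : IsFl V Φ) {t : ℝ} (ht : 0 ≤ t) : Continuous (Φ t) := by
  obtain ⟨K, K0, h⟩ := F.lip
  refine LipschitzWith.continuous (K := ⟨Real.exp (K * t), by positivity⟩)
    (LipschitzWith.of_dist_le_mul fun y y' => ?_)
  rw [mul_comm]; exact h t ht y y'

theorem add (F : IsFl V Φ) (s t : ℝ) (y) : Φ (s + t) y = Φ s (Φ t y) := by
  have := F.uniq (fun s => Φ (s + t) y) (fun s => (F.der y (s + t)).comp_add_const s t) s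
  simpa using this

theorem d1 (F : IsFl V Φ) (y t) : HasDerivAt (fun s => (Φ s y).1) ((2 : ℝ) • (Φ t y).2) t :=
  (HasFDerivAt.comp_hasDerivAt (f := fun s => Φ s y) t hasFDerivAt_fst (F.der y t) :)
theorem d2 (F : IsFl V Φ) (y t) : HasDerivAt (fun s => (Φ s y).2) (-(gradient V (Φ t y).1)) t :=
  (HasFDerivAt.comp_hasDerivAt (f := fun s => Φ s y) t hasFDerivAt_snd (F.der y t) :)

theorem rev (F : IsFl V Φ) (t : ℝ) (y) :
    Φ t (y.1, -y.2) = ((Φ (-t) y).1, -(Φ (-t) y).2) := by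
  have := F.uniq (fun s => ((Φ (-s) y).1, -(Φ (-s) y).2)) (fun s => ?_) t
  · simp only [neg_zero, F.zero] at this
    exact this.symm
  · have h1 := (F.d1 y (-s)).scomp s (hasDerivAt_neg s)
    have h2 := ((F.d2 y (-s)).scomp s (hasDerivAt_neg s)).neg
    refine (h1.prodMk h2).congr_deriv ?_
    unfold XV
    ext1 <;> simp

theorem energy (F : IsFl V Φ) (H : VB V γ Cv) (t y) : pE V (Φ t y) = pE V y := by
  have hd : ∀ s, HasDerivAt (fun s => pE V (Φ s y)) 0 s := fun s => by
    have h1 := (F.d2 y s).norm_sq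
    have h2 := (H.diff (Φ s y).1).hasFDerivAt.comp_hasDerivAt s (F.d1 y s)
    refine (h1.add h2).congr_deriv ?_
    rw [map_smul, inner_neg_right, real_inner_comm, VB.inner_grad]
    simp
  have := is_const_of_deriv_eq_zero (fun s => (hd s).differentiableAt) (fun s => (hd s).deriv) t 0
  simpa [F.zero] using this

theorem mom (F : IsFl V Φ) (H : VB V γ Cv) {M : ℝ} {y} (hM : pE V y ≤ M) (t) :
    ‖(Φ t y).2‖ ≤ √(M + Cv) := by
  apply Real.le_sqrt_of_sq_le
  have := F.energy H t y
  have h2 := abs_le.1 (H.bV (Φ t y).1)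
  unfold pE at *
  linarith [h2.1]

theorem growth (F : IsFl V Φ) (H : VB V γ Cv) {M : ℝ} {y} (hM : pE V y ≤ M) (s t) :
    ‖(Φ t y).1 - (Φ s y).1‖ ≤ 2 * √(M + Cv) * |t - s| := by
  have := Convex.norm_image_sub_le_of_norm_hasDerivWithin_le (f := fun s => (Φ s y).1)
    (f' := fun t => (2 : ℝ) • (Φ t y).2) (C := 2 * √(M + Cv)) (s := Set.univ) (x := s) (y := t)
    (fun r _ => (F.d1 y r).hasDerivWithinAt) (fun r _ => by
      rw [norm_smul]; norm_num; exact F.mom H hM r) convex_univ trivial trivial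
  simpa using this

theorem persist (F : IsFl V Φ) (H : VB V γ Cv) {a1 R1 : ℝ} (ha1 : 0 < a1) (hR1 : 0 ≤ R1)
    (hR : ∀ z, R1 < ‖z‖ → 2 * |V z| + |fderiv ℝ V z z| < 2 * a1) {y} (hy : a1 ≤ pE V y)
    {s0 : ℝ} (h1 : R1 < ‖(Φ s0 y).1‖) (h2 : 0 < inner ℝ (Φ s0 y).1 (Φ s0 y).2) {s : ℝ}
    (hs : s0 ≤ s) : R1 < ‖(Φ s y).1‖ ∧ 0 < inner ℝ (Φ s y).1 (Φ s y).2 := by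
  set Y : ℝ → ℝ := fun s => ‖(Φ s y).1‖ ^ 2 with hY
  set q : ℝ → ℝ := fun s => inner ℝ (Φ s y).1 (Φ s y).2 with hq
  have dY : ∀ s, HasDerivAt Y (4 * q s) s := fun s => by
    refine (F.d1 y s).norm_sq.congr_deriv ?_
    rw [inner_smul_right]; ring
  have dq : ∀ s, HasDerivAt q (2 * ‖(Φ s y).2‖ ^ 2 - fderiv ℝ V (Φ s y).1 (Φ s y).1) s := fun s => by
    refine ((F.d1 y s).inner ℝ (F.d2 y s)).congr_deriv ?_
    rw [inner_neg_right, inner_smul_left, real_inner_comm, VB.inner_grad,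
      real_inner_self_eq_norm_sq]
    simp; ring
  have cY : Continuous Y := continuous_iff_continuousAt.2 fun t => (dY t).continuousAt
  have cq : Continuous q := continuous_iff_continuousAt.2 fun t => (dq t).continuousAt
  have dqpos : ∀ s, R1 < ‖(Φ s y).1‖ → 0 < 2 * ‖(Φ s y).2‖ ^ 2 - fderiv ℝ V (Φ s y).1 (Φ s y).1 := by
    intro s hs
    have e := F.energy H s y
    have h3 := hR _ hs
    have h4 := le_abs_self (V (Φ s y).1)
    have h5 := le_abs_self (fderiv ℝ V (Φ s y).1 (Φ s y).1)
    unfold pE at *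
    linarith
  have key : Set.Icc s0 s ⊆ {r | Y s0 ≤ Y r ∧ q s0 ≤ q r} := by
    refine IsClosed.Icc_subset_of_forall_exists_gt ?_ ⟨le_rfl, le_rfl⟩ ?_
    · exact ((isClosed_le continuous_const cY).inter (isClosed_le continuous_const cq)).inter
        isClosed_Icc
    · rintro x ⟨⟨hx1, hx2⟩, hx3⟩ r hr
      have hxR : R1 < ‖(Φ x y).1‖ := by
        have : R1 ^ 2 < Y x := lt_of_lt_of_le (by rw [hY]; dsimp only; gcongr) hx1
        exact lt_of_pow_lt_pow_left₀ 2 (norm_nonneg _) this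
      have hqx : 0 < q x := h2.trans_le hx2
      have cn : Continuous fun s => ‖(Φ s y).1‖ := (continuous_fst.comp (F.cont y)).norm
      have ev : ∀ᶠ r' in nhds x, R1 < ‖(Φ r' y).1‖ ∧ 0 < q r' :=
        (cn.continuousAt.eventually_const_lt hxR).and (cq.continuousAt.eventually_const_lt hqx)
      obtain ⟨e, e0, he⟩ := Metric.eventually_nhds_iff.1 ev
      set r' := min r (x + e / 2) with hr'
      have hxr : x < r' := lt_min hr (by linarith)
      have hin : ∀ p ∈ Set.Icc x r', R1 < ‖(Φ p y).1‖ ∧ 0 < q p := fun p hp => by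
        apply he
        have : p ≤ x + e / 2 := hp.2.trans (min_le_right _ _)
        rw [Real.dist_eq, abs_of_nonneg (by linarith [hp.1])]
        linarith
      have mY : MonotoneOn Y (Set.Icc x r') := monotoneOn_of_deriv_nonneg (convex_Icc _ _)
        cY.continuousOn (fun p _ => (dY p).differentiableAt.differentiableWithinAt) (fun p hp => by
          rw [(dY p).deriv]; have := (hin p (interior_subset hp)).2; positivity)
      have mq : MonotoneOn q (Set.Icc x r') := monotoneOn_of_deriv_nonneg (convex_Icc _ _)
        cq.continuousOn (fun p _ => (dq p).differentiableAt.differentiableWithinAt) (fun p hp => by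
          rw [(dq p).deriv]; exact (dqpos p (hin p (interior_subset hp)).1).le)
      have l := Set.left_mem_Icc.2 hxr.le
      have u := Set.right_mem_Icc.2 hxr.le
      exact ⟨r', ⟨hx1.trans (mY l u hxr.le), hx2.trans (mq l u hxr.le)⟩, hxr, min_le_left _ _⟩
  obtain ⟨k1, k2⟩ := key ⟨hs, le_rfl⟩
  refine ⟨?_, h2.trans_le k2⟩
  have : R1 ^ 2 < Y s := lt_of_lt_of_le (by rw [hY]; dsimp only; gcongr) k1
  exact lt_of_pow_lt_pow_left₀ 2 (norm_nonneg _) this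

theorem reach (F : IsFl V Φ) {R1 : ℝ} {y}
    (hesc : Tendsto (fun t => ‖(Φ t y).1‖) atTop atTop) :
    ∃ s0, 0 ≤ s0 ∧ R1 < ‖(Φ s0 y).1‖ ∧ 0 < inner ℝ (Φ s0 y).1 (Φ s0 y).2 := by
  obtain ⟨s1, hs1⟩ := eventually_atTop.1 (hesc.eventually_gt_atTop R1)
  set s1' := max s1 0
  obtain ⟨s2, hs2⟩ := eventually_atTop.1 (hesc.eventually_gt_atTop ‖(Φ s1' y).1‖)
  set s3 := max s2 (s1' + 1)
  have h13 : s1' < s3 := lt_of_lt_of_le (by linarith) (le_max_right _ _)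
  have dY : ∀ s, HasDerivAt (fun s => ‖(Φ s y).1‖ ^ 2) (4 * inner ℝ (Φ s y).1 (Φ s y).2) s :=
    fun s => by
    refine (F.d1 y s).norm_sq.congr_deriv ?_
    rw [inner_smul_right]; ring
  obtain ⟨c, hc, hc2⟩ := exists_hasDerivAt_eq_slope (fun s => ‖(Φ s y).1‖ ^ 2) _ h13
    (fun s _ => (dY s).continuousAt.continuousWithinAt) (fun s _ => dY s)
  refine ⟨c, (le_max_right _ _).trans hc.1.le, hs1 c ((le_max_left _ _).trans hc.1.le), ?_⟩
  have h3 : ‖(Φ s1' y).1‖ < ‖(Φ s3 y).1‖ := hs2 s3 (le_max_left _ _)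
  have : 0 < (‖(Φ s3 y).1‖ ^ 2 - ‖(Φ s1' y).1‖ ^ 2) / (s3 - s1') := by
    apply div_pos
    · have : ‖(Φ s1' y).1‖ ^ 2 < ‖(Φ s3 y).1‖ ^ 2 := by gcongr
      linarith
    · linarith
  rw [← hc2] at this
  linarith

theorem dyn (F : IsFl V Φ) (H : VB V γ Cv) {a1 b1 R0 : ℝ} (ha1 : 0 < a1)
    (hesc : ∀ y, pE V y ∈ Set.Icc a1 b1 → Tendsto (fun t => ‖(Φ t y).1‖) atTop atTop) :
    ∃ T, 0 < T ∧ ∀ s, T ≤ s → ∀ y, ‖y.1‖ ≤ R0 → pE V y ∈ Set.Icc a1 b1 →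
      R0 < ‖(Φ s y).1‖ ∧ 0 < inner ℝ (Φ s y).1 (Φ s y).2 := by
  have htend : Tendsto (fun r : ℝ => 3 * (Cv * (1 + r) ^ (-γ))) atTop (nhds 0) := by
    have := (tendsto_rpow_neg_atTop H.g0).comp (tendsto_atTop_add_const_left atTop (1 : ℝ) tendsto_id)
    have := (this.const_mul Cv).const_mul 3
    simpa using this
  obtain ⟨R2, hR2⟩ := eventually_atTop.1 (htend.eventually_lt_const (by linarith : 0 < 2 * a1))
  set R1 := max (max R0 R2) 0
  have hR : ∀ z : SRE n, R1 < ‖z‖ → 2 * |V z| + |fderiv ℝ V z z| < 2 * a1 := fun z hz => by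
    have h1 := hR2 ‖z‖ (((le_max_right R0 R2).trans (le_max_left _ _)).trans hz.le)
    have h2 := H.b0 z
    have h3 := H.bzD z
    linarith
  have hR10 : 0 ≤ R1 := le_max_right _ _
  set K : Set (SRE n × SRE n) := {y | ‖y.1‖ ≤ R0 ∧ pE V y ∈ Set.Icc a1 b1} with hK
  have cp : Continuous (pE V) := by
    have := H.diff.continuous
    unfold pE; fun_prop
  have hKc : IsCompact K := by
    refine Metric.isCompact_of_isClosed_isBounded ?_ ?_
    · exact (isClosed_le (continuous_fst.norm) continuous_const).inter (isClosed_Icc.preimage cp)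
    · refine (Metric.isBounded_closedBall (x := (0 : SRE n × SRE n))
        (r := max R0 (√(b1 + Cv)))).subset fun y hy => ?_
      have h1 := F.mom H hy.2.2 0
      rw [F.zero] at h1
      simp only [mem_closedBall_zero_iff, Prod.norm_def]
      exact max_le_max hy.1 h1
  have key : ∃ T, 0 < T ∧ ∀ s, T ≤ s → ∀ y ∈ K,
      R1 < ‖(Φ s y).1‖ ∧ 0 < inner ℝ (Φ s y).1 (Φ s y).2 := by
    choose s0 h0 h1 h2 using fun y : K => F.reach (R1 := R1) (hesc y.1 y.2.2)
    have hU : ∀ y : K, {x | R1 < ‖(Φ (s0 y) x).1‖ ∧ 0 < inner ℝ (Φ (s0 y) x).1 (Φ (s0 y) x).2}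
        ∈ nhds y.1 := fun y => by
      have c := F.contY (h0 y)
      exact (IsOpen.inter (isOpen_lt continuous_const (continuous_fst.comp c).norm)
        (isOpen_lt continuous_const ((continuous_fst.comp c).inner (𝕜 := ℝ) (continuous_snd.comp c)))).mem_nhds ⟨h1 y, h2 y⟩
    obtain ⟨t, ht⟩ := hKc.elim_nhds_subcover' (fun y hy => {x | R1 < ‖(Φ (s0 ⟨y, hy⟩) x).1‖ ∧
      0 < inner ℝ (Φ (s0 ⟨y, hy⟩) x).1 (Φ (s0 ⟨y, hy⟩) x).2}) (fun y hy => hU ⟨y, hy⟩)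
    refine ⟨1 + ∑ y ∈ t, s0 y, by have := Finset.sum_nonneg (fun y (_ : y ∈ t) => h0 y); linarith,
      fun s hs y hy => ?_⟩
    have := ht hy
    simp only [Set.mem_iUnion] at this
    obtain ⟨x, hx, hxy⟩ := this
    refine F.persist H ha1 hR10 hR hy.2.1 (s0 := s0 x) hxy.1 hxy.2 ?_
    have := Finset.single_le_sum (f := s0) (fun y _ => h0 y) hx
    linarith
  obtain ⟨T, T0, hT⟩ := key
  refine ⟨T, T0, fun s hs y h1 h2 => ?_⟩
  obtain ⟨k1, k2⟩ := hT s hs y ⟨h1, h2⟩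
  exact ⟨lt_of_le_of_lt ((le_max_left R0 R2).trans (le_max_left _ _)) k1, k2⟩
end IsFl
end

section
open Filter MeasureTheory SchwartzMap LineDeriv

namespace IsFl
variable {n : ℕ} {V : SRE n → ℝ} {γ Cv : ℝ} {Φ : ℝ → SRE n × SRE n → SRE n × SRE n}

theorem back (F : IsFl V Φ) (H : VB V γ Cv) {a1 b1 R0 T : ℝ}
    (hT : ∀ s, T ≤ s → ∀ y, ‖y.1‖ ≤ R0 → pE V y ∈ Set.Icc a1 b1 →
      R0 < ‖(Φ s y).1‖ ∧ 0 < inner ℝ (Φ s y).1 (Φ s y).2) {s : ℝ} (hs : T ≤ s) {r : ℝ} {y}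
    (h1 : ‖(Φ (r + s) y).1‖ ≤ R0) (h2 : pE V y ∈ Set.Icc a1 b1) :
    R0 < ‖(Φ r y).1‖ ∧ inner ℝ (Φ r y).1 (Φ r y).2 < 0 := by
  have h3 := hT s hs ((Φ (r + s) y).1, -(Φ (r + s) y).2) h1 (by
    have := F.energy H (r + s) y
    unfold pE at *
    simpa [this] using h2)
  rw [F.rev s (Φ (r + s) y), ← F.add, show -s + (r + s) = r by ring] at h3
  simpa using h3

/-- time integral along the flow -/
noncomputable def bI (Φ : ℝ → SRE n × SRE n → SRE n × SRE n) (a0 : SRE n × SRE n → ℝ) (σ : ℝ)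
    (y : SRE n × SRE n) : ℝ := ∫ s in (0 : ℝ)..σ, a0 (Φ s y)

theorem bI_lip (F : IsFl V Φ) {a0 : SRE n × SRE n → ℝ} {L : NNReal} (hL : LipschitzWith L a0)
    {σ : ℝ} (hσ : 0 ≤ σ) : ∃ K, LipschitzWith K (bI Φ a0 σ) := by
  obtain ⟨K, K0, hK⟩ := F.lip
  have c : ∀ y, Continuous fun s => a0 (Φ s y) := fun y => hL.continuous.comp (F.cont y)
  refine ⟨⟨L * Real.exp (K * σ) * σ, by positivity⟩, LipschitzWith.of_dist_le_mul fun y y' => ?_⟩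
  rw [dist_eq_norm]
  unfold bI
  rw [← intervalIntegral.integral_sub ((c y).intervalIntegrable _ _) ((c y').intervalIntegrable _ _)]
  have := intervalIntegral.norm_integral_le_of_norm_le_const (a := 0) (b := σ)
    (f := fun s => a0 (Φ s y) - a0 (Φ s y')) (C := L * (dist y y' * Real.exp (K * σ)))
    (fun s hs => by
      rw [Set.uIoc_of_le hσ] at hs
      rw [← dist_eq_norm]
      refine (hL.dist_le_mul _ _).trans ?_
      gcongr
      refine (hK s hs.1.le y y').trans ?_
      have := hs.2
      gcongr)
  refine this.trans (le_of_eq ?_)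
  rw [sub_zero, abs_of_nonneg hσ]
  change _ = L * Real.exp (K * σ) * σ * dist y y'
  ring

theorem bI_der (F : IsFl V Φ) {a0 : SRE n × SRE n → ℝ} (hc : Continuous a0) (σ : ℝ) (y) :
    HasDerivAt (fun τ => bI Φ a0 σ (Φ τ y)) (a0 (Φ σ y) - a0 y) 0 := by
  have c : Continuous fun s => a0 (Φ s y) := hc.comp (F.cont y)
  have e : (fun τ => bI Φ a0 σ (Φ τ y))
      = fun τ => (∫ s in (0 : ℝ)..(σ + τ), a0 (Φ s y)) - ∫ s in (0 : ℝ)..τ, a0 (Φ s y) := by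
    funext τ
    unfold bI
    rw [intervalIntegral.integral_interval_sub_left (c.intervalIntegrable _ _)
      (c.intervalIntegrable _ _)]
    simp only [← F.add]
    rw [intervalIntegral.integral_comp_add_right (fun s => a0 (Φ s y))]
    simp
  rw [e]
  have d : ∀ r, HasDerivAt (fun τ => ∫ s in (0 : ℝ)..τ, a0 (Φ s y)) (a0 (Φ r y)) r := fun r =>
    intervalIntegral.integral_hasDerivAt_right (c.intervalIntegrable _ _)
      (c.stronglyMeasurableAtFilter _ _) c.continuousAt
  have h1 := HasDerivAt.comp_const_add σ 0 (d (σ + 0))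
  refine (h1.sub (d 0)).congr_deriv ?_
  simp [F.zero]

/-- the escape function -/
theorem escape (F : IsFl V Φ) (H : VB V γ Cv) {a1 b1 R0 T : ℝ} (hR0 : 0 ≤ R0) (T0 : 0 < T)
    (hT : ∀ s, T ≤ s → ∀ y, ‖y.1‖ ≤ R0 → pE V y ∈ Set.Icc a1 b1 →
      R0 < ‖(Φ s y).1‖ ∧ 0 < inner ℝ (Φ s y).1 (Φ s y).2)
    {a0 : SRE n × SRE n → ℝ} {L : NNReal} (hL : LipschitzWith L a0)
    (ha0 : ∀ y, 0 ≤ a0 y) (ha1 : ∀ y, a0 y ≤ 1)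
    (hs : ∀ y, a0 y ≠ 0 → ‖y.1‖ ≤ R0 ∧ pE V y ∈ Set.Icc a1 b1) :
    ∃ Cm, 0 < Cm ∧ ∀ N : ℕ, ∃ (b m : SRE n × SRE n → ℝ) (K : NNReal) (S : ℝ), 0 ≤ S ∧ R0 ≤ S ∧
      LipschitzWith K b ∧ (∀ y, 0 ≤ b y) ∧ HasCompactSupport b ∧
      (∀ y, b y ≠ 0 → ‖y.1‖ ≤ S) ∧
      Continuous m ∧ (∀ y, 0 ≤ m y) ∧ (∀ y, m y ≤ Cm * (1 + ‖y.1‖)⁻¹) ∧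
      (∀ y, m y ≠ 0 → R0 < ‖y.1‖ ∧ ‖y.1‖ ≤ S ∧ inner ℝ y.1 y.2 < 0) ∧
      (∀ y, DifferentiableAt ℝ b y → fderiv ℝ b y (XV V y)
        = m y - (∑ i ∈ Finset.range N, 1 / ((i : ℝ) + 1)) * a0 y) := by
  set M := √(b1 + Cv) with hM
  have M0 : 0 ≤ M := Real.sqrt_nonneg _
  have sp : ∀ s y, a0 (Φ s y) ≠ 0 → ‖(Φ s y).1‖ ≤ R0 ∧ pE V y ∈ Set.Icc a1 b1 ∧
      ‖y.1‖ ≤ R0 + 2 * M * |s| ∧ ‖y.2‖ ≤ M := by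
    intro s y h
    obtain ⟨h1, h2⟩ := hs _ h
    rw [F.energy H] at h2
    refine ⟨h1, h2, ?_, ?_⟩
    · have := F.growth H h2.2 s 0
      rw [F.zero, zero_sub, abs_neg] at this
      have h3 := norm_add_le (y.1 - (Φ s y).1) (Φ s y).1
      rw [sub_add_cancel] at h3
      linarith
    · have := F.mom H h2.2 0
      rwa [F.zero] at this
  refine ⟨1 + R0 + 2 * M * T, by positivity, fun N => ?_⟩
  have tp : ∀ i : ℕ, (0 : ℝ) ≤ ((i : ℝ) + 1) * T := fun i => by positivity
  have wp : ∀ i : ℕ, (0 : ℝ) ≤ 1 / ((i : ℝ) + 1) := fun i => by positivity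
  choose Kb hKb using fun i : ℕ => F.bI_lip hL (tp i)
  set b : SRE n × SRE n → ℝ := fun y => ∑ i ∈ Finset.range N,
    1 / ((i : ℝ) + 1) * bI Φ a0 (((i : ℝ) + 1) * T) y with hb
  set m : SRE n × SRE n → ℝ := fun y => ∑ i ∈ Finset.range N,
    1 / ((i : ℝ) + 1) * a0 (Φ (((i : ℝ) + 1) * T) y) with hm
  set S := R0 + 2 * M * (N * T) with hS
  have S0 : 0 ≤ S := by positivity
  have bn : ∀ σ, 0 ≤ σ → ∀ y, 0 ≤ bI Φ a0 σ y := fun σ hσ y =>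
    intervalIntegral.integral_nonneg hσ fun s _ => ha0 _
  have iN : ∀ i ∈ Finset.range N, ((i : ℝ) + 1) * T ≤ N * T := fun i hi => by
    have : (i : ℝ) + 1 ≤ N := by exact_mod_cast Finset.mem_range.1 hi
    gcongr
  have bsup : ∀ y, b y ≠ 0 → ‖y.1‖ ≤ S ∧ ‖y.2‖ ≤ M := by
    intro y hy
    obtain ⟨i, hi, h1⟩ := Finset.exists_ne_zero_of_sum_ne_zero hy
    have h2 := right_ne_zero_of_mul h1
    have : ∃ s ∈ Set.Icc 0 (((i : ℝ) + 1) * T), a0 (Φ s y) ≠ 0 := by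
      by_contra hcon
      push Not at hcon
      apply h2
      unfold bI
      rw [intervalIntegral.integral_congr (g := fun _ => 0) (fun s hs => by
        rw [Set.uIcc_of_le (tp i)] at hs; exact hcon s hs)]
      simp
    obtain ⟨s, hs1, hs2⟩ := this
    obtain ⟨_, _, k3, k4⟩ := sp s y hs2
    refine ⟨k3.trans ?_, k4⟩
    rw [abs_of_nonneg hs1.1]
    have := hs1.2.trans (iN i hi)
    rw [hS]; gcongr
  have mone : ∀ y, ∀ i : ℕ, a0 (Φ (((i : ℝ) + 1) * T) y) ≠ 0 → ∀ j : ℕ, i < j →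
      a0 (Φ (((j : ℝ) + 1) * T) y) = 0 := by
    intro y i hi j hij
    by_contra hj
    obtain ⟨i1, i2, -, -⟩ := sp _ y hi
    obtain ⟨j1, -, -, -⟩ := sp _ y hj
    have hij' : (1 : ℝ) ≤ (j : ℝ) - i := by
      have : (i : ℝ) + 1 ≤ j := by exact_mod_cast hij
      linarith
    have := F.back H hT (s := ((j : ℝ) - i) * T) (r := ((i : ℝ) + 1) * T) (y := y)
      (by nlinarith) (by
        rw [show ((i : ℝ) + 1) * T + ((j : ℝ) - i) * T = ((j : ℝ) + 1) * T by ring]; exact j1) i2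
    linarith [this.1]
  have mex : ∀ y, m y ≠ 0 → ∃ i ∈ Finset.range N, a0 (Φ (((i : ℝ) + 1) * T) y) ≠ 0 ∧
      m y ≤ 1 / ((i : ℝ) + 1) := by
    intro y hy
    obtain ⟨i, hi, h1⟩ := Finset.exists_ne_zero_of_sum_ne_zero hy
    have h2 := right_ne_zero_of_mul h1
    refine ⟨i, hi, h2, ?_⟩
    rw [hm]
    dsimp only
    rw [Finset.sum_eq_single_of_mem i hi]
    · exact mul_le_of_le_one_right (wp i) (ha1 _)
    · intro j _ hji
      rcases lt_or_gt_of_ne hji with h | h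
      · by_contra hcon
        exact h2 (mone y j (right_ne_zero_of_mul hcon) i h)
      · rw [mone y i h2 j h, mul_zero]
  refine ⟨b, m, ∑ i ∈ Finset.range N, ‖(1 / ((i : ℝ) + 1))‖₊ * Kb i, S, S0, ?_, ?_, ?_, ?_, fun y hy =>
    (bsup y hy).1, ?_, ?_, ?_, ?_, ?_⟩
  · rw [hS]; have : 0 ≤ 2 * M * (N * T) := by positivity
    linarith
  · refine LipschitzWith.of_dist_le_mul fun y y' => ?_
    rw [hb, dist_eq_norm]
    dsimp only
    rw [← Finset.sum_sub_distrib]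
    refine (norm_sum_le _ _).trans ?_
    push_cast
    rw [Finset.sum_mul]
    refine Finset.sum_le_sum fun i _ => ?_
    rw [← mul_sub, norm_mul, ← dist_eq_norm, mul_assoc]
    gcongr
    exact (hKb i).dist_le_mul _ _
  · exact fun y => Finset.sum_nonneg fun i _ => mul_nonneg (wp i) (bn _ (tp i) y)
  · refine HasCompactSupport.of_support_subset_isCompact
      (isCompact_closedBall (0 : SRE n × SRE n) (max S M)) fun y hy => ?_
    obtain ⟨h1, h2⟩ := bsup y hy
    simp only [mem_closedBall_zero_iff, Prod.norm_def]
    exact max_le_max h1 h2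
  · refine continuous_finsetSum _ fun i _ => continuous_const.mul ?_
    exact hL.continuous.comp (F.contY (tp i))
  · exact fun y => Finset.sum_nonneg fun i _ => mul_nonneg (wp i) (ha0 _)
  · intro y
    by_cases hy : m y = 0
    · rw [hy]; positivity
    obtain ⟨i, hi, h1, h2⟩ := mex y hy
    refine h2.trans ?_
    obtain ⟨-, -, k3, -⟩ := sp _ y h1
    rw [abs_of_nonneg (tp i)] at k3
    rw [← div_eq_mul_inv, div_le_div_iff₀ (by positivity) (by positivity)]
    have : (0 : ℝ) ≤ i := i.cast_nonneg
    nlinarith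
  · intro y hy
    obtain ⟨i, hi, h1, h2⟩ := mex y hy
    obtain ⟨k1, k2, k3, -⟩ := sp _ y h1
    have := F.back H hT (s := ((i : ℝ) + 1) * T) (r := 0) (y := y)
      (by have : (0 : ℝ) ≤ i := i.cast_nonneg
          nlinarith) (by simpa using k1) k2
    rw [F.zero] at this
    refine ⟨this.1, k3.trans ?_, this.2⟩
    rw [abs_of_nonneg (tp i)]
    have := iN i hi
    rw [hS]; gcongr
  · intro y hy
    have hd : HasDerivAt (fun τ => b (Φ τ y)) (fderiv ℝ b y (XV V y)) 0 := by
      have h1 := F.der y 0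
      have h2 : HasFDerivAt b (fderiv ℝ b y) (Φ 0 y) := by rw [F.zero]; exact hy.hasFDerivAt
      have h3 := h2.comp_hasDerivAt (0 : ℝ) h1
      rw [F.zero] at h3
      exact h3
    have hd2 : HasDerivAt (fun τ => b (Φ τ y)) (∑ i ∈ Finset.range N,
        1 / ((i : ℝ) + 1) * (a0 (Φ (((i : ℝ) + 1) * T) y) - a0 y)) 0 :=
      HasDerivAt.fun_sum fun i _ => (F.bI_der hL.continuous (((i : ℝ) + 1) * T) y).const_mul _
    rw [hd.unique hd2, hm]
    dsimp only
    rw [Finset.sum_mul, ← Finset.sum_sub_distrib]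
    exact Finset.sum_congr rfl fun i _ => by ring
end IsFl
end

section
open Filter MeasureTheory SchwartzMap LineDeriv FourierTransform

variable {n : ℕ}

noncomputable def wq (m q : 𝓢(SRE n, ℂ)) (x : SRE n) : 𝓢(SRE n, ℂ) :=
  smulLeftCLM ℂ (⇑m) (SchwartzMap.compSubConstCLM ℂ (-x) q)

theorem wq_apply (m q : 𝓢(SRE n, ℂ)) (x w : SRE n) : wq m q x w = m w * q (x + w) := by
  unfold wq
  rw [smulLeftCLM_apply_apply m.hasTemperateGrowth, compSubConstCLM_apply, sub_neg_eq_add, add_comm w x,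
    smul_eq_mul]

/-- the window transform -/
noncomputable def FW (m q : 𝓢(SRE n, ℂ)) (p : SRE n × SRE n) : ℂ := 𝓕 (wq m q p.1) p.2

theorem FW_int (m q : 𝓢(SRE n, ℂ)) (p : SRE n × SRE n) : FW m q p =
    ∫ w, Complex.exp ((-(2 * Real.pi * inner ℝ w p.2) : ℝ) * Complex.I) * (m w * q (p.1 + w)) := by
  unfold FW
  rw [SchwartzMap.fourier_coe, Real.fourier_eq']
  congr 1
  funext w
  rw [wq_apply, smul_eq_mul]
  congr 3
  push_cast; ring

theorem dj_wq (m q : 𝓢(SRE n, ℂ)) (x : SRE n) (j : Fin n) :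
    dj j (wq m q x) = wq (dj j m) q x + wq m (dj j q) x := by
  ext w
  unfold dj
  rw [add_apply, SchwartzMap.lineDerivOp_apply_eq_fderiv, wq_apply, wq_apply,
    SchwartzMap.lineDerivOp_apply_eq_fderiv, SchwartzMap.lineDerivOp_apply_eq_fderiv]
  have e : (⇑(wq m q x) : SRE n → ℂ) = fun w => m w * q (x + w) := by
    ext w; exact wq_apply _ _ _ _
  have h2 : HasFDerivAt (fun w => q (x + w)) (fderiv ℝ q (x + w)) w := by
    have := (q.differentiableAt (x := x + w)).hasFDerivAt
    exact (this.comp w ((hasFDerivAt_id w).const_add x)).congr_fderiv (by ext v; simp)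
  rw [e, (m.differentiableAt.hasFDerivAt.fun_mul h2).fderiv]
  simp; ring

theorem FW_dj (m q : 𝓢(SRE n, ℂ)) (p : SRE n × SRE n) (j : Fin n) :
    FW m (dj j q) p = (2 * Real.pi * Complex.I) * (p.2 j) * FW m q p - FW (dj j m) q p := by
  have h := congrArg (fun f : 𝓢(SRE n, ℂ) => (𝓕 f : 𝓢(SRE n, ℂ)) p.2) (dj_wq m q p.1 j)
  have ht : (fun w : SRE n => inner ℝ w (ebv j)).HasTemperateGrowth :=
    ((innerSL ℝ).flip (ebv j)).hasTemperateGrowth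
  unfold dj at h
  simp only [SchwartzMap.fourier_lineDerivOp_eq] at h
  rw [smul_apply, smulLeftCLM_apply_apply ht] at h
  rw [FourierTransform.fourier_add, add_apply] at h
  simp only [EuclideanSpace.inner_single_right] at h
  unfold FW dj
  rw [eq_sub_iff_add_eq, add_comm, ← h]
  simp [mul_assoc]

/-- multiplication of the window by a coordinate -/
noncomputable def wj (j : Fin n) (m : 𝓢(SRE n, ℂ)) : 𝓢(SRE n, ℂ) :=
  smulLeftCLM ℂ (fun w : SRE n => w j) m
theorem wj_apply (j : Fin n) (m : 𝓢(SRE n, ℂ)) (w) : wj j m w = (w j : ℂ) * m w := by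
  unfold wj; rw [smulLeftCLM_apply_apply (coord_temp j)]; simp

theorem q_bdd (q : 𝓢(SRE n, ℂ)) : ∃ C, 0 ≤ C ∧ ∀ x, ‖q x‖ ≤ C :=
  ⟨SchwartzMap.seminorm ℝ 0 0 q, apply_nonneg _ _, fun x => q.norm_le_seminorm ℝ x⟩

theorem FW_dx (m q : 𝓢(SRE n, ℂ)) (x η : SRE n) (j : Fin n) :
    HasDerivAt (fun s : ℝ => FW m q (x + s • ebv j, η)) (FW m (dj j q) (x, η)) 0 := by
  simp only [FW_int]
  obtain ⟨C, C0, hC⟩ := q_bdd (dj j q)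
  have hd : ∀ (s : ℝ) (w : SRE n), HasDerivAt (fun s : ℝ => q (x + s • ebv j + w))
      (dj j q (x + s • ebv j + w)) s := fun s w => by
    have h1 := (q.differentiableAt (x := x + s • ebv j + w)).hasFDerivAt
    have h2 : HasDerivAt (fun s : ℝ => x + s • ebv j + w) (ebv j) s := by
      have := (((hasDerivAt_id s).smul_const (ebv j)).const_add x).add_const w
      simpa using this
    have := h1.comp_hasDerivAt s h2
    unfold dj
    rw [SchwartzMap.lineDerivOp_apply_eq_fderiv]
    exact this
  have hc : ∀ (q' : 𝓢(SRE n, ℂ)) (y : SRE n), Continuous fun w : SRE n =>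
      Complex.exp ((-(2 * Real.pi * inner ℝ w η) : ℝ) * Complex.I) * (m w * q' (y + w)) := by
    intro q' y
    have := m.continuous; have := q'.continuous
    fun_prop
  have hn : ∀ (q' : 𝓢(SRE n, ℂ)) (y w : SRE n),
      ‖Complex.exp ((-(2 * Real.pi * inner ℝ w η) : ℝ) * Complex.I) * (m w * q' (y + w))‖
        = ‖m w‖ * ‖q' (y + w)‖ := by
    intro q' y w
    rw [norm_mul, Complex.norm_exp_ofReal_mul_I, one_mul, norm_mul]
  obtain ⟨C', C0', hC'⟩ := q_bdd q
  have mi := (m.integrable (μ := volume)).norm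
  have := (hasDerivAt_integral_of_dominated_loc_of_deriv_le (μ := volume) (x₀ := (0 : ℝ))
    (F := fun (s : ℝ) w => Complex.exp ((-(2 * Real.pi * inner ℝ w η) : ℝ) * Complex.I)
      * (m w * q (x + s • ebv j + w)))
    (F' := fun (s : ℝ) w => Complex.exp ((-(2 * Real.pi * inner ℝ w η) : ℝ) * Complex.I)
      * (m w * dj j q (x + s • ebv j + w))) (s := Set.univ) (bound := fun w => C * ‖m w‖)
    univ_mem (Eventually.of_forall fun s => (hc q _).aestronglyMeasurable)
    ((mi.const_mul C').mono' (hc q _).aestronglyMeasurable (Eventually.of_forall fun w => by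
      rw [hn, mul_comm]; gcongr; exact hC' _))
    (hc (dj j q) _).aestronglyMeasurable
    (Eventually.of_forall fun w s _ => by rw [hn, mul_comm]; gcongr; exact hC _)
    (mi.const_mul C)
    (Eventually.of_forall fun w s _ => ((hd s w).const_mul (m w)).const_mul _)).2
  simpa using this

theorem FW_deta (m q : 𝓢(SRE n, ℂ)) (x η : SRE n) (j : Fin n) :
    HasDerivAt (fun s : ℝ => FW m q (x, η + s • ebv j))
      (-(2 * Real.pi * Complex.I) * FW (wj j m) q (x, η)) 0 := by
  have h1 := ((𝓕 (wq m q x) : 𝓢(SRE n, ℂ)).differentiableAt (x := η)).hasFDerivAt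
  have h2 : HasDerivAt (fun s : ℝ => η + s • ebv j) (ebv j) 0 := by
    have := ((hasDerivAt_id (0 : ℝ)).smul_const (ebv j)).const_add η
    simpa using this
  have h1' : HasFDerivAt (⇑(𝓕 (wq m q x) : 𝓢(SRE n, ℂ))) (fderiv ℝ (⇑(𝓕 (wq m q x) : 𝓢(SRE n, ℂ))) η)
      (η + (0 : ℝ) • ebv j) := by simpa using h1
  have h3 := h1'.comp_hasDerivAt (0 : ℝ) h2
  refine h3.congr_deriv ?_
  rw [← SchwartzMap.lineDerivOp_apply_eq_fderiv, SchwartzMap.lineDerivOp_fourier_eq,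
    FourierTransform.fourier_smul, smul_apply, smul_eq_mul]
  congr 1
  unfold FW
  congr 2
  ext w
  have ht : (fun w : SRE n => inner ℝ w (ebv j)).HasTemperateGrowth :=
    ((innerSL ℝ).flip (ebv j)).hasTemperateGrowth
  rw [smulLeftCLM_apply_apply ht, wq_apply, wq_apply, wj_apply, EuclideanSpace.inner_single_right]
  simp [mul_assoc]

theorem FW_smooth {m : 𝓢(SRE n, ℂ)} (hm : HasCompactSupport m) (q : 𝓢(SRE n, ℂ)) :
    ContDiff ℝ (⊤ : ℕ∞) (FW m q) := by
  have hk : IsCompact (Neg.neg '' tsupport m) := hm.isCompact.image continuous_neg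
  have key := contDiffOn_convolution_right_with_param (𝕜 := ℝ) (μ := (volume : Measure (SRE n)))
    (f := ⇑q) (n := ⊤) (ContinuousLinearMap.mul ℝ ℂ)
    (g := fun (η v : SRE n) => Complex.exp ((2 * Real.pi * inner ℝ v η : ℝ) * Complex.I) * m (-v))
    (s := Set.univ) isOpen_univ hk (fun η v _ hv => by
      have : m (-v) = 0 := by
        apply image_eq_zero_of_notMem_tsupport
        intro h
        exact hv ⟨-v, h, by simp⟩
      rw [this, mul_zero])
    (q.integrable.locallyIntegrable) (by
      rw [Set.univ_prod_univ, contDiffOn_univ]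
      have := m.smooth ⊤
      have h1 : ContDiff ℝ (⊤ : ℕ∞) fun p : SRE n × SRE n => m (-p.2) := this.comp contDiff_snd.neg
      have h2 : ContDiff ℝ (⊤ : ℕ∞) fun p : SRE n × SRE n =>
          ((2 * Real.pi * inner ℝ p.2 p.1 : ℝ) : ℂ) :=
        Complex.ofRealCLM.contDiff.comp (contDiff_const.mul (contDiff_snd.inner ℝ contDiff_fst))
      exact (Complex.contDiff_exp.comp (h2.mul contDiff_const)).mul h1)
  rw [Set.univ_prod_univ, contDiffOn_univ] at key
  have := key.comp (contDiff_snd.prodMk contDiff_fst : ContDiff ℝ (⊤ : ℕ∞)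
    fun p : SRE n × SRE n => (p.2, p.1))
  convert this using 1
  funext p
  rw [FW_int]
  simp only [Function.comp, MeasureTheory.convolution, ContinuousLinearMap.mul_apply']
  conv_rhs => rw [← integral_add_left_eq_self _ p.1]
  congr 1; funext w
  simp
  ring
end

section
open Filter MeasureTheory SchwartzMap LineDeriv FourierTransform

variable {n : ℕ}

theorem srp_ibp {f B : SRE n × SRE n → ℝ} (hf : ContDiff ℝ 1 f) {K : NNReal}
    (hB : LipschitzWith K B) (hs : HasCompactSupport B) (v : SRE n × SRE n) :
    ∫ p, fderiv ℝ f p v * B p = - ∫ p, lineDeriv ℝ B p v * f p := by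
  obtain ⟨r, hr0, hr⟩ : ∃ r, 0 < r ∧ tsupport B ⊆ Metric.closedBall 0 r := by
    obtain ⟨r, hr⟩ := hs.isCompact.isBounded.subset_closedBall 0
    exact ⟨max r 1, by positivity, hr.trans (Metric.closedBall_subset_closedBall (le_max_left _ _))⟩
  let κ : ContDiffBump (0 : SRE n × SRE n) := ⟨r + 1, r + 2, by positivity, by linarith⟩
  have k1 : ∀ p ∈ tsupport B, (fun q => κ q) =ᶠ[nhds p] fun _ => 1 := by
    intro p hp
    have : p ∈ Metric.ball (0 : SRE n × SRE n) (r + 1) :=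
      Metric.closedBall_subset_ball (by linarith) (hr hp)
    filter_upwards [Metric.isOpen_ball.mem_nhds this] with q hq
    exact κ.one_of_mem_closedBall (Metric.ball_subset_closedBall hq)
  have hκc : ContDiff ℝ 1 (fun p => f p * κ p) := hf.mul κ.contDiff
  have hκs : HasCompactSupport (fun p => f p * κ p) := κ.hasCompactSupport.mul_left
  obtain ⟨K', hK'⟩ := hκc.lipschitzWith_of_hasCompactSupport hκs (by simp)
  haveI : (volume : Measure (SRE n × SRE n)).IsAddHaarMeasure := Measure.prod.instIsAddHaarMeasure _ _
  have key := LipschitzWith.integral_lineDeriv_mul_eq (μ := volume) hK' hB hs v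
  have e1 : ∀ p, lineDeriv ℝ (fun p => f p * κ p) p v * B p = fderiv ℝ f p v * B p := by
    intro p
    by_cases hp : p ∈ tsupport B
    · congr 1
      have : (fun q => f q * κ q) =ᶠ[nhds p] f := by
        filter_upwards [k1 p hp] with q hq
        rw [hq, mul_one]
      rw [this.lineDeriv_eq, (hf.differentiable (by simp)).differentiableAt.lineDeriv_eq_fderiv]
    · rw [image_eq_zero_of_notMem_tsupport hp, mul_zero, mul_zero]
  have e2 : ∀ p, lineDeriv ℝ B p (-v) * (f p * κ p) = - (lineDeriv ℝ B p v * f p) := by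
    intro p
    rw [lineDeriv_neg]
    by_cases hp : p ∈ tsupport B
    · rw [(k1 p hp).eq_of_nhds]; ring
    · have : B =ᶠ[nhds p] fun _ => 0 := notMem_tsupport_iff_eventuallyEq.1 hp
      rw [this.lineDeriv_eq]; simp [lineDeriv]
  simp only [e1, e2] at key
  rw [key, integral_neg]

noncomputable abbrev DD (n : ℕ) (S : ℝ) : Set (SRE n × SRE n) := Metric.closedBall 0 S ×ˢ Set.univ

theorem DD_meas (S : ℝ) : MeasurableSet (DD n S) := measurableSet_closedBall.prod MeasurableSet.univ

theorem qg_eq {W : SRE n × SRE n → ℂ} {φ : SRE n → 𝓢(SRE n, ℂ)} (hW : Continuous W)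
    (hφ : ∀ p, W p = 𝓕 (φ p.1) p.2) (S : ℝ) :
    ∫⁻ p in DD n S, ENNReal.ofReal (‖W p‖ ^ 2) =
      ∫⁻ x in Metric.closedBall (0 : SRE n) S, ∫⁻ w, ENNReal.ofReal (‖φ x w‖ ^ 2) := by
  have hm : Measurable fun p => ENNReal.ofReal (‖W p‖ ^ 2) := by
    have := hW.measurable; fun_prop
  rw [Measure.volume_eq_prod, ← Measure.prod_restrict, Measure.restrict_univ,
    lintegral_prod _ hm.aemeasurable]
  congr 1; funext x
  have hi : ∀ q : 𝓢(SRE n, ℂ), Integrable fun w => ‖q w‖ ^ 2 := fun q =>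
    (q.memLp 2 volume).integrable_norm_pow (by norm_num)
  simp only [hφ]
  rw [← ofReal_integral_eq_lintegral_ofReal (hi _) (Eventually.of_forall fun _ => by positivity),
    ← ofReal_integral_eq_lintegral_ofReal (hi _) (Eventually.of_forall fun _ => by positivity)]
  congr 1
  exact SchwartzMap.integral_norm_sq_fourier (φ x)

theorem qg_swap {c Q : SRE n → ℝ} (hc : Continuous c) (hc1 : ∀ w, c w ≠ 0 → ‖w‖ ≤ 1)
    (hQ : Continuous Q) (S : ℝ) :
    ∫⁻ x in Metric.closedBall (0 : SRE n) S, ∫⁻ w, ENNReal.ofReal (c w) * ENNReal.ofReal (Q (x + w))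
      ≤ (∫⁻ w, ENNReal.ofReal (c w)) *
        ∫⁻ y in Metric.closedBall (0 : SRE n) (S + 1), ENNReal.ofReal (Q y) := by
  rw [lintegral_lintegral_swap (by
    have := hc.measurable; have := hQ.measurable
    apply Measurable.aemeasurable
    unfold Function.uncurry
    fun_prop)]
  rw [← lintegral_mul_const _ (by have := hc.measurable; fun_prop)]
  refine lintegral_mono fun w => ?_
  rw [lintegral_const_mul _ (by have := hQ.measurable; fun_prop)]
  by_cases h : c w = 0
  · simp [h]
  refine mul_le_mul_right ?_ _
  rw [← lintegral_indicator measurableSet_closedBall, ← lintegral_indicator measurableSet_closedBall,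
    ← lintegral_add_right_eq_self ((Metric.closedBall (0 : SRE n) (S + 1)).indicator _) w]
  refine lintegral_mono fun x => ?_
  by_cases hx : x ∈ Metric.closedBall (0 : SRE n) S
  · have : x + w ∈ Metric.closedBall (0 : SRE n) (S + 1) := by
      simp only [mem_closedBall_zero_iff] at hx ⊢
      exact (norm_add_le _ _).trans (add_le_add hx (hc1 w h))
    rw [Set.indicator_of_mem hx, Set.indicator_of_mem this]
  · rw [Set.indicator_of_notMem hx]; simp

theorem qg {W : SRE n × SRE n → ℂ} {φ : SRE n → 𝓢(SRE n, ℂ)} (hW : Continuous W)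
    (hφ : ∀ p, W p = 𝓕 (φ p.1) p.2) (S : ℝ) {c Q : SRE n → ℝ} (hc : Continuous c)
    (hc0 : ∀ w, 0 ≤ c w) (hci : Integrable c)
    (hc1 : ∀ w, c w ≠ 0 → ‖w‖ ≤ 1) (hQ : Continuous Q) (hQ0 : ∀ y, 0 ≤ Q y)
    (hb : ∀ x, ‖x‖ ≤ S → ∀ w, ‖φ x w‖ ^ 2 ≤ c w * Q (x + w)) :
    IntegrableOn (fun p => ‖W p‖ ^ 2) (DD n S) ∧
    ∫ p in DD n S, ‖W p‖ ^ 2 ≤ (∫ w, c w) * ∫ y in Metric.closedBall (0 : SRE n) (S + 1), Q y := by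
  have hQi : IntegrableOn Q (Metric.closedBall (0 : SRE n) (S + 1)) :=
    hQ.continuousOn.integrableOn_compact (isCompact_closedBall _ _)
  have key : ∫⁻ p in DD n S, ENNReal.ofReal (‖W p‖ ^ 2) ≤ ENNReal.ofReal ((∫ w, c w) *
      ∫ y in Metric.closedBall (0 : SRE n) (S + 1), Q y) := by
    rw [qg_eq hW hφ, ENNReal.ofReal_mul (integral_nonneg hc0),
      ofReal_integral_eq_lintegral_ofReal hci (Eventually.of_forall hc0),
      ofReal_integral_eq_lintegral_ofReal hQi (Eventually.of_forall hQ0)]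
    refine le_trans ?_ (qg_swap hc hc1 hQ S)
    refine setLIntegral_mono' measurableSet_closedBall fun x hx => lintegral_mono fun w => ?_
    rw [← ENNReal.ofReal_mul (hc0 w)]
    exact ENNReal.ofReal_le_ofReal (hb x (by simpa using hx) w)
  have hsm : AEStronglyMeasurable (fun p => ‖W p‖ ^ 2) (volume.restrict (DD n S)) :=
    (hW.norm.pow 2).aestronglyMeasurable
  have hi : IntegrableOn (fun p => ‖W p‖ ^ 2) (DD n S) := by
    refine ⟨hsm, ?_⟩
    rw [hasFiniteIntegral_iff_ofReal (Eventually.of_forall fun _ => by positivity)]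
    exact key.trans_lt ENNReal.ofReal_lt_top
  refine ⟨hi, ?_⟩
  rw [← ofReal_integral_eq_lintegral_ofReal hi (Eventually.of_forall fun _ => by positivity)] at key
  exact (ENNReal.ofReal_le_ofReal_iff (mul_nonneg (integral_nonneg hc0) (integral_nonneg hQ0))).1 key
end

section
open Filter MeasureTheory SchwartzMap LineDeriv FourierTransform

variable {n : ℕ}

noncomputable def FWL (m : 𝓢(SRE n, ℂ)) (p : SRE n × SRE n) : 𝓢(SRE n, ℂ) →ₗ[ℂ] ℂ where
  toFun q := FW m q p
  map_add' a b := by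
    have : wq m (a + b) p.1 = wq m a p.1 + wq m b p.1 := by
      ext w; simp only [add_apply, wq_apply]; ring
    unfold FW; rw [this, FourierTransform.fourier_add, add_apply]
  map_smul' c a := by
    have : wq m (c • a) p.1 = c • wq m a p.1 := by
      ext w; simp only [smul_apply, wq_apply, smul_eq_mul]; ring
    unfold FW; rw [this, FourierTransform.fourier_smul, smul_apply, RingHom.id_apply]

noncomputable def FWM (q : 𝓢(SRE n, ℂ)) (p : SRE n × SRE n) : 𝓢(SRE n, ℂ) →ₗ[ℂ] ℂ where
  toFun m := FW m q p
  map_add' a b := by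
    have : wq (a + b) q p.1 = wq a q p.1 + wq b q p.1 := by
      ext w; simp only [add_apply, wq_apply]; ring
    unfold FW; rw [this, FourierTransform.fourier_add, add_apply]
  map_smul' c a := by
    have : wq (c • a) q p.1 = c • wq a q p.1 := by
      ext w; simp only [smul_apply, wq_apply, smul_eq_mul]; ring
    unfold FW; rw [this, FourierTransform.fourier_smul, smul_apply, RingHom.id_apply]

theorem FW_ff (V : SRE n → ℝ) (h lam t : ℝ) (m u : 𝓢(SRE n, ℂ)) (p) :
    FW m (ff V h lam t u) p = -((h : ℂ) ^ 2) * ∑ j, FW m (dj j (dj j u)) p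
      + FW m (smulLeftCLM ℂ V u) p - ((lam : ℂ) + (t : ℂ) * Complex.I) * FW m u p := by
  have : FWL m p (ff V h lam t u) = -((h : ℂ) ^ 2) * ∑ j, FWL m p (dj j (dj j u))
      + FWL m p (smulLeftCLM ℂ V u) - ((lam : ℂ) + (t : ℂ) * Complex.I) * FWL m p u := by
    unfold ff slap
    rw [map_sub, map_add, map_smul, map_smul, map_sum]
    simp only [smul_eq_mul]
  exact this

theorem sr_isq (q : 𝓢(SRE n, ℂ)) : Integrable fun w => ‖q w‖ ^ 2 :=
    (q.memLp 2 volume).integrable_norm_pow (by norm_num)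

/-- basic bound -/
theorem fw_bd {m : 𝓢(SRE n, ℂ)} (hm : HasCompactSupport m) (hm1 : ∀ w, m w ≠ 0 → ‖w‖ ≤ 1)
    (q : 𝓢(SRE n, ℂ)) (S : ℝ) : IntegrableOn (fun p => ‖FW m q p‖ ^ 2) (DD n S) ∧
    ∫ p in DD n S, ‖FW m q p‖ ^ 2 ≤
      (∫ w, ‖m w‖ ^ 2) * ∫ y in Metric.closedBall (0 : SRE n) (S + 1), ‖q y‖ ^ 2 := by
  refine qg (FW_smooth hm q).continuous (φ := wq m q) (fun p => rfl) S (m.continuous.norm.pow 2)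
    (fun w => by positivity) (sr_isq m) (fun w hw => hm1 w fun h => hw (by simp [h]))
    (q.continuous.norm.pow 2) (fun y => by positivity) fun x _ w => ?_
  rw [wq_apply, norm_mul, mul_pow]

/-- weighted bound -/
theorem fw_bdA {m : 𝓢(SRE n, ℂ)} (hm : HasCompactSupport m) (hm1 : ∀ w, m w ≠ 0 → ‖w‖ ≤ 1)
    (q : 𝓢(SRE n, ℂ)) (S : ℝ) :
    IntegrableOn (fun p => Aw p.1 ^ (-(1/2) : ℝ) * ‖FW m q p‖ ^ 2) (DD n S) ∧
    ∫ p in DD n S, Aw p.1 ^ (-(1/2) : ℝ) * ‖FW m q p‖ ^ 2 ≤ (∫ w, 2 * ‖m w‖ ^ 2) *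
      ∫ y in Metric.closedBall (0 : SRE n) (S + 1), Aw y ^ (-(1/2) : ℝ) * ‖q y‖ ^ 2 := by
  have hA : ∀ α : ℝ, Continuous fun x : SRE n => Aw x ^ α := fun α => (Aw_temp α).1.continuous
  have e : ∀ (x : SRE n) (z : ℂ), ‖((Aw x ^ (-(1/4) : ℝ) : ℝ) : ℂ) * z‖ ^ 2
      = Aw x ^ (-(1/2) : ℝ) * ‖z‖ ^ 2 := fun x z => by
    have := Aw_pos x
    rw [norm_mul, mul_pow, Complex.norm_real, Real.norm_of_nonneg (by positivity),
      ← Real.rpow_natCast, ← Real.rpow_mul this.le]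
    norm_num
  have := qg (W := fun p => ((Aw p.1 ^ (-(1/4) : ℝ) : ℝ) : ℂ) * FW m q p)
    (φ := fun x => ((Aw x ^ (-(1/4) : ℝ) : ℝ) : ℂ) • wq m q x)
    ((Complex.continuous_ofReal.comp ((hA _).comp continuous_fst)).mul (FW_smooth hm q).continuous)
    (fun p => by rw [FourierTransform.fourier_smul, smul_apply, smul_eq_mul]; rfl)
    S (c := fun w => 2 * ‖m w‖ ^ 2) (Q := fun y => Aw y ^ (-(1/2) : ℝ) * ‖q y‖ ^ 2)
    (continuous_const.mul (m.continuous.norm.pow 2))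
    (fun w => by positivity) ((sr_isq m).const_mul 2)
    (fun w hw => hm1 w fun h => hw (by simp [h]))
    ((hA _).mul (q.continuous.norm.pow 2))
    (fun y => mul_nonneg (Real.rpow_nonneg (Aw_pos y).le _) (by positivity)) fun x _ w => by
      rw [smul_apply, smul_eq_mul, e, wq_apply, norm_mul, mul_pow]
      by_cases hw : m w = 0
      · simp [hw]
      have hw1 := hm1 w hw
      have h4 : Aw (x + w) ≤ 4 * Aw x := by
        unfold Aw
        have h1 := norm_add_le x w
        have h2 : ‖x + w‖ ^ 2 ≤ (‖x‖ + 1) ^ 2 := by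
          apply pow_le_pow_left₀ (norm_nonneg _); linarith
        nlinarith [sq_nonneg (‖x‖ - 1)]
      have h5 : (4 * Aw x) ^ (-(1/2) : ℝ) ≤ Aw (x + w) ^ (-(1/2) : ℝ) :=
        Real.rpow_le_rpow_of_nonpos (Aw_pos _) h4 (by norm_num)
      rw [Real.mul_rpow (by norm_num) (Aw_pos x).le] at h5
      have h6 : (4 : ℝ) ^ (-(1/2) : ℝ) = 1 / 2 := by
        rw [show (4 : ℝ) = 2 ^ (2 : ℝ) by norm_num, ← Real.rpow_mul (by norm_num)]
        norm_num
      rw [h6] at h5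
      have : Aw x ^ (-(1/2) : ℝ) ≤ 2 * Aw (x + w) ^ (-(1/2) : ℝ) := by linarith
      calc _ ≤ 2 * Aw (x + w) ^ (-(1/2) : ℝ) * (‖m w‖ ^ 2 * ‖q (x + w)‖ ^ 2) := by gcongr
        _ = _ := by ring
  simpa only [e] using this

/-- remainder -/
noncomputable def FR (v : SRE n → ℝ) (c : Fin n → SRE n → ℝ) (g u : 𝓢(SRE n, ℂ))
    (p : SRE n × SRE n) : ℂ :=
  FW g (smulLeftCLM ℂ v u) p - (v p.1 : ℂ) * FW g u p - ∑ j, (c j p.1 : ℂ) * FW (wj j g) u p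

theorem wj_cs {g : 𝓢(SRE n, ℂ)} (hg : HasCompactSupport g) (j : Fin n) :
    HasCompactSupport (wj j g) := by
  have : ⇑(wj j g) = fun w : SRE n => (w j : ℂ) * g w := funext (wj_apply j g)
  rw [this]; exact hg.mul_left

theorem FR_cont {v : SRE n → ℝ} (hv : v.HasTemperateGrowth) {c : Fin n → SRE n → ℝ}
    (hc : ∀ j, Continuous (c j)) {g : 𝓢(SRE n, ℂ)} (hg : HasCompactSupport g) (u : 𝓢(SRE n, ℂ)) :
    Continuous (FR v c g u) := by
  have h1 := hv.1.continuous
  have h2 := (FW_smooth hg u).continuous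
  have h3 := (FW_smooth hg (smulLeftCLM ℂ v u)).continuous
  have h4 := fun j => (FW_smooth (wj_cs hg j) u).continuous
  have h5 : Continuous fun p : SRE n × SRE n => (v p.1 : ℂ) :=
    Complex.continuous_ofReal.comp (h1.comp continuous_fst)
  refine (h3.sub (h5.mul h2)).sub (continuous_finsetSum _ fun j _ => ?_)
  exact (Complex.continuous_ofReal.comp ((hc j).comp continuous_fst)).mul (h4 j)

theorem fr_bd {v : SRE n → ℝ} (hv : v.HasTemperateGrowth) {c : Fin n → SRE n → ℝ}
    (hc : ∀ j, Continuous (c j)) {g : 𝓢(SRE n, ℂ)} (hg : HasCompactSupport g)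
    (hg1 : ∀ w, g w ≠ 0 → ‖w‖ ≤ 1) (u : 𝓢(SRE n, ℂ)) (S : ℝ) {M : ℝ}
    (hM : ∀ x w, g w ≠ 0 → |v (x + w) - v x - ∑ j, c j x * w j| ≤ M) :
    IntegrableOn (fun p => ‖FR v c g u p‖ ^ 2) (DD n S) ∧
    ∫ p in DD n S, ‖FR v c g u p‖ ^ 2 ≤
      (∫ w, M ^ 2 * ‖g w‖ ^ 2) * ∫ y in Metric.closedBall (0 : SRE n) (S + 1), ‖u y‖ ^ 2 := by
  refine qg (FR_cont hv hc hg u) (φ := fun x => wq g (smulLeftCLM ℂ v u) x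
      - (v x : ℂ) • wq g u x - ∑ j, (c j x : ℂ) • wq (wj j g) u x) (fun p => ?_) S
    (continuous_const.mul (g.continuous.norm.pow 2))
    (fun w => by positivity) ((sr_isq g).const_mul _)
    (fun w hw => hg1 w fun h => hw (by simp [h]))
    (u.continuous.norm.pow 2) (fun y => by positivity) fun x _ w => ?_
  · have : FR v c g u p = fourierₗ ℂ 𝓢(SRE n, ℂ) (wq g (smulLeftCLM ℂ v u) p.1) p.2
       - (v p.1 : ℂ) * fourierₗ ℂ 𝓢(SRE n, ℂ) (wq g u p.1) p.2
       - ∑ j, (c j p.1 : ℂ) * fourierₗ ℂ 𝓢(SRE n, ℂ) (wq (wj j g) u p.1) p.2 := rfl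
    rw [this, ← fourierₗ_apply (R := ℂ), map_sub, map_sub, map_smul, map_sum, sub_apply, sub_apply,
      smul_apply, sum_apply, smul_eq_mul]
    simp only [map_smul, smul_apply, smul_eq_mul]
  · have e : (wq g (smulLeftCLM ℂ v u) x - (v x : ℂ) • wq g u x
        - ∑ j, (c j x : ℂ) • wq (wj j g) u x) w =
        ((v (x + w) - v x - ∑ j, c j x * w j : ℝ) : ℂ) * (g w * u (x + w)) := by
      simp only [sub_apply, smul_apply, sum_apply, wq_apply, wj_apply, smulLeftCLM_apply_apply hv,
        smul_eq_mul, Complex.real_smul]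
      push_cast
      rw [sub_mul, sub_mul, Finset.sum_mul]
      congr 1
      · ring
      · exact Finset.sum_congr rfl fun j _ => by ring
    rw [e, norm_mul, norm_mul, Complex.norm_real, mul_pow, mul_pow, ← mul_assoc]
    by_cases hw : g w = 0
    · simp [hw]
    · have := pow_le_pow_left₀ (abs_nonneg _) (hM x w hw) 2
      rw [Real.norm_eq_abs]
      gcongr
end

section
open Filter MeasureTheory SchwartzMap LineDeriv FourierTransform

variable {n : ℕ}

noncomputable def Jc (a b : ℂ) : ℝ := a.re * b.im - a.im * b.re

theorem Jc_le (a b : ℂ) : |Jc a b| ≤ ‖a‖ * ‖b‖ := by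
  have : Jc a b = (star a * b).im := by simp [Jc, Complex.mul_im]; ring
  rw [this]
  refine (Complex.abs_im_le_norm _).trans ?_
  rw [norm_mul, norm_star]

theorem FW_fx {m : 𝓢(SRE n, ℂ)} (hm : HasCompactSupport m) (q : 𝓢(SRE n, ℂ)) (p) (j : Fin n) :
    fderiv ℝ (FW m q) p (ebv j, 0) = FW m (dj j q) p := by
  have h1 := ((FW_smooth hm q).differentiable (by simp) p).hasFDerivAt
  have h2 : HasDerivAt (fun s : ℝ => ((p.1 + s • ebv j, p.2) : SRE n × SRE n)) (ebv j, 0) 0 := by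
    have := ((hasDerivAt_id (0 : ℝ)).smul_const (ebv j)).const_add p.1
    have := this.prodMk (hasDerivAt_const (0 : ℝ) p.2)
    simpa using this
  have h1' : HasFDerivAt (FW m q) (fderiv ℝ (FW m q) p) (p.1 + (0 : ℝ) • ebv j, p.2) := by simpa using h1
  have h3 := h1'.comp_hasDerivAt (0 : ℝ) h2
  exact h3.unique (FW_dx m q p.1 p.2 j)

theorem FW_fe {m : 𝓢(SRE n, ℂ)} (hm : HasCompactSupport m) (q : 𝓢(SRE n, ℂ)) (p) (j : Fin n) :
    fderiv ℝ (FW m q) p (0, ebv j) = -(2 * Real.pi * Complex.I) * FW (wj j m) q p := by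
  have h1 := ((FW_smooth hm q).differentiable (by simp) p).hasFDerivAt
  have h2 : HasDerivAt (fun s : ℝ => ((p.1, p.2 + s • ebv j) : SRE n × SRE n)) (0, ebv j) 0 := by
    have := ((hasDerivAt_id (0 : ℝ)).smul_const (ebv j)).const_add p.2
    have := (hasDerivAt_const (0 : ℝ) p.1).prodMk this
    simpa using this
  have h1' : HasFDerivAt (FW m q) (fderiv ℝ (FW m q) p) (p.1, p.2 + (0 : ℝ) • ebv j) := by simpa using h1
  have h3 := h1'.comp_hasDerivAt (0 : ℝ) h2
  exact h3.unique (FW_deta m q p.1 p.2 j)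

theorem Jc_cd {E : Type*} [NormedAddCommGroup E] [NormedSpace ℝ E] {a b : E → ℂ}
    (ha : ContDiff ℝ 1 a) (hb : ContDiff ℝ 1 b) : ContDiff ℝ 1 (fun p => Jc (a p) (b p)) := by
  have r := fun {c : E → ℂ} (hc : ContDiff ℝ 1 c) => Complex.reCLM.contDiff.comp hc
  have i := fun {c : E → ℂ} (hc : ContDiff ℝ 1 c) => Complex.imCLM.contDiff.comp hc
  exact ((r ha).mul (i hb)).sub ((i ha).mul (r hb))

theorem Jc_fd {E : Type*} [NormedAddCommGroup E] [NormedSpace ℝ E] {a b : E → ℂ} {p : E}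
    (ha : DifferentiableAt ℝ a p) (hb : DifferentiableAt ℝ b p) (v : E) :
    fderiv ℝ (fun p => Jc (a p) (b p)) p v = Jc (fderiv ℝ a p v) (b p) + Jc (a p) (fderiv ℝ b p v) := by
  have r := fun {c : E → ℂ} (hc : DifferentiableAt ℝ c p) =>
    Complex.reCLM.hasFDerivAt.comp p hc.hasFDerivAt
  have i := fun {c : E → ℂ} (hc : DifferentiableAt ℝ c p) =>
    Complex.imCLM.hasFDerivAt.comp p hc.hasFDerivAt
  have := (((r ha).mul (i hb)).sub ((i ha).mul (r hb))).fderiv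
  have e : (fun p => Jc (a p) (b p)) = (Complex.reCLM ∘ a) * (Complex.imCLM ∘ b)
    - (Complex.imCLM ∘ a) * (Complex.reCLM ∘ b) := rfl
  rw [e, this]
  simp [Jc]; ring

theorem nsq_fd {E : Type*} [NormedAddCommGroup E] [NormedSpace ℝ E] {a : E → ℂ} {p : E}
    (ha : DifferentiableAt ℝ a p) (v : E) : fderiv ℝ (fun p => ‖a p‖ ^ 2) p v
      = 2 * ((a p).re * (fderiv ℝ a p v).re + (a p).im * (fderiv ℝ a p v).im) := by
  have := (ha.hasFDerivAt.norm_sq).fderiv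
  rw [this]
  simp [Complex.inner]; ring

noncomputable def lsc (c : ℝ) : SRE n × SRE n →L[ℝ] SRE n × SRE n :=
  (ContinuousLinearMap.fst ℝ (SRE n) (SRE n)).prod (c • ContinuousLinearMap.snd ℝ (SRE n) (SRE n))
theorem lsc_apply (c : ℝ) (p : SRE n × SRE n) : lsc c p = (p.1, c • p.2) := rfl

theorem lsc_inv {c : ℝ} (hc : c ≠ 0) (p : SRE n × SRE n) : lsc c (lsc c⁻¹ p) = p := by
  simp [lsc_apply, hc]
theorem lsc_inv' {c : ℝ} (hc : c ≠ 0) (p : SRE n × SRE n) : lsc c⁻¹ (lsc c p) = p := by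
  simp [lsc_apply, hc]

theorem lsc_cs {c : ℝ} (hc : c ≠ 0) {b : SRE n × SRE n → ℝ} (hb : HasCompactSupport b) :
    HasCompactSupport (fun p => b (lsc c p)) := by
  refine HasCompactSupport.of_support_subset_isCompact (hb.isCompact.image (lsc c⁻¹).continuous) ?_
  intro p hp
  exact ⟨lsc c p, subset_tsupport _ hp, lsc_inv' hc p⟩

/-- pairing with a line derivative is integrable -/
theorem ld_int {B f : SRE n × SRE n → ℝ} {K : NNReal} (hB : LipschitzWith K B)
    (hs : HasCompactSupport B) (hf : Continuous f) (v) :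
    Integrable fun p => lineDeriv ℝ B p v * f p := by
  obtain ⟨r, hr0, hr⟩ : ∃ r, 0 < r ∧ tsupport B ⊆ Metric.closedBall 0 r := by
    obtain ⟨r, hr⟩ := hs.isCompact.isBounded.subset_closedBall 0
    exact ⟨max r 1, by positivity, hr.trans (Metric.closedBall_subset_closedBall (le_max_left _ _))⟩
  let κ : ContDiffBump (0 : SRE n × SRE n) := ⟨r + 1, r + 2, by positivity, by linarith⟩
  have i1 : Integrable fun p => f p * κ p :=
    (hf.mul κ.continuous).integrable_of_hasCompactSupport κ.hasCompactSupport.mul_left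
  have i2 := i1.bdd_mul (c := K * ‖v‖) (f := fun p => lineDeriv ℝ B p v)
    ((measurable_lineDeriv hB.continuous).aestronglyMeasurable)
    (Eventually.of_forall fun p => norm_lineDeriv_le_of_lipschitz ℝ hB)
  refine i2.congr (Eventually.of_forall fun p => ?_)
  dsimp only
  by_cases hp : p ∈ tsupport B
  · rw [κ.one_of_mem_closedBall (Metric.closedBall_subset_closedBall (by change r ≤ r + 1; linarith)
      (hr hp)), mul_one]
  · have : B =ᶠ[nhds p] fun _ => 0 := notMem_tsupport_iff_eventuallyEq.1 hp
    rw [this.lineDeriv_eq]; simp [lineDeriv]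
end

section
open Filter MeasureTheory SchwartzMap LineDeriv FourierTransform

variable {n : ℕ}

noncomputable def cV (V : SRE n → ℝ) (j : Fin n) (x : SRE n) : ℝ := fderiv ℝ V x (ebv j)

theorem cV_cd {V : SRE n → ℝ} (hV : ContDiff ℝ (⊤ : ℕ∞) V) (j : Fin n) : ContDiff ℝ 1 (cV V j) :=
  (hV.fderiv_right (m := 1) (by norm_cast)).clm_apply contDiff_const

theorem int_add_sub {α : Type*} [MeasurableSpace α] {μ : Measure α} {f g k : α → ℝ}
    (hf : Integrable f μ) (hg : Integrable g μ) (hk : Integrable k μ) :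
    ∫ x, (f x + (g x - k x)) ∂μ = ∫ x, f x ∂μ + (∫ x, g x ∂μ - ∫ x, k x ∂μ) := by
  have : Integrable (fun x => g x - k x) μ := hg.sub hk
  rw [integral_add hf this, integral_sub hg hk]

/-- pointwise transport identity -/
theorem tr_pt {V : SRE n → ℝ} (hV : ContDiff ℝ (⊤ : ℕ∞) V) (h lam t : ℝ) {g : 𝓢(SRE n, ℂ)}
    (hg : HasCompactSupport g) (u : 𝓢(SRE n, ℂ)) (p : SRE n × SRE n) :
    t * ‖FW g u p‖ ^ 2 = - Jc (FW g u p) (FW g (ff V h lam t u) p)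
      + Jc (FW g u p) (FR V (cV V) g u p)
      - ∑ j, h ^ 2 * fderiv ℝ (fun p => Jc (FW g u p) (FW g (dj j u) p)) p (ebv j, 0)
      + ∑ j, 1 / (4 * Real.pi) * fderiv ℝ (fun p => cV V j p.1 * ‖FW g u p‖ ^ 2) p (0, ebv j) := by
  have dF : ∀ q, DifferentiableAt ℝ (FW g q) p := fun q => (FW_smooth hg q).differentiable (by simp) p
  have e1 : ∀ j, fderiv ℝ (fun p => Jc (FW g u p) (FW g (dj j u) p)) p (ebv j, 0) =
      Jc (FW g u p) (FW g (dj j (dj j u)) p) := fun j => by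
    rw [Jc_fd (dF _) (dF _), FW_fx hg, FW_fx hg]
    simp [Jc]; ring
  have e2 : ∀ j, 1 / (4 * Real.pi) * fderiv ℝ (fun p => cV V j p.1 * ‖FW g u p‖ ^ 2) p (0, ebv j) =
      cV V j p.1 * Jc (FW g u p) (FW (wj j g) u p) := fun j => by
    have d1 : DifferentiableAt ℝ (fun p : SRE n × SRE n => cV V j p.1) p :=
      (((cV_cd hV j).differentiable (by simp)) p.1).comp p differentiableAt_fst
    have d0 : fderiv ℝ (fun p : SRE n × SRE n => cV V j p.1) p (0, ebv j) = 0 := by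
      have := fderiv_comp' p (((cV_cd hV j).differentiable (by simp)) p.1)
        (differentiableAt_fst (𝕜 := ℝ) (E := SRE n) (F := SRE n))
      rw [this]; simp [fderiv_fst]
    rw [fderiv_fun_mul d1 ((dF u).norm_sq ℝ)]
    simp only [ContinuousLinearMap.add_apply, ContinuousLinearMap.smul_apply, d0,
      nsq_fd (dF u), FW_fe hg, smul_eq_mul]
    have := Real.pi_pos
    field_simp
    simp [Jc]; ring
  simp only [e1, e2]
  have hR : FW g (smulLeftCLM ℂ V u) p = FR V (cV V) g u p + (V p.1 : ℂ) * FW g u p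
      + ∑ j, (cV V j p.1 : ℂ) * FW (wj j g) u p := by unfold FR; ring
  rw [FW_ff, hR]
  have s1 : ∀ (c : Fin n → ℝ) (w : Fin n → ℂ) (a : ℂ),
      ∑ j, c j * Jc a (w j) = Jc a (∑ j, (c j : ℂ) * w j) := fun c w a => by
    simp only [Jc, Complex.im_sum, Complex.re_sum, Complex.re_ofReal_mul, Complex.im_ofReal_mul,
      Finset.mul_sum, ← Finset.sum_sub_distrib]
    exact Finset.sum_congr rfl fun j _ => by ring
  rw [s1, s1]
  simp only [Complex.ofReal_pow, ← Finset.mul_sum]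
  generalize (∑ j, FW g (dj j (dj j u)) p) = X
  generalize (∑ j, (cV V j p.1 : ℂ) * FW (wj j g) u p) = Y
  generalize FR V (cV V) g u p = Z
  have e3 : ((h : ℂ) ^ 2) = ((h ^ 2 : ℝ) : ℂ) := by push_cast; rfl
  rw [e3, ← Complex.normSq_eq_norm_sq, Complex.normSq_apply]
  simp [Jc]
  ring

theorem XV_sum (V : SRE n → ℝ) (H : ∀ z w, inner ℝ (gradient V z) w = fderiv ℝ V z w)
    (L : SRE n × SRE n →L[ℝ] ℝ) (y : SRE n × SRE n) :
    L (XV V y) = ∑ j, 2 * y.2 j * L (ebv j, 0) - ∑ j, cV V j y.1 * L (0, ebv j) := by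
  have e : ∀ v : SRE n, v = ∑ j, v j • ebv j := fun v => by
    ext i; simp [ebv, Pi.single_apply]
  have hg : ∀ j, (gradient V y.1) j = cV V j y.1 := fun j => by
    have := H y.1 (ebv j)
    rw [EuclideanSpace.inner_single_right] at this
    simpa [cV] using this
  have e1 : ∀ v : SRE n, L (v, 0) = ∑ j, v j * L (ebv j, 0) := fun v => by
    have : L (v, 0) = (L.comp (ContinuousLinearMap.inl ℝ _ _)) v := rfl
    rw [this]; conv_lhs => rw [e v]
    simp only [map_sum, map_smul, smul_eq_mul]; rfl
  have e2 : ∀ v : SRE n, L (0, v) = ∑ j, v j * L (0, ebv j) := fun v => by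
    have : L (0, v) = (L.comp (ContinuousLinearMap.inr ℝ _ _)) v := rfl
    rw [this]; conv_lhs => rw [e v]
    simp only [map_sum, map_smul, smul_eq_mul]; rfl
  have : XV V y = ((2 : ℝ) • y.2, 0) - (0, gradient V y.1) := by simp [XV]
  rw [this, map_sub, e1, e2]
  simp [hg]

theorem transport {V : SRE n → ℝ} (hV : ContDiff ℝ (⊤ : ℕ∞) V) (hT : V.HasTemperateGrowth)
    (H : ∀ z w, inner ℝ (gradient V z) w = fderiv ℝ V z w)
    {h lam t : ℝ} (hh : 0 < h) (ht : 0 < t) {g : 𝓢(SRE n, ℂ)}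
    (hg : HasCompactSupport g) (u : 𝓢(SRE n, ℂ)) {b : SRE n × SRE n → ℝ} {K : NNReal}
    (hb : LipschitzWith K b) (hs : HasCompactSupport b) (hb0 : ∀ y, 0 ≤ b y)
    {S M : ℝ} (hbS : ∀ y, b y ≠ 0 → ‖y.1‖ ≤ S) (hbM : ∀ y, b y ≤ M) :
    ∃ T : SRE n × SRE n → ℝ, Integrable T ∧ 0 ≤ ∫ p, T p ∧ ∀ᵐ p,
      DifferentiableAt ℝ b (lsc (2 * Real.pi * h) p) ∧
      T p ≤ h / 2 * fderiv ℝ b (lsc (2 * Real.pi * h) p) (XV V (lsc (2 * Real.pi * h) p))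
          * ‖FW g u p‖ ^ 2 + (DD n S).indicator (fun p =>
            M * (‖FW g u p‖ * ‖FW g (ff V h lam t u) p‖) + M * (‖FW g u p‖ * ‖FR V (cV V) g u p‖)
            + h ^ 2 * K * ∑ j, ‖FW g u p‖ * ‖FW (dj j g) u p‖) p := by
  have hc : (2 * Real.pi * h) ≠ 0 := by have := Real.pi_pos; positivity
  set c := 2 * Real.pi * h with hcd
  set B : SRE n × SRE n → ℝ := fun p => b (lsc c p) with hBd
  have hBs : HasCompactSupport B := lsc_cs hc hs
  have hBl : LipschitzWith (K * ‖(lsc c : SRE n × SRE n →L[ℝ] _)‖₊) B := hb.comp (lsc c).lipschitz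
  have cF : ∀ q, ContDiff ℝ 1 (FW g q) := fun q => (FW_smooth hg q).of_le (by norm_cast)
  have kF : ∀ q, Continuous (FW g q) := fun q => (cF q).continuous
  have kJ : ∀ {a b : SRE n × SRE n → ℂ}, Continuous a → Continuous b →
      Continuous fun p => Jc (a p) (b p) := fun ha hb =>
    ((Complex.continuous_re.comp ha).mul (Complex.continuous_im.comp hb)).sub
      ((Complex.continuous_im.comp ha).mul (Complex.continuous_re.comp hb))
  have cG : ∀ j, ContDiff ℝ 1 (fun p => Jc (FW g u p) (FW g (dj j u) p)) := fun j =>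
    Jc_cd (cF _) (cF _)
  have cP : ∀ j, ContDiff ℝ 1 (fun p : SRE n × SRE n => cV V j p.1 * ‖FW g u p‖ ^ 2) := fun j =>
    ((cV_cd hV j).comp contDiff_fst).mul ((cF u).norm_sq ℝ)
  have iB : ∀ {f : SRE n × SRE n → ℝ}, Continuous f → Integrable fun p => f p * B p := fun hf =>
    (hf.mul hBl.continuous).integrable_of_hasCompactSupport hBs.mul_left
  have kR : Continuous (FR V (cV V) g u) := FR_cont hT (fun j => (cV_cd hV j).continuous) hg u
  have i1 := iB (kJ (kF u) (kF (ff V h lam t u)))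
  have i2 := iB (kJ (kF u) kR)
  have i3 : ∀ j, Integrable fun p => fderiv ℝ (fun p => Jc (FW g u p) (FW g (dj j u) p)) p (ebv j, 0) * B p :=
    fun j => iB (((cG j).continuous_fderiv (by simp)).clm_apply continuous_const)
  have i4 : ∀ j, Integrable fun p =>
      fderiv ℝ (fun p : SRE n × SRE n => cV V j p.1 * ‖FW g u p‖ ^ 2) p (0, ebv j) * B p :=
    fun j => iB (((cP j).continuous_fderiv (by simp)).clm_apply continuous_const)
  have i3' : ∀ j, Integrable fun p => lineDeriv ℝ B p (ebv j, 0) * Jc (FW g u p) (FW g (dj j u) p) :=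
    fun j => ld_int hBl hBs (cG j).continuous _
  have i4' : ∀ j, Integrable fun p => lineDeriv ℝ B p (0, ebv j) * (cV V j p.1 * ‖FW g u p‖ ^ 2) :=
    fun j => ld_int hBl hBs (cP j).continuous _
  have j3 : Integrable fun p => ∑ j, h ^ 2 *
      (fderiv ℝ (fun p => Jc (FW g u p) (FW g (dj j u) p)) p (ebv j, 0) * B p) :=
    integrable_finsetSum _ fun j _ => (i3 j).const_mul _
  have j4 : Integrable fun p => ∑ j, 1 / (4 * Real.pi) *
      (fderiv ℝ (fun p : SRE n × SRE n => cV V j p.1 * ‖FW g u p‖ ^ 2) p (0, ebv j) * B p) :=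
    integrable_finsetSum _ fun j _ => (i4 j).const_mul _
  have j3' : Integrable fun p => ∑ j, h ^ 2 *
      (lineDeriv ℝ B p (ebv j, 0) * Jc (FW g u p) (FW g (dj j u) p)) :=
    integrable_finsetSum _ fun j _ => (i3' j).const_mul _
  have j4' : Integrable fun p => ∑ j, 1 / (4 * Real.pi) *
      (lineDeriv ℝ B p (0, ebv j) * (cV V j p.1 * ‖FW g u p‖ ^ 2)) :=
    integrable_finsetSum _ fun j _ => (i4' j).const_mul _
  have i12 : Integrable fun p => - (Jc (FW g u p) (FW g (ff V h lam t u) p) * B p)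
      + Jc (FW g u p) (FR V (cV V) g u p) * B p := i1.neg.add i2
  refine ⟨fun p => (- (Jc (FW g u p) (FW g (ff V h lam t u) p) * B p)
      + Jc (FW g u p) (FR V (cV V) g u p) * B p)
      + (∑ j, h ^ 2 * (lineDeriv ℝ B p (ebv j, 0) * Jc (FW g u p) (FW g (dj j u) p))
      - ∑ j, 1 / (4 * Real.pi) * (lineDeriv ℝ B p (0, ebv j) * (cV V j p.1 * ‖FW g u p‖ ^ 2))),
    i12.add (j3'.sub j4'), ?_, ?_⟩
  · have h0 : 0 ≤ ∫ p, t * ‖FW g u p‖ ^ 2 * B p := integral_nonneg fun p => by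
      have := hb0 (lsc c p); positivity
    refine h0.trans (le_of_eq ?_)
    have e : ∀ p, t * ‖FW g u p‖ ^ 2 * B p = (- (Jc (FW g u p) (FW g (ff V h lam t u) p) * B p)
      + Jc (FW g u p) (FR V (cV V) g u p) * B p)
      + (∑ j, 1 / (4 * Real.pi) *
      (fderiv ℝ (fun p : SRE n × SRE n => cV V j p.1 * ‖FW g u p‖ ^ 2) p (0, ebv j) * B p)
       - ∑ j, h ^ 2 *
      (fderiv ℝ (fun p => Jc (FW g u p) (FW g (dj j u) p)) p (ebv j, 0) * B p)) := fun p => by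
      rw [tr_pt hV h lam t hg u p]
      simp only [← mul_assoc, ← Finset.sum_mul]
      ring
    simp only [e]
    rw [int_add_sub i12 j4 j3, int_add_sub i12 j3' j4']
    congr 1
    rw [integral_finsetSum _ fun j _ => (i3 j).const_mul _,
      integral_finsetSum _ fun j _ => (i4 j).const_mul _,
      integral_finsetSum _ fun j _ => (i3' j).const_mul _,
      integral_finsetSum _ fun j _ => (i4' j).const_mul _]
    simp only [integral_const_mul, srp_ibp (cG _) hBl hBs, srp_ibp (cP _) hBl hBs, mul_neg,
      Finset.sum_neg_distrib]
    ring
  · haveI : (volume : Measure (SRE n × SRE n)).IsAddHaarMeasure :=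
      Measure.prod.instIsAddHaarMeasure _ _
    filter_upwards [hBl.ae_differentiableAt (μ := volume)] with p hp
    have hbd : DifferentiableAt ℝ b (lsc c p) := by
      have e : b = B ∘ lsc c⁻¹ := by
        funext y; simp only [hBd, Function.comp, lsc_inv hc]
      have hp' : DifferentiableAt ℝ B (lsc c⁻¹ (lsc c p)) := by rwa [lsc_inv' hc]
      rw [e]
      exact hp'.comp _ (lsc c⁻¹).differentiableAt
    refine ⟨hbd, ?_⟩
    have hld : ∀ v, lineDeriv ℝ B p v = fderiv ℝ b (lsc c p) (lsc c v) := fun v => by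
      rw [hp.lineDeriv_eq_fderiv]
      have := (hbd.hasFDerivAt.comp p (lsc c).hasFDerivAt).fderiv
      have e : B = b ∘ lsc c := rfl
      rw [e, this]; rfl
    set L := fderiv ℝ b (lsc c p) with hL
    have l1 : ∀ j : Fin n, lsc c (ebv j, 0) = ((ebv j, 0) : SRE n × SRE n) := fun j => by
      simp [lsc_apply]
    have l2 : ∀ j : Fin n, lsc c (0, ebv j) = c • ((0, ebv j) : SRE n × SRE n) := fun j => by
      simp [lsc_apply]
    simp only [hld, l1, l2, map_smul, smul_eq_mul]
    have hG : ∀ j, Jc (FW g u p) (FW g (dj j u) p) =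
        2 * Real.pi * p.2 j * ‖FW g u p‖ ^ 2 - Jc (FW g u p) (FW (dj j g) u p) := fun j => by
      rw [FW_dj, ← Complex.normSq_eq_norm_sq, Complex.normSq_apply]
      simp [Jc]; ring
    have main : ∑ j, h ^ 2 * (L (ebv j, 0) * Jc (FW g u p) (FW g (dj j u) p))
        - ∑ j, 1 / (4 * Real.pi) * (c * L (0, ebv j) * (cV V j p.1 * ‖FW g u p‖ ^ 2))
        = h / 2 * L (XV V (lsc c p)) * ‖FW g u p‖ ^ 2
          - ∑ j, h ^ 2 * (L (ebv j, 0) * Jc (FW g u p) (FW (dj j g) u p)) := by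
      rw [XV_sum V H L]
      simp only [hG, lsc_apply, mul_sub, sub_mul, Finset.sum_sub_distrib, Finset.mul_sum,
        Finset.sum_mul]
      have t1 : ∀ j, h ^ 2 * (L (ebv j, 0) * (2 * Real.pi * p.2 j * ‖FW g u p‖ ^ 2)) =
          h / 2 * (2 * (c • p.2) j * L (ebv j, 0)) * ‖FW g u p‖ ^ 2 := fun j => by
        simp [hcd]; ring
      have t2 : ∀ j, 1 / (4 * Real.pi) * (c * L (0, ebv j) * (cV V j p.1 * ‖FW g u p‖ ^ 2)) =
          h / 2 * (cV V j p.1 * L (0, ebv j)) * ‖FW g u p‖ ^ 2 := fun j => by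
        have := Real.pi_pos
        rw [hcd]; field_simp; ring
      simp only [t1, t2]
      ring
    rw [main]
    by_cases hD : p ∈ DD n S
    · rw [Set.indicator_of_mem hD]
      have hM := hbM (lsc c p)
      have h0 := hb0 (lsc c p)
      have q1 : - (Jc (FW g u p) (FW g (ff V h lam t u) p) * B p) ≤
          M * (‖FW g u p‖ * ‖FW g (ff V h lam t u) p‖) := by
        have := (neg_le_abs _).trans (Jc_le (FW g u p) (FW g (ff V h lam t u) p))
        rw [← neg_mul, mul_comm]
        calc _ ≤ B p * (‖FW g u p‖ * ‖FW g (ff V h lam t u) p‖) := mul_le_mul_of_nonneg_left this h0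
          _ ≤ _ := mul_le_mul_of_nonneg_right hM (by positivity)
      have q2 : Jc (FW g u p) (FR V (cV V) g u p) * B p ≤
          M * (‖FW g u p‖ * ‖FR V (cV V) g u p‖) := by
        have := (le_abs_self _).trans (Jc_le (FW g u p) (FR V (cV V) g u p))
        rw [mul_comm]
        calc _ ≤ B p * (‖FW g u p‖ * ‖FR V (cV V) g u p‖) := mul_le_mul_of_nonneg_left this h0
          _ ≤ _ := mul_le_mul_of_nonneg_right hM (by positivity)
      have q3 : -∑ j, h ^ 2 * (L (ebv j, 0) * Jc (FW g u p) (FW (dj j g) u p)) ≤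
          h ^ 2 * K * ∑ j, ‖FW g u p‖ * ‖FW (dj j g) u p‖ := by
        rw [← Finset.sum_neg_distrib, Finset.mul_sum]
        refine Finset.sum_le_sum fun j _ => ?_
        have a1 : |L (ebv j, 0)| ≤ K := by
          have := L.le_opNorm ((ebv j, 0) : SRE n × SRE n)
          have e1 : ‖((ebv j, 0) : SRE n × SRE n)‖ = 1 := by simp [Prod.norm_def]
          rw [e1, mul_one] at this
          exact this.trans (norm_fderiv_le_of_lipschitz ℝ hb)
        have a2 := Jc_le (FW g u p) (FW (dj j g) u p)
        calc _ ≤ |h ^ 2 * (L (ebv j, 0) * Jc (FW g u p) (FW (dj j g) u p))| := neg_le_abs _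
          _ = h ^ 2 * (|L (ebv j, 0)| * |Jc (FW g u p) (FW (dj j g) u p)|) := by
            rw [abs_mul, abs_mul, abs_of_nonneg (by positivity : (0:ℝ) ≤ h ^ 2)]
          _ ≤ h ^ 2 * (K * (‖FW g u p‖ * ‖FW (dj j g) u p‖)) := by gcongr
          _ = _ := by ring
      linarith
    · rw [Set.indicator_of_notMem hD]
      have hS : ¬ ‖(lsc c p).1‖ ≤ S := fun h' => hD ⟨by simpa [lsc_apply] using h', trivial⟩
      have hts : lsc c p ∉ tsupport b := by
        intro hmem
        have hcl : IsClosed {y : SRE n × SRE n | ‖y.1‖ ≤ S} :=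
          isClosed_le continuous_fst.norm continuous_const
        exact hS (closure_minimal (fun y hy => hbS y hy) hcl hmem)
      have z1 : B p = 0 := image_eq_zero_of_notMem_tsupport (f := b) hts
      have z2 : L = 0 := by
        rw [hL, (notMem_tsupport_iff_eventuallyEq.1 hts).fderiv_eq]; simp
      simp [z1, z2]
end

section
open Filter MeasureTheory SchwartzMap LineDeriv FourierTransform

variable {n : ℕ}

structure Win (g : 𝓢(SRE n, ℂ)) (δ Cg : ℝ) : Prop where
  cs : HasCompactSupport g
  s0 : ∀ w, g w ≠ 0 → ‖w‖ ≤ δ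
  cd : ∀ j, HasCompactSupport (dj j g)
  sd : ∀ j w, dj j g w ≠ 0 → ‖w‖ ≤ δ
  cl : HasCompactSupport (slap g)
  sl : ∀ w, slap g w ≠ 0 → ‖w‖ ≤ δ
  i0 : ∫ w, ‖g w‖ ^ 2 = 1
  i1 : ∀ j, ∫ w, ‖dj j g w‖ ^ 2 ≤ Cg / δ ^ 2
  i2 : ∫ w, ‖slap g w‖ ^ 2 ≤ Cg / δ ^ 4

theorem dj_supp {g : 𝓢(SRE n, ℂ)} {δ : ℝ} (hs : ∀ w, g w ≠ 0 → ‖w‖ ≤ δ) (j : Fin n) :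
    ∀ w, dj j g w ≠ 0 → ‖w‖ ≤ δ := by
  intro w hw
  have hcl : IsClosed {y : SRE n | ‖y‖ ≤ δ} := isClosed_le continuous_norm continuous_const
  by_contra h
  apply hw
  have hts : w ∉ tsupport g := fun hm => h (closure_minimal (fun y hy => hs y hy) hcl hm)
  unfold dj
  rw [SchwartzMap.lineDerivOp_apply_eq_fderiv, (notMem_tsupport_iff_eventuallyEq.1 hts).fderiv_eq]
  simp

theorem cs_of {g : SRE n → ℂ} {δ : ℝ} (hs : ∀ w, g w ≠ 0 → ‖w‖ ≤ δ) : HasCompactSupport g :=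
  HasCompactSupport.of_support_subset_isCompact (isCompact_closedBall 0 δ)
    fun w hw => by simpa using hs w hw

theorem dj_scale {g q : 𝓢(SRE n, ℂ)} {c : ℂ} {r : ℝ} (hg : ∀ w, g w = c * q (r • w)) (j : Fin n) :
    ∀ w, dj j g w = (c * r) * dj j q (r • w) := by
  intro w
  have e : ⇑g = fun w => c * q (r • w) := funext hg
  unfold dj
  rw [SchwartzMap.lineDerivOp_apply_eq_fderiv, SchwartzMap.lineDerivOp_apply_eq_fderiv, e]
  have h1 : HasFDerivAt (fun w : SRE n => r • w) (r • ContinuousLinearMap.id ℝ (SRE n)) w :=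
    (hasFDerivAt_id w).const_smul r
  have h2 := (q.differentiableAt (x := r • w)).hasFDerivAt.comp w h1
  have h3 := (h2.const_mul c).fderiv
  have e2 : (fun w => c * q (r • w)) = fun w => c * (⇑q ∘ fun w : SRE n => r • w) w := rfl
  rw [e2, h3]
  simp [mul_assoc]

theorem int_scale (q : 𝓢(SRE n, ℂ)) (c : ℂ) {δ : ℝ} (hδ : 0 < δ) :
    ∫ w, ‖c * q (δ⁻¹ • w)‖ ^ 2 = ‖c‖ ^ 2 * (δ ^ n * ∫ w, ‖q w‖ ^ 2) := by
  have := Measure.integral_comp_inv_smul_of_nonneg (volume : Measure (SRE n)) (fun w => ‖q w‖ ^ 2) hδ.le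
  simp only [norm_mul, mul_pow, integral_const_mul]
  rw [this]; simp

theorem q0_exists (n : ℕ) : ∃ q : 𝓢(SRE n, ℂ), 0 < ∫ w, ‖q w‖ ^ 2 ∧ ∀ w, q w ≠ 0 → ‖w‖ ≤ 1 := by
  let g0 : ContDiffBump (0 : SRE n) := ⟨1 / 2, 1, by norm_num, by norm_num⟩
  have c0 : HasCompactSupport fun w => (g0 w : ℂ) :=
    g0.hasCompactSupport.comp_left (g := ((↑) : ℝ → ℂ)) (by simp)
  have d0 : ContDiff ℝ (⊤ : ℕ∞) fun w => (g0 w : ℂ) := Complex.ofRealCLM.contDiff.comp g0.contDiff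
  let q : 𝓢(SRE n, ℂ) := c0.toSchwartzMap d0
  have hq : ∀ w, q w = (g0 w : ℂ) := fun w => rfl
  refine ⟨q, ?_, fun w hw => ?_⟩
  · refine (integral_pos_iff_support_of_nonneg (fun w => by positivity) (sr_isq q)).2 ?_
    have hop : IsOpen (Function.support fun w => ‖q w‖ ^ 2) :=
      isOpen_ne_fun (q.continuous.norm.pow 2) continuous_const
    refine hop.measure_pos _ ⟨0, ?_⟩
    simp [hq, g0.one_of_mem_closedBall (x := 0) (by simp [g0.rIn_pos.le])]
  · rw [hq] at hw
    by_contra hn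
    apply hw
    rw [g0.zero_of_le_dist (by rw [dist_zero_right]; exact (not_le.1 hn).le)]
    simp

theorem Win_exists (n : ℕ) : ∃ Cg, 0 < Cg ∧ ∀ δ : ℝ, 0 < δ → ∃ g : 𝓢(SRE n, ℂ), Win g δ Cg := by
  obtain ⟨q, M0, hq⟩ := q0_exists n
  obtain ⟨A0, hA0⟩ : ∃ x, x = ∫ w, ‖q w‖ ^ 2 := ⟨_, rfl⟩
  obtain ⟨A1, hA1⟩ : ∃ x, x = ∑ j, ∫ w, ‖dj j q w‖ ^ 2 := ⟨_, rfl⟩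
  obtain ⟨A2, hA2⟩ : ∃ x, x = ∫ w, ‖slap q w‖ ^ 2 := ⟨_, rfl⟩
  rw [← hA0] at M0
  have p1 : 0 ≤ A1 := hA1 ▸ Finset.sum_nonneg fun j _ => integral_nonneg fun w => by positivity
  have p2 : 0 ≤ A2 := hA2 ▸ integral_nonneg fun w => by positivity
  refine ⟨(A1 + A2 + 1) / A0, by positivity, fun δ hδ => ?_⟩
  let ℓ : SRE n ≃L[ℝ] SRE n := ContinuousLinearEquiv.smulLeft (Units.mk0 δ⁻¹ (inv_ne_zero hδ.ne'))
  let r : ℝ := (√(δ ^ n * A0))⁻¹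
  have hr : ‖(r : ℂ)‖ ^ 2 * (δ ^ n * A0) = 1 := by
    rw [Complex.norm_real, Real.norm_eq_abs, sq_abs]
    have : 0 < δ ^ n * A0 := by positivity
    simp only [r, inv_pow, Real.sq_sqrt this.le]
    field_simp
  let g : 𝓢(SRE n, ℂ) := (r : ℂ) • compCLMOfContinuousLinearEquiv ℂ ℓ q
  have hg : ∀ w, g w = (r : ℂ) * q (δ⁻¹ • w) := fun w => rfl
  have hgj : ∀ j w, dj j g w = (r * δ⁻¹ : ℂ) * dj j q (δ⁻¹ • w) := fun j w => by
    rw [dj_scale hg j w]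
  have hgl : ∀ w, slap g w = (r * δ⁻¹ * δ⁻¹ : ℂ) * slap q (δ⁻¹ • w) := fun w => by
    rw [slap_apply, slap_apply, Finset.mul_sum]
    refine Finset.sum_congr rfl fun j _ => ?_
    rw [dj_scale (hgj j) j w]
  have s0 : ∀ w, g w ≠ 0 → ‖w‖ ≤ δ := by
    intro w hw
    rw [hg] at hw
    have : q (δ⁻¹ • w) ≠ 0 := fun h => hw (by simp [h])
    have := hq _ this
    rw [norm_smul, norm_inv, Real.norm_of_nonneg hδ.le, inv_mul_eq_div, div_le_iff₀ hδ] at this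
    linarith
  have sl : ∀ w, slap g w ≠ 0 → ‖w‖ ≤ δ := by
    intro w hw
    rw [slap_apply] at hw
    obtain ⟨j, _, hj⟩ := Finset.exists_ne_zero_of_sum_ne_zero hw
    exact dj_supp (dj_supp s0 j) j w hj
  have nδ : ‖((δ⁻¹ : ℝ) : ℂ)‖ = δ⁻¹ := by
    rw [Complex.norm_real, Real.norm_of_nonneg (by positivity)]
  have hr' : ‖(r : ℂ)‖ ^ 2 * δ ^ n = 1 / A0 := by
    rw [eq_div_iff M0.ne', mul_assoc, hr]
  refine ⟨g, cs_of s0, s0, fun j => cs_of (dj_supp s0 j), fun j => dj_supp s0 j, cs_of sl, sl, ?_, ?_, ?_⟩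
  · simp only [hg]
    rw [int_scale q _ hδ, ← hA0, hr]
  · intro j
    simp only [hgj]
    rw [int_scale (dj j q) _ hδ, norm_mul, nδ]
    have : ∫ w, ‖dj j q w‖ ^ 2 ≤ A1 := hA1 ▸
      Finset.single_le_sum (f := fun j => ∫ w, ‖dj j q w‖ ^ 2)
        (fun j _ => integral_nonneg fun w => by positivity) (Finset.mem_univ j)
    calc _ = (‖(r : ℂ)‖ ^ 2 * δ ^ n) * (∫ w, ‖dj j q w‖ ^ 2) / δ ^ 2 := by field_simp
      _ ≤ (‖(r : ℂ)‖ ^ 2 * δ ^ n) * (A1 + A2 + 1) / δ ^ 2 := by gcongr; linarith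
      _ = _ := by rw [hr']; ring
  · simp only [hgl]
    rw [int_scale (slap q) _ hδ, norm_mul, norm_mul, nδ]
    calc _ = (‖(r : ℂ)‖ ^ 2 * δ ^ n) * A2 / δ ^ 4 := by rw [hA2]; field_simp
      _ ≤ (‖(r : ℂ)‖ ^ 2 * δ ^ n) * (A1 + A2 + 1) / δ ^ 4 := by gcongr; linarith
      _ = _ := by rw [hr']; ring
end

section
open Filter MeasureTheory SchwartzMap LineDeriv FourierTransform

variable {n : ℕ}

structure LB (S : ℝ) (f : SRE n × SRE n → ℝ) (B : ℝ) : Prop where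
  int : IntegrableOn f (DD n S)
  le : ∫ p in DD n S, f p ≤ B

theorem LB.add {S : ℝ} {f g : SRE n × SRE n → ℝ} {A B : ℝ} (hf : LB S f A) (hg : LB S g B) :
    LB S (fun p => f p + g p) (A + B) :=
  ⟨hf.int.add hg.int, by rw [integral_add hf.int hg.int]; exact add_le_add hf.le hg.le⟩

theorem LB.mul {S : ℝ} {f : SRE n × SRE n → ℝ} {A : ℝ} (hf : LB S f A) {c : ℝ} (hc : 0 ≤ c) :
    LB S (fun p => c * f p) (c * A) :=
  ⟨hf.int.const_mul c, by rw [integral_const_mul]; exact mul_le_mul_of_nonneg_left hf.le hc⟩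

theorem LB.sum {S : ℝ} {f : Fin n → SRE n × SRE n → ℝ} {A : Fin n → ℝ} (hf : ∀ j, LB S (f j) (A j)) :
    LB S (fun p => ∑ j, f j p) (∑ j, A j) :=
  ⟨integrable_finsetSum _ fun j _ => (hf j).int, by
    rw [integral_finsetSum _ fun j _ => (hf j).int]; exact Finset.sum_le_sum fun j _ => (hf j).le⟩

theorem LB.mono {S : ℝ} {f g : SRE n × SRE n → ℝ} {A : ℝ} (hg : LB S g A) (hm : Continuous f)
    (h0 : ∀ p, 0 ≤ f p) (h : ∀ p, f p ≤ g p) : LB S f A := by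
  have : IntegrableOn f (DD n S) := hg.int.mono' hm.aestronglyMeasurable
    (Filter.Eventually.of_forall fun p => by rw [Real.norm_of_nonneg (h0 p)]; exact h p)
  exact ⟨this, (integral_mono this hg.int h).trans hg.le⟩

theorem LB.le' {S : ℝ} {f : SRE n × SRE n → ℝ} {A B : ℝ} (hf : LB S f A) (h : A ≤ B) : LB S f B :=
  ⟨hf.int, hf.le.trans h⟩

theorem nsq4 (a b c d : ℂ) : ‖a - b - c - d‖ ^ 2 ≤ 4 * (‖a‖ ^ 2 + ‖b‖ ^ 2 + ‖c‖ ^ 2 + ‖d‖ ^ 2) := by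
  have h : ‖a - b - c - d‖ ≤ ‖a‖ + ‖b‖ + ‖c‖ + ‖d‖ := by
    have h1 := norm_sub_le (a - b - c) d
    have h2 := norm_sub_le (a - b) c
    have h3 := norm_sub_le a b
    linarith
  have h2 := pow_le_pow_left₀ (norm_nonneg _) h 2
  nlinarith [sq_nonneg (‖a‖ - ‖b‖), sq_nonneg (‖a‖ - ‖c‖), sq_nonneg (‖a‖ - ‖d‖), sq_nonneg (‖b‖ - ‖c‖),
    sq_nonneg (‖b‖ - ‖d‖), sq_nonneg (‖c‖ - ‖d‖)]

theorem nsqs (a : Fin n → ℂ) : ‖∑ j, a j‖ ^ 2 ≤ n * ∑ j, ‖a j‖ ^ 2 := by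
  have h := pow_le_pow_left₀ (norm_nonneg _) (norm_sum_le Finset.univ a) 2
  have h2 := sq_sum_le_card_mul_sum_sq (s := Finset.univ) (f := fun j => ‖a j‖)
  simp only [Finset.card_univ, Fintype.card_fin] at h2
  exact h.trans h2

theorem ell_id {V : SRE n → ℝ} (h lam t : ℝ) (g u : 𝓢(SRE n, ℂ)) (p) :
    (((pE V (lsc (2 * Real.pi * h) p) - lam : ℝ) : ℂ) - t * Complex.I) * FW g u p =
      FW g (ff V h lam t u) p - 2 * (h : ℂ) ^ 2 * ∑ j, FW (dj j g) (dj j u) p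
        - (h : ℂ) ^ 2 * FW (slap g) u p - FR V (fun _ _ => 0) g u p := by
  have e1 : ∀ j, FW g (dj j (dj j u)) p = -((2 * Real.pi * p.2 j : ℝ) : ℂ) ^ 2 * FW g u p
      - 2 * FW (dj j g) (dj j u) p - FW (dj j (dj j g)) u p := fun j => by
    have h1 := FW_dj g (dj j u) p j
    have h2 := FW_dj g u p j
    have h3 := FW_dj (dj j g) u p j
    have : (2 * Real.pi * Complex.I) * (p.2 j) * FW (dj j g) u p
      = FW (dj j g) (dj j u) p + FW (dj j (dj j g)) u p := by rw [h3]; ring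
    rw [h1, h2, mul_sub, this]
    push_cast
    linear_combination (4 * (Real.pi : ℂ) ^ 2 * (p.2 j : ℂ) ^ 2 * FW g u p) * Complex.I_sq
  have e2 : FW (slap g) u p = ∑ j, FW (dj j (dj j g)) u p := by
    have : FWM u p (slap g) = ∑ j, FWM u p (dj j (dj j g)) := by unfold slap; rw [map_sum]
    exact this
  have e3 : pE V (lsc (2 * Real.pi * h) p) = h ^ 2 * ∑ j, (2 * Real.pi * p.2 j) ^ 2 + V p.1 := by
    unfold pE
    rw [lsc_apply]
    simp only [norm_smul, mul_pow, ← Finset.mul_sum, EuclideanSpace.norm_sq_eq, Real.norm_eq_abs, sq_abs]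
    ring
  rw [FW_ff, e2, e3]
  unfold FR
  simp only [e1, Finset.sum_sub_distrib, ← Finset.sum_mul, ← Finset.mul_sum, Complex.ofReal_zero, zero_mul,
    Finset.sum_const_zero, Finset.sum_neg_distrib]
  push_cast
  ring

theorem ell {V : SRE n → ℝ} {γ Cv : ℝ} (H : VB V γ Cv) {g : 𝓢(SRE n, ℂ)} {δ Cg : ℝ} (W : Win g δ Cg)
    (hδ1 : δ ≤ 1) (h lam t : ℝ) (u : 𝓢(SRE n, ℂ)) (S : ℝ) :
    LB S (fun p => |pE V (lsc (2 * Real.pi * h) p) - lam| ^ 2 * ‖FW g u p‖ ^ 2)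
      (4 * ((∫ y in Metric.closedBall (0 : SRE n) (S + 1), ‖ff V h lam t u y‖ ^ 2)
        + 4 * n * h ^ 2 * (Cg / δ ^ 2) * (∫ y in Metric.closedBall (0 : SRE n) (S + 1), h ^ 2 * Gf u y)
        + h ^ 4 * (Cg / δ ^ 4) * (∫ y in Metric.closedBall (0 : SRE n) (S + 1), ‖u y‖ ^ 2)
        + (Cv * δ) ^ 2 * (∫ y in Metric.closedBall (0 : SRE n) (S + 1), ‖u y‖ ^ 2))) := by
  have g1 : ∀ w, g w ≠ 0 → ‖w‖ ≤ 1 := fun w hw => (W.s0 w hw).trans hδ1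
  have b1 := fw_bd W.cs g1 (ff V h lam t u) S
  have b2 := fun j => fw_bd (W.cd j) (fun w hw => (W.sd j w hw).trans hδ1) (dj j u) S
  have b3 := fw_bd W.cl (fun w hw => (W.sl w hw).trans hδ1) u S
  have b4 := fr_bd (M := Cv * δ) H.temp (c := fun _ _ => 0) (fun _ => continuous_const) W.cs g1 u S
    (fun x w hw => by
      have := H.lipV (x + w) x
      simp only [zero_mul, Finset.sum_const_zero, sub_zero]
      refine this.trans ?_
      rw [add_sub_cancel_left]
      exact mul_le_mul_of_nonneg_left (W.s0 w hw) H.c0.le)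
  rw [integral_const_mul, W.i0, mul_one] at b4
  rw [W.i0, one_mul] at b1
  have hU : 0 ≤ ∫ y in Metric.closedBall (0 : SRE n) (S + 1), ‖u y‖ ^ 2 :=
    integral_nonneg fun y => by positivity
  have L1 : LB S _ _ := ⟨b1.1, b1.2⟩
  have L2 : ∀ j, LB S _ _ := fun j => ⟨(b2 j).1, (b2 j).2.trans
    (mul_le_mul_of_nonneg_right (W.i1 j) (integral_nonneg fun y => by positivity))⟩
  have L3 : LB S _ _ := ⟨b3.1, b3.2.trans (mul_le_mul_of_nonneg_right W.i2 hU)⟩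
  have L4 : LB S _ _ := ⟨b4.1, b4.2⟩
  have L := (((L1.add ((LB.sum L2).mul (c := 4 * h ^ 4 * n) (by positivity))).add
    (L3.mul (c := h ^ 4) (by positivity))).add L4).mul (c := 4) (by norm_num)
  refine LB.le' (LB.mono L ?_ (fun p => by positivity) fun p => ?_) (le_of_eq ?_)
  · have h1 := (FW_smooth W.cs u).continuous
    have h2 : Continuous fun p => pE V (lsc (2 * Real.pi * h) p) := by
      unfold pE
      have := H.diff.continuous
      have := (lsc (n := n) (2 * Real.pi * h)).continuous
      fun_prop
    exact ((h2.sub continuous_const).abs.pow 2).mul (h1.norm.pow 2)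
  · have e := congrArg (fun z : ℂ => ‖z‖ ^ 2) (ell_id (V := V) h lam t g u p)
    beta_reduce at e
    have k := nsq4 (FW g (ff V h lam t u) p) (2 * (h : ℂ) ^ 2 * ∑ j, FW (dj j g) (dj j u) p)
      ((h : ℂ) ^ 2 * FW (slap g) u p) (FR V (fun _ _ => 0) g u p)
    rw [← e] at k
    have k1 : |pE V (lsc (2 * Real.pi * h) p) - lam| ^ 2 * ‖FW g u p‖ ^ 2 ≤
        ‖(((pE V (lsc (2 * Real.pi * h) p) - lam : ℝ) : ℂ) - t * Complex.I) * FW g u p‖ ^ 2 := by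
      rw [norm_mul, mul_pow]
      gcongr
      have := Complex.abs_re_le_norm (((pE V (lsc (2 * Real.pi * h) p) - lam : ℝ) : ℂ) - t * Complex.I)
      simpa using this
    refine k1.trans (k.trans ?_)
    have k2 : ‖2 * (h : ℂ) ^ 2 * ∑ j, FW (dj j g) (dj j u) p‖ ^ 2
        ≤ 4 * h ^ 4 * n * ∑ j, ‖FW (dj j g) (dj j u) p‖ ^ 2 := by
      rw [norm_mul, mul_pow]
      have := nsqs fun j => FW (dj j g) (dj j u) p
      calc _ = 4 * h ^ 4 * ‖∑ j, FW (dj j g) (dj j u) p‖ ^ 2 := by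
            congr 1
            simp only [norm_mul, norm_pow, Complex.norm_real, Real.norm_eq_abs, sq_abs]
            norm_num
            ring
        _ ≤ 4 * h ^ 4 * (n * ∑ j, ‖FW (dj j g) (dj j u) p‖ ^ 2) := by gcongr
        _ = _ := by ring
    have k3 : ‖(h : ℂ) ^ 2 * FW (slap g) u p‖ ^ 2 = h ^ 4 * ‖FW (slap g) u p‖ ^ 2 := by
      simp only [norm_mul, norm_pow, Complex.norm_real, Real.norm_eq_abs, sq_abs]
      ring
    linarith
  · have : ∫ y in Metric.closedBall (0 : SRE n) (S + 1), h ^ 2 * Gf u y =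
        h ^ 2 * ∑ j, ∫ y in Metric.closedBall (0 : SRE n) (S + 1), ‖dj j u y‖ ^ 2 := by
      rw [integral_const_mul]
      unfold Gf
      rw [integral_finsetSum _ fun j _ => (sr_isq (dj j u)).integrableOn]
    rw [this, ← Finset.mul_sum]
    ring

end

section
open Filter MeasureTheory SchwartzMap LineDeriv FourierTransform

variable {n : ℕ}

theorem nj_lip (x y : SRE n) (j : Fin n) :
    |Aw y ^ (-(1/2) : ℝ) * y j - Aw x ^ (-(1/2) : ℝ) * x j| ≤ 2 * ‖y - x‖ := by
  have e : ∀ z : SRE n, Aw z ^ (-(1/2) : ℝ) = (√(Aw z))⁻¹ := fun z => by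
    rw [Real.rpow_neg (Aw_pos z).le, Real.sqrt_eq_rpow]
  have s1 : ∀ z : SRE n, 1 ≤ √(Aw z) := fun z => Real.one_le_sqrt.2 (Aw_one_le z)
  have sn : ∀ z : SRE n, ‖z‖ ≤ √(Aw z) := fun z => by
    apply Real.le_sqrt_of_sq_le; unfold Aw; linarith
  have sj : ∀ z : SRE n, |z j| ≤ ‖z‖ := fun z => by
    have := EuclideanSpace.norm_sq_eq z
    have h2 : ‖z j‖ ^ 2 ≤ ‖z‖ ^ 2 := by
      rw [this]; exact Finset.single_le_sum (f := fun i => ‖z i‖ ^ 2) (fun i _ => by positivity) (Finset.mem_univ j)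
    exact abs_le_of_sq_le_sq (by simpa using h2) (norm_nonneg _)
  have ss : ∀ z : SRE n, √(Aw z) ^ 2 = 1 + ‖z‖ ^ 2 := fun z => Real.sq_sqrt (Aw_pos z).le
  rw [e, e]
  have hx := s1 x
  have hy := s1 y
  have nx := sn x
  have ny := sn y
  have qx := ss x
  have qy := ss y
  obtain ⟨a, ha⟩ : ∃ a, a = √(Aw x) := ⟨_, rfl⟩
  obtain ⟨b, hb⟩ : ∃ a, a = √(Aw y) := ⟨_, rfl⟩
  rw [← ha] at hx nx qx ⊢
  rw [← hb] at hy ny qy ⊢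
  have d1 : |a - b| ≤ ‖y - x‖ := by
    have h1 : (a - b) * (a + b) = (‖x‖ - ‖y‖) * (‖x‖ + ‖y‖) := by linear_combination qx - qy
    have h2 : |a - b| * (a + b) ≤ ‖y - x‖ * (a + b) := by
      have : |a - b| * (a + b) = |‖x‖ - ‖y‖| * (‖x‖ + ‖y‖) := by
        rw [← abs_of_nonneg (show 0 ≤ a + b by linarith), ← abs_mul, h1, abs_mul,
          abs_of_nonneg (show 0 ≤ ‖x‖ + ‖y‖ by positivity)]
      rw [this]
      have := abs_norm_sub_norm_le x y
      rw [norm_sub_rev] at this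
      gcongr
    exact le_of_mul_le_mul_right h2 (by linarith)
  have e2 : b⁻¹ * y j - a⁻¹ * x j = b⁻¹ * (y - x) j + (a⁻¹ * x j) * (b⁻¹ * (a - b)) := by
    have : a ≠ 0 := by linarith
    have : b ≠ 0 := by linarith
    simp only [PiLp.sub_apply]
    field_simp
    ring
  rw [e2]
  have b1 : b⁻¹ ≤ 1 := inv_le_one_of_one_le₀ hy
  have b0 : 0 ≤ b⁻¹ := by positivity
  have a0 : 0 < a := by linarith
  have k1 : |b⁻¹ * (y - x) j| ≤ ‖y - x‖ := by
    rw [abs_mul, abs_of_nonneg b0]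
    calc _ ≤ 1 * ‖y - x‖ := by gcongr; exact sj _
      _ = _ := one_mul _
  have k2 : |(a⁻¹ * x j) * (b⁻¹ * (a - b))| ≤ ‖y - x‖ := by
    have : |a⁻¹ * x j| ≤ 1 := by
      rw [abs_mul, abs_of_nonneg (by positivity), inv_mul_le_iff₀ a0, mul_one]
      exact (sj x).trans nx
    rw [abs_mul, abs_mul (b⁻¹), abs_of_nonneg b0]
    calc _ ≤ 1 * (1 * ‖y - x‖) := by gcongr
      _ = _ := by ring
  have := abs_add_le (b⁻¹ * (y - x) j) ((a⁻¹ * x j) * (b⁻¹ * (a - b)))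
  linarith

theorem nsq3 (a b c : ℂ) : ‖a + b + c‖ ^ 2 ≤ 3 * (‖a‖ ^ 2 + ‖b‖ ^ 2 + ‖c‖ ^ 2) := by
  have h2 := pow_le_pow_left₀ (norm_nonneg _) (norm_add₃_le (a := a) (b := b) (c := c)) 2
  nlinarith [sq_nonneg (‖a‖ - ‖b‖), sq_nonneg (‖a‖ - ‖c‖), sq_nonneg (‖b‖ - ‖c‖)]

noncomputable def njf (j : Fin n) (z : SRE n) : ℝ := Aw z ^ (-(1/2) : ℝ) * z j

noncomputable def qj (h lam : ℝ) (u : 𝓢(SRE n, ℂ)) (j : Fin n) : 𝓢(SRE n, ℂ) :=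
  (h : ℂ) • dj j u - ((√lam : ℂ) * Complex.I) • smulLeftCLM ℂ (njf j) u

theorem qj_Q (h lam : ℝ) (u : 𝓢(SRE n, ℂ)) (z) : Qf h lam u z = ∑ j, ‖qj h lam u j z‖ ^ 2 := by
  unfold Qf
  refine Finset.sum_congr rfl fun j _ => ?_
  unfold qj
  rw [sub_apply, smul_apply, smul_apply, smulLeftCLM_apply_apply (show (njf j).HasTemperateGrowth from Awz_temp _ j)]
  congr 2
  simp only [Complex.real_smul, smul_eq_mul, njf]
  push_cast
  ring

theorem q_id (h lam : ℝ) (g u : 𝓢(SRE n, ℂ)) (p) (j : Fin n) :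
    Complex.I * (((2 * Real.pi * h) * p.2 j - √lam * njf j p.1 : ℝ) : ℂ) * FW g u p =
      FW g (qj h lam u j) p + (h : ℂ) * FW (dj j g) u p
        + (√lam : ℂ) * Complex.I * FR (njf j) (fun _ _ => 0) g u p := by
  have e1 : FW g (qj h lam u j) p = (h : ℂ) * FW g (dj j u) p
      - ((√lam : ℂ) * Complex.I) * FW g (smulLeftCLM ℂ (njf j) u) p := by
    have : FWL g p (qj h lam u j) = (h : ℂ) * FWL g p (dj j u)
      - ((√lam : ℂ) * Complex.I) * FWL g p (smulLeftCLM ℂ (njf j) u) := by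
      unfold qj; rw [map_sub, map_smul, map_smul]; rfl
    exact this
  rw [e1, FW_dj]
  unfold FR
  simp only [Complex.ofReal_zero, zero_mul, Finset.sum_const_zero]
  push_cast
  ring

theorem outg {g : 𝓢(SRE n, ℂ)} {δ Cg : ℝ} (W : Win g δ Cg)
    (hδ1 : δ ≤ 1) (h : ℝ) {lam : ℝ} (hl : 0 ≤ lam) (u : 𝓢(SRE n, ℂ)) (S : ℝ) :
    LB S (fun p => Aw p.1 ^ (-(1/2) : ℝ) *
        ‖(lsc (2 * Real.pi * h) p).2 - (√lam * Aw p.1 ^ (-(1/2) : ℝ)) • p.1‖ ^ 2 * ‖FW g u p‖ ^ 2)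
      (3 * (2 * (∫ y in Metric.closedBall (0 : SRE n) (S + 1), Aw y ^ (-(1/2) : ℝ) * Qf h lam u y)
        + n * h ^ 2 * (Cg / δ ^ 2) * (∫ y in Metric.closedBall (0 : SRE n) (S + 1), ‖u y‖ ^ 2)
        + n * lam * (2 * δ) ^ 2 * (∫ y in Metric.closedBall (0 : SRE n) (S + 1), ‖u y‖ ^ 2))) := by
  have g1 : ∀ w, g w ≠ 0 → ‖w‖ ≤ 1 := fun w hw => (W.s0 w hw).trans hδ1
  have hU : 0 ≤ ∫ y in Metric.closedBall (0 : SRE n) (S + 1), ‖u y‖ ^ 2 :=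
    integral_nonneg fun y => by positivity
  have b1 := fun j => fw_bdA W.cs g1 (qj h lam u j) S
  have b2 := fun j => fw_bd (W.cd j) (fun w hw => (W.sd j w hw).trans hδ1) u S
  have b4 := fun j => fr_bd (M := 2 * δ) (v := njf j) (Awz_temp _ j) (c := fun _ _ => 0)
    (fun _ => continuous_const) W.cs g1 u S
    (fun x w hw => by
      have := nj_lip x (x + w) j
      simp only [zero_mul, Finset.sum_const_zero, sub_zero]
      refine this.trans ?_
      rw [add_sub_cancel_left]
      exact mul_le_mul_of_nonneg_left (W.s0 w hw) (by norm_num))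
  simp only [integral_const_mul, W.i0, mul_one] at b4 b1
  have L1 : ∀ j, LB S _ _ := fun j => ⟨(b1 j).1, (b1 j).2⟩
  have L2 : ∀ j, LB S _ _ := fun j => ⟨(b2 j).1, (b2 j).2.trans (mul_le_mul_of_nonneg_right (W.i1 j) hU)⟩
  have L3 : ∀ j, LB S _ _ := fun j => ⟨(b4 j).1, (b4 j).2⟩
  have L := LB.sum fun j => (((L1 j).add ((L2 j).mul (c := h ^ 2) (by positivity))).add
    ((L3 j).mul (c := lam) hl)).mul (c := 3) (by norm_num)
  refine LB.le' (LB.mono L ?_ (fun p => ?_) fun p => ?_) (le_of_eq ?_)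
  · have h1 := (FW_smooth W.cs u).continuous
    have h2 := (lsc (n := n) (2 * Real.pi * h)).continuous
    have h3 : Continuous fun p : SRE n × SRE n => Aw p.1 ^ (-(1/2) : ℝ) :=
      (Aw_temp (n := n) (-(1/2) : ℝ)).1.continuous.comp continuous_fst
    fun_prop
  · have := Aw_pos p.1; positivity
  · have hA := Aw_pos p.1
    have hA1 : Aw p.1 ^ (-(1/2) : ℝ) ≤ 1 := Real.rpow_le_one_of_one_le_of_nonpos (Aw_one_le _) (by norm_num)
    have hA0 : 0 ≤ Aw p.1 ^ (-(1/2) : ℝ) := by positivity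
    rw [EuclideanSpace.norm_sq_eq, Finset.mul_sum, Finset.sum_mul]
    refine Finset.sum_le_sum fun j _ => ?_
    have e := congrArg (fun z : ℂ => ‖z‖ ^ 2) (q_id h lam g u p j)
    beta_reduce at e
    have k := nsq3 (FW g (qj h lam u j) p) ((h : ℂ) * FW (dj j g) u p)
      ((√lam : ℂ) * Complex.I * FR (njf j) (fun _ _ => 0) g u p)
    rw [← e] at k
    have e1 : ‖((lsc (2 * Real.pi * h) p).2 - (√lam * Aw p.1 ^ (-(1/2) : ℝ)) • p.1) j‖ ^ 2 * ‖FW g u p‖ ^ 2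
       = ‖Complex.I * (((2 * Real.pi * h) * p.2 j - √lam * njf j p.1 : ℝ) : ℂ) * FW g u p‖ ^ 2 := by
      rw [norm_mul, norm_mul, Complex.norm_I, one_mul, Complex.norm_real, mul_pow, lsc_apply]
      congr 2
      simp [njf, mul_assoc]
    have e2 : ‖(h : ℂ) * FW (dj j g) u p‖ ^ 2 = h ^ 2 * ‖FW (dj j g) u p‖ ^ 2 := by
      rw [norm_mul, mul_pow, Complex.norm_real, Real.norm_eq_abs, sq_abs]
    have e3 : ‖(√lam : ℂ) * Complex.I * FR (njf j) (fun _ _ => 0) g u p‖ ^ 2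
        = lam * ‖FR (njf j) (fun _ _ => 0) g u p‖ ^ 2 := by
      rw [norm_mul, norm_mul, Complex.norm_I, mul_one, mul_pow, Complex.norm_real, Real.norm_eq_abs, sq_abs,
        Real.sq_sqrt hl]
    rw [e2, e3] at k
    rw [mul_assoc, e1]
    have k2 := mul_le_mul_of_nonneg_left k hA0
    refine k2.trans ?_
    have m1 := mul_le_of_le_one_left (show 0 ≤ h ^ 2 * ‖FW (dj j g) u p‖ ^ 2 by positivity) hA1
    have m2 := mul_le_of_le_one_left (show 0 ≤ lam * ‖FR (njf j) (fun _ _ => 0) g u p‖ ^ 2 by positivity) hA1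
    linarith
  · have i1 : ∀ j, IntegrableOn (fun y => Aw y ^ (-(1/2) : ℝ) * ‖qj h lam u j y‖ ^ 2)
        (Metric.closedBall (0 : SRE n) (S + 1)) := fun j =>
      (((Aw_temp (n := n) (-(1/2) : ℝ)).1.continuous.mul
        ((qj h lam u j).continuous.norm.pow 2)).continuousOn).integrableOn_compact (isCompact_closedBall _ _)
    have : ∫ y in Metric.closedBall (0 : SRE n) (S + 1), Aw y ^ (-(1/2) : ℝ) * Qf h lam u y =
        ∑ j, ∫ y in Metric.closedBall (0 : SRE n) (S + 1), Aw y ^ (-(1/2) : ℝ) * ‖qj h lam u j y‖ ^ 2 := by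
      simp only [qj_Q, Finset.mul_sum]
      rw [integral_finsetSum _ fun j _ => i1 j]
    rw [this]
    simp only [← Finset.mul_sum, Finset.sum_add_distrib, Finset.sum_const, Finset.card_univ,
      Fintype.card_fin, nsmul_eq_mul]
    ring

theorem m_bd {x ξ : SRE n} (hx : 1 ≤ ‖x‖) (hi : inner ℝ x ξ < 0) {a lam : ℝ} (ha : 0 < a) (hl : a ≤ lam) :
    (1 + ‖x‖)⁻¹ ≤ 2 / a * (Aw x ^ (-(1/2) : ℝ) * ‖ξ - (√lam * Aw x ^ (-(1/2) : ℝ)) • x‖ ^ 2) := by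
  have hA := Aw_pos x
  have h1 : (1 + ‖x‖)⁻¹ ≤ Aw x ^ (-(1/2) : ℝ) := by
    rw [Real.rpow_neg hA.le]
    exact inv_anti₀ (by positivity) (VB.Aw_le x)
  have h2 : a / 2 ≤ ‖ξ - (√lam * Aw x ^ (-(1/2) : ℝ)) • x‖ ^ 2 := by
    obtain ⟨c, hc⟩ : ∃ c, c = √lam * Aw x ^ (-(1/2) : ℝ) := ⟨_, rfl⟩
    have c0 : 0 ≤ c := by rw [hc]; positivity
    have c2 : c ^ 2 * Aw x = lam := by
      rw [hc, mul_pow, Real.sq_sqrt (by linarith), ← Real.rpow_natCast, ← Real.rpow_mul hA.le, mul_assoc]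
      norm_num
      rw [Real.rpow_neg_one, inv_mul_cancel₀ hA.ne', mul_one]
    rw [← hc, norm_sub_sq_real, inner_smul_right, norm_smul, Real.norm_of_nonneg c0, mul_pow,
      real_inner_comm]
    have h3 : c * inner ℝ x ξ ≤ 0 := mul_nonpos_of_nonneg_of_nonpos c0 hi.le
    have h4 : lam ≤ 2 * (c ^ 2 * ‖x‖ ^ 2) := by
      rw [← c2]; unfold Aw
      have : 1 ≤ ‖x‖ ^ 2 := one_le_pow₀ hx
      nlinarith [sq_nonneg c]
    nlinarith [sq_nonneg ‖ξ‖]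
  have h3 : 0 ≤ Aw x ^ (-(1/2) : ℝ) := by positivity
  calc _ ≤ Aw x ^ (-(1/2) : ℝ) := h1
    _ = 2 / a * (Aw x ^ (-(1/2) : ℝ) * (a / 2)) := by field_simp
    _ ≤ _ := by gcongr

theorem low {g : 𝓢(SRE n, ℂ)} {δ Cg : ℝ} (W : Win g δ Cg) (hδ1 : δ ≤ 1) (u : 𝓢(SRE n, ℂ)) (R : ℝ) :
    ∫ y in Metric.closedBall (0 : SRE n) R, ‖u y‖ ^ 2 ≤ ∫ p in DD n (R + 1), ‖FW g u p‖ ^ 2 := by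
  have g1 : ∀ w, g w ≠ 0 → ‖w‖ ≤ 1 := fun w hw => (W.s0 w hw).trans hδ1
  have hi := (fw_bd W.cs g1 u (R + 1)).1
  have e := qg_eq (FW_smooth W.cs u).continuous (φ := wq g u) (fun p => rfl) (R + 1)
  rw [← ofReal_integral_eq_lintegral_ofReal hi (ae_of_all _ fun p => by positivity)] at e
  have key : ENNReal.ofReal (∫ y in Metric.closedBall (0 : SRE n) R, ‖u y‖ ^ 2) ≤
      ∫⁻ x in Metric.closedBall (0 : SRE n) (R + 1), ∫⁻ w, ENNReal.ofReal (‖wq g u x w‖ ^ 2) := by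
    have e1 : ∀ x w, ENNReal.ofReal (‖wq g u x w‖ ^ 2) =
        ENNReal.ofReal (‖g w‖ ^ 2) * ENNReal.ofReal (‖u (x + w)‖ ^ 2) := fun x w => by
      rw [wq_apply, norm_mul, mul_pow, ENNReal.ofReal_mul (by positivity)]
    simp only [e1]
    have mg : Measurable fun w => ENNReal.ofReal (‖g w‖ ^ 2) := by
      have := g.continuous.measurable; fun_prop
    have mu : Measurable fun w => ENNReal.ofReal (‖u w‖ ^ 2) := by
      have := u.continuous.measurable; fun_prop
    rw [lintegral_lintegral_swap (by
      apply Measurable.aemeasurable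
      unfold Function.uncurry
      exact (mg.comp measurable_snd).mul (mu.comp (measurable_fst.add measurable_snd)))]
    rw [ofReal_integral_eq_lintegral_ofReal (sr_isq u).integrableOn (ae_of_all _ fun p => by positivity)]
    have i0 : ∫⁻ w, ENNReal.ofReal (‖g w‖ ^ 2) = 1 := by
      rw [← ofReal_integral_eq_lintegral_ofReal (sr_isq g) (ae_of_all _ fun p => by positivity), W.i0,
        ENNReal.ofReal_one]
    calc ∫⁻ y in Metric.closedBall (0 : SRE n) R, ENNReal.ofReal (‖u y‖ ^ 2)
        = ∫⁻ w, ENNReal.ofReal (‖g w‖ ^ 2) *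
          ∫⁻ y in Metric.closedBall (0 : SRE n) R, ENNReal.ofReal (‖u y‖ ^ 2) := by
          rw [lintegral_mul_const _ mg, i0, one_mul]
      _ ≤ _ := by
          refine lintegral_mono fun w => ?_
          beta_reduce
          have mw : Measurable fun x => ENNReal.ofReal (‖u (x + w)‖ ^ 2) := mu.comp (measurable_id.add_const w)
          rw [lintegral_const_mul _ mw]
          by_cases hw : g w = 0
          · simp [hw]
          refine mul_le_mul' le_rfl ?_
          rw [← lintegral_indicator measurableSet_closedBall, ← lintegral_indicator measurableSet_closedBall,
            ← lintegral_add_right_eq_self _ w]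
          refine lintegral_mono fun x => ?_
          beta_reduce
          by_cases hx : x + w ∈ Metric.closedBall (0 : SRE n) R
          · have hx2 : x ∈ Metric.closedBall (0 : SRE n) (R + 1) := by
              simp only [mem_closedBall_zero_iff] at hx ⊢
              have : ‖x‖ ≤ ‖x + w‖ + ‖w‖ := by simpa using norm_sub_le (x + w) w
              linarith [g1 w hw]
            rw [Set.indicator_of_mem hx, Set.indicator_of_mem hx2]
          · rw [Set.indicator_of_notMem hx]; exact zero_le
  rw [← e] at key
  exact (ENNReal.ofReal_le_ofReal_iff (integral_nonneg fun p => by positivity)).1 key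

end

section
open Filter MeasureTheory SchwartzMap LineDeriv FourierTransform

variable {n : ℕ}

theorem cV_sum (V : SRE n → ℝ) (x w : SRE n) : ∑ j, cV V j x * w j = fderiv ℝ V x w := by
  have e : w = ∑ j, w j • ebv j := by
    ext i
    simp [ebv, Pi.single_apply]
  conv_rhs => rw [e]
  rw [map_sum]
  refine Finset.sum_congr rfl fun j _ => ?_
  rw [map_smul, smul_eq_mul, mul_comm]; rfl

theorem sr_am {a b s : ℝ} (hs : 0 < s) : 2 * (a * b) ≤ s * a ^ 2 + s⁻¹ * b ^ 2 := by
  have : 0 ≤ s⁻¹ * (s * a - b) ^ 2 := by positivity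
  have e : s⁻¹ * (s * a - b) ^ 2 = s * a ^ 2 + s⁻¹ * b ^ 2 - 2 * (a * b) := by
    field_simp; ring
  linarith

theorem tr_est {V : SRE n → ℝ} {γ Cv : ℝ} (H : VB V γ Cv) {g : 𝓢(SRE n, ℂ)} {δ Cg : ℝ} (W : Win g δ Cg)
    (hδ0 : 0 < δ) (hδ1 : δ ≤ 1) {h t a lam θ : ℝ} (hh : 0 < h) (ht : 0 < t) (ha : 0 < a) (hal : a ≤ lam)
    (hθ : 0 < θ) (u : 𝓢(SRE n, ℂ)) {b m a0 : SRE n × SRE n → ℝ} {K : NNReal} {S M c Cm : ℝ}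
    (hb : LipschitzWith K b) (hs : HasCompactSupport b) (hb0 : ∀ y, 0 ≤ b y)
    (hbS : ∀ y, b y ≠ 0 → ‖y.1‖ ≤ S) (hbM : ∀ y, b y ≤ M) (hM : 0 ≤ M)
    (hm : Continuous m) (hm0 : ∀ y, 0 ≤ m y) (hCm : 0 < Cm) (hmC : ∀ y, m y ≤ Cm * (1 + ‖y.1‖)⁻¹)
    (hms : ∀ y, m y ≠ 0 → 1 ≤ ‖y.1‖ ∧ ‖y.1‖ ≤ S ∧ inner ℝ y.1 y.2 < 0)
    (hac : Continuous a0) (ha0 : ∀ y, 0 ≤ a0 y) (ha1 : ∀ y, a0 y ≤ 1) (has : ∀ y, a0 y ≠ 0 → ‖y.1‖ ≤ S)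
    (hfd : ∀ y, DifferentiableAt ℝ b y → fderiv ℝ b y (XV V y) = m y - c * a0 y) :
    IntegrableOn (fun p => a0 (lsc (2 * Real.pi * h) p) * ‖FW g u p‖ ^ 2) (DD n S) ∧
    c * ∫ p in DD n S, a0 (lsc (2 * Real.pi * h) p) * ‖FW g u p‖ ^ 2 ≤
      (2 * Cm / a) * (3 * (2 * (∫ y in Metric.closedBall (0 : SRE n) (S + 1), Aw y ^ (-(1/2) : ℝ) * Qf h lam u y)
        + n * h ^ 2 * (Cg / δ ^ 2) * (∫ y in Metric.closedBall (0 : SRE n) (S + 1), ‖u y‖ ^ 2)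
        + n * lam * (2 * δ) ^ 2 * (∫ y in Metric.closedBall (0 : SRE n) (S + 1), ‖u y‖ ^ 2)))
      + M * (θ * (∫ y in Metric.closedBall (0 : SRE n) (S + 1), ‖u y‖ ^ 2)
        + (θ * h ^ 2)⁻¹ * ∫ y in Metric.closedBall (0 : SRE n) (S + 1), ‖ff V h lam t u y‖ ^ 2)
      + (M / h * (δ ^ 2 * (∫ y in Metric.closedBall (0 : SRE n) (S + 1), ‖u y‖ ^ 2)
        + (δ ^ 2)⁻¹ * ((Cv * δ ^ 2) ^ 2 * ∫ y in Metric.closedBall (0 : SRE n) (S + 1), ‖u y‖ ^ 2))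
      + ∑ _j : Fin n, h * K * (δ⁻¹ * (∫ y in Metric.closedBall (0 : SRE n) (S + 1), ‖u y‖ ^ 2)
        + δ * (Cg / δ ^ 2 * ∫ y in Metric.closedBall (0 : SRE n) (S + 1), ‖u y‖ ^ 2))) := by
  have g1 : ∀ w, g w ≠ 0 → ‖w‖ ≤ 1 := fun w hw => (W.s0 w hw).trans hδ1
  have hU : 0 ≤ ∫ y in Metric.closedBall (0 : SRE n) (S + 1), ‖u y‖ ^ 2 :=
    integral_nonneg fun y => by positivity
  have cF := (FW_smooth W.cs u).continuous
  have cl := (lsc (n := n) (2 * Real.pi * h)).continuous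
  have b0 := fw_bd W.cs g1 u S
  rw [W.i0, one_mul] at b0
  have b1 := fw_bd W.cs g1 (ff V h lam t u) S
  rw [W.i0, one_mul] at b1
  have b2 := fun j => fw_bd (W.cd j) (fun w hw => (W.sd j w hw).trans hδ1) u S
  have b4 := fr_bd (M := Cv * δ ^ 2) H.temp (c := cV V) (fun j => (cV_cd H.cd j).continuous) W.cs g1 u S
    (fun x w hw => by
      rw [cV_sum]
      refine (H.taylor x w).trans ?_
      have := W.s0 w hw
      have := H.c0
      gcongr)
  rw [integral_const_mul, W.i0, mul_one] at b4
  have L0 : LB S (fun p => ‖FW g u p‖ ^ 2) _ := ⟨b0.1, b0.2⟩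
  have L1 : LB S (fun p => ‖FW g (ff V h lam t u) p‖ ^ 2) _ := ⟨b1.1, b1.2⟩
  have L2 : ∀ j, LB S (fun p => ‖FW (dj j g) u p‖ ^ 2) _ := fun j => ⟨(b2 j).1, (b2 j).2.trans (mul_le_mul_of_nonneg_right (W.i1 j) hU)⟩
  have L4 : LB S (fun p => ‖FR V (cV V) g u p‖ ^ 2) _ := ⟨b4.1, b4.2⟩
  have Lm : LB S (fun p => m (lsc (2 * Real.pi * h) p) * ‖FW g u p‖ ^ 2) _ :=
    LB.mono ((outg W hδ1 h (ha.le.trans hal) u S).mul (c := 2 * Cm / a) (by positivity))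
      ((hm.comp cl).mul (cF.norm.pow 2)) (fun p => mul_nonneg (hm0 _) (by positivity)) fun p => by
      by_cases hp : m (lsc (2 * Real.pi * h) p) = 0
      · rw [hp, zero_mul]; have := Aw_pos p.1; positivity
      · obtain ⟨h1, -, h3⟩ := hms _ hp
        have k1 := hmC (lsc (2 * Real.pi * h) p)
        have k2 := m_bd (lam := lam) h1 h3 ha hal
        have e1 : (lsc (2 * Real.pi * h) p).1 = p.1 := by rw [lsc_apply]
        rw [e1] at k1 k2
        have k3 := k1.trans (mul_le_mul_of_nonneg_left k2 hCm.le)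
        have k4 := mul_le_mul_of_nonneg_right k3 (sq_nonneg ‖FW g u p‖)
        refine k4.trans (le_of_eq ?_)
        ring
  have p1 : 0 ≤ (θ * h ^ 2)⁻¹ := by positivity
  have p2 : 0 ≤ δ ^ 2 := by positivity
  have p3 : 0 ≤ (δ ^ 2)⁻¹ := by positivity
  have p4 : 0 ≤ M / h := by positivity
  have p5 : 0 ≤ δ⁻¹ := by positivity
  have p6 : 0 ≤ h * K := by positivity
  have LG : LB S (fun p => m (lsc (2 * Real.pi * h) p) * ‖FW g u p‖ ^ 2 + M * (θ * ‖FW g u p‖ ^ 2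
    + (θ * h ^ 2)⁻¹ * ‖FW g (ff V h lam t u) p‖ ^ 2) + (M / h * (δ ^ 2 * ‖FW g u p‖ ^ 2
    + (δ ^ 2)⁻¹ * ‖FR V (cV V) g u p‖ ^ 2) + ∑ j, h * K * (δ⁻¹ * ‖FW g u p‖ ^ 2
    + δ * ‖FW (dj j g) u p‖ ^ 2))) _ := (Lm.add (((L0.mul hθ.le).add (L1.mul p1)).mul hM)).add
    ((((L0.mul p2).add (L4.mul p3)).mul p4).add
    (LB.sum fun j => ((L0.mul p5).add ((L2 j).mul hδ0.le)).mul p6))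
  have ia : IntegrableOn (fun p => a0 (lsc (2 * Real.pi * h) p) * ‖FW g u p‖ ^ 2) (DD n S) :=
    (LB.mono L0 ((hac.comp cl).mul (cF.norm.pow 2)) (fun p => mul_nonneg (ha0 _) (sq_nonneg _))
      fun p => mul_le_of_le_one_left (sq_nonneg _) (ha1 _)).int
  refine ⟨ia, ?_⟩
  generalize hG : (fun p => m (lsc (2 * Real.pi * h) p) * ‖FW g u p‖ ^ 2 + M * (θ * ‖FW g u p‖ ^ 2
    + (θ * h ^ 2)⁻¹ * ‖FW g (ff V h lam t u) p‖ ^ 2) + (M / h * (δ ^ 2 * ‖FW g u p‖ ^ 2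
    + (δ ^ 2)⁻¹ * ‖FR V (cV V) g u p‖ ^ 2) + ∑ j, h * K * (δ⁻¹ * ‖FW g u p‖ ^ 2
    + δ * ‖FW (dj j g) u p‖ ^ 2))) = G at LG
  refine le_trans ?_ LG.le
  have iG := LG.int
  clear LG
  obtain ⟨T, iT, hT0, hT⟩ := transport (lam := lam) H.cd H.temp VB.inner_grad hh ht W.cs u hb hs hb0 hbS hbM
  have iI := ((iG.sub (ia.const_mul c)).const_mul (h / 2))
  have key : ∫ p, T p ≤ ∫ p in DD n S, h / 2 * (G p - c * (a0 (lsc (2 * Real.pi * h) p) * ‖FW g u p‖ ^ 2)) := by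
    rw [← integral_indicator (DD_meas S)]
    refine integral_mono_ae iT ((integrable_indicator_iff (DD_meas S)).2 iI) ?_
    filter_upwards [hT] with p hp
    obtain ⟨hd, hp⟩ := hp
    refine hp.trans ?_
    rw [hfd _ hd]
    by_cases hD : p ∈ DD n S
    · rw [Set.indicator_of_mem hD, Set.indicator_of_mem hD, ← hG]
      beta_reduce
      have q1 := sr_am (a := ‖FW g u p‖) (b := ‖FW g (ff V h lam t u) p‖) (s := θ * h) (by positivity)
      have q2 := sr_am (a := ‖FW g u p‖) (b := ‖FR V (cV V) g u p‖) (s := δ ^ 2) (by positivity)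
      have q3 : ∀ j, 2 * (‖FW g u p‖ * ‖FW (dj j g) u p‖) ≤ δ⁻¹ * ‖FW g u p‖ ^ 2 + δ * ‖FW (dj j g) u p‖ ^ 2 :=
        fun j => by simpa using sr_am (a := ‖FW g u p‖) (b := ‖FW (dj j g) u p‖) (s := δ⁻¹) (by positivity)
      have r1 : M * (‖FW g u p‖ * ‖FW g (ff V h lam t u) p‖) ≤ h / 2 * (M * (θ * ‖FW g u p‖ ^ 2
          + (θ * h ^ 2)⁻¹ * ‖FW g (ff V h lam t u) p‖ ^ 2)) := by
        have := mul_le_mul_of_nonneg_left q1 (show 0 ≤ M / 2 by positivity)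
        calc _ = M / 2 * (2 * (‖FW g u p‖ * ‖FW g (ff V h lam t u) p‖)) := by ring
          _ ≤ _ := this
          _ = _ := by field_simp
      have r2 : M * (‖FW g u p‖ * ‖FR V (cV V) g u p‖) ≤ h / 2 * (M / h * (δ ^ 2 * ‖FW g u p‖ ^ 2
          + (δ ^ 2)⁻¹ * ‖FR V (cV V) g u p‖ ^ 2)) := by
        have := mul_le_mul_of_nonneg_left q2 (show 0 ≤ M / 2 by positivity)
        calc _ = M / 2 * (2 * (‖FW g u p‖ * ‖FR V (cV V) g u p‖)) := by ring
          _ ≤ _ := this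
          _ = _ := by field_simp
      have r3 : h ^ 2 * K * ∑ j, ‖FW g u p‖ * ‖FW (dj j g) u p‖ ≤ h / 2 * ∑ j, h * K * (δ⁻¹ * ‖FW g u p‖ ^ 2
          + δ * ‖FW (dj j g) u p‖ ^ 2) := by
        rw [Finset.mul_sum, Finset.mul_sum]
        refine Finset.sum_le_sum fun j _ => ?_
        have := mul_le_mul_of_nonneg_left (q3 j) (show 0 ≤ h ^ 2 * K / 2 by positivity)
        calc _ = h ^ 2 * K / 2 * (2 * (‖FW g u p‖ * ‖FW (dj j g) u p‖)) := by ring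
          _ ≤ _ := this
          _ = _ := by ring
      calc _ ≤ h / 2 * (m (lsc (2 * Real.pi * h) p) - c * a0 (lsc (2 * Real.pi * h) p)) * ‖FW g u p‖ ^ 2
            + (h / 2 * (M * (θ * ‖FW g u p‖ ^ 2 + (θ * h ^ 2)⁻¹ * ‖FW g (ff V h lam t u) p‖ ^ 2))
            + h / 2 * (M / h * (δ ^ 2 * ‖FW g u p‖ ^ 2 + (δ ^ 2)⁻¹ * ‖FR V (cV V) g u p‖ ^ 2))
            + h / 2 * ∑ j, h * K * (δ⁻¹ * ‖FW g u p‖ ^ 2 + δ * ‖FW (dj j g) u p‖ ^ 2)) := by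
              gcongr
        _ = _ := by ring
    · rw [Set.indicator_of_notMem hD, Set.indicator_of_notMem hD]
      have hx : ¬ ‖(lsc (2 * Real.pi * h) p).1‖ ≤ S := fun hx => hD (by
        rw [lsc_apply] at hx
        exact ⟨by simpa using hx, trivial⟩)
      have z1 : m (lsc (2 * Real.pi * h) p) = 0 := by
        by_contra hc; exact hx (hms _ hc).2.1
      have z2 : a0 (lsc (2 * Real.pi * h) p) = 0 := by
        by_contra hc; exact hx (has _ hc)
      rw [z1, z2]; simp
  rw [integral_const_mul, integral_sub iG (ia.const_mul c), integral_const_mul] at key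
  have k2 := hT0.trans key
  have k3 := nonneg_of_mul_nonneg_right k2 (by positivity)
  linarith

end

section
open Filter MeasureTheory SchwartzMap LineDeriv FourierTransform

variable {n : ℕ}

theorem a0_exists {V : SRE n → ℝ} {γ Cv : ℝ} (H : VB V γ Cv) {a b δ₀ R : ℝ} (hab : a ≤ b) (hδ : 0 < δ₀)
    (hR : 0 < R) : ∃ (a0 : SRE n × SRE n → ℝ) (L : NNReal), LipschitzWith L a0 ∧ (∀ y, 0 ≤ a0 y) ∧
      (∀ y, a0 y ≤ 1) ∧ (∀ y, a0 y ≠ 0 → ‖y.1‖ ≤ R + 2 ∧ pE V y ∈ Set.Icc (a - δ₀) (b + δ₀)) ∧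
      ∀ y : SRE n × SRE n, ‖y.1‖ ≤ R + 1 → ∀ lam ∈ Set.Icc a b, 1 ≤ a0 y + 4 / δ₀ ^ 2 * |pE V y - lam| ^ 2 := by
  let χ : ContDiffBump (0 : SRE n) := ⟨R + 1, R + 2, by linarith, by linarith⟩
  let ψ : ContDiffBump ((a + b) / 2 : ℝ) := ⟨(b - a) / 2 + δ₀ / 2, (b - a) / 2 + δ₀, by linarith, by linarith⟩
  have hχ : ∀ x, χ x ≠ 0 → ‖x‖ ≤ R + 2 := fun x hx => by
    by_contra hc
    exact hx (χ.zero_of_le_dist (by rw [dist_zero_right]; exact (not_le.1 hc).le))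
  have hψ : ∀ x, ψ x ≠ 0 → x ∈ Set.Icc (a - δ₀) (b + δ₀) := fun x hx => by
    by_contra hc
    refine hx (ψ.zero_of_le_dist ?_)
    rw [Real.dist_eq]
    change (b - a) / 2 + δ₀ ≤ _
    by_contra h2
    rw [not_le, abs_lt] at h2
    exact hc ⟨by linarith, by linarith⟩
  have hsupp : ∀ y : SRE n × SRE n, χ y.1 * ψ (pE V y) ≠ 0 → ‖y.1‖ ≤ R + 2 ∧ pE V y ∈ Set.Icc (a - δ₀) (b + δ₀) :=
    fun y hy => ⟨hχ _ (left_ne_zero_of_mul hy), hψ _ (right_ne_zero_of_mul hy)⟩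
  have cs : HasCompactSupport fun y : SRE n × SRE n => χ y.1 * ψ (pE V y) := by
    refine HasCompactSupport.of_support_subset_isCompact
      ((isCompact_closedBall (0 : SRE n) (R + 2)).prod (isCompact_closedBall (0 : SRE n) (1 + |b + δ₀ + Cv|))) fun y hy => ?_
    obtain ⟨h1, h2⟩ := hsupp y hy
    refine ⟨by simpa using h1, ?_⟩
    rw [mem_closedBall_zero_iff]
    have h3 := h2.2
    unfold pE at h3
    have h4 := (abs_le.1 (H.bV y.1)).1
    have h5 : ‖y.2‖ ^ 2 ≤ |b + δ₀ + Cv| := le_trans (by linarith) (le_abs_self _)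
    nlinarith [norm_nonneg y.2, sq_nonneg (‖y.2‖ - 1)]
  have cd : ContDiff ℝ 1 fun y : SRE n × SRE n => χ y.1 * ψ (pE V y) := by
    have h1 : ContDiff ℝ 1 fun y : SRE n × SRE n => χ y.1 := χ.contDiff.comp contDiff_fst
    have hV : ContDiff ℝ 1 V := H.cd.of_le (by exact_mod_cast le_top)
    have h2 : ContDiff ℝ 1 fun y : SRE n × SRE n => pE V y := by
      unfold pE
      exact (contDiff_snd.norm_sq ℝ).add (hV.comp contDiff_fst)
    exact h1.mul (ψ.contDiff.comp h2)
  obtain ⟨L, hL⟩ := cd.lipschitzWith_of_hasCompactSupport cs (by norm_num)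
  refine ⟨_, L, hL, fun y => mul_nonneg χ.nonneg ψ.nonneg, fun y => mul_le_one₀ χ.le_one ψ.nonneg ψ.le_one,
    hsupp, fun y hy lam hlam => ?_⟩
  have h1 : χ y.1 = 1 := χ.one_of_mem_closedBall (by simpa using hy)
  beta_reduce
  rw [h1, one_mul]
  by_cases hc : |pE V y - lam| ≤ δ₀ / 2
  · have h2 : ψ (pE V y) = 1 := ψ.one_of_mem_closedBall (by
      rw [Metric.mem_closedBall, Real.dist_eq]
      change _ ≤ (b - a) / 2 + δ₀ / 2
      obtain ⟨h3, h4⟩ := abs_le.1 hc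
      rw [abs_le]
      exact ⟨by linarith [hlam.1], by linarith [hlam.2]⟩)
    rw [h2]
    have : 0 ≤ 4 / δ₀ ^ 2 * |pE V y - lam| ^ 2 := by positivity
    linarith
  · have h3 : (δ₀ / 2) ^ 2 ≤ |pE V y - lam| ^ 2 := pow_le_pow_left₀ (by positivity) (not_le.1 hc).le 2
    have h4 : (1 : ℝ) = 4 / δ₀ ^ 2 * (δ₀ / 2) ^ 2 := by field_simp; norm_num
    have h5 : 4 / δ₀ ^ 2 * (δ₀ / 2) ^ 2 ≤ 4 / δ₀ ^ 2 * |pE V y - lam| ^ 2 := by gcongr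
    have := ψ.nonneg' (pE V y)
    linarith

theorem loc_bd {V : SRE n → ℝ} {β σ : ℝ} (hβ : 0 ≤ β) (hσ : 0 ≤ σ) (h lam t : ℝ) (u : 𝓢(SRE n, ℂ)) {S : ℝ} (hS : 0 ≤ S) :
    (∫ y in Metric.closedBall (0 : SRE n) S, ‖u y‖ ^ 2) ≤ (1 + S ^ 2) ^ (1/2 + σ) * ∫ z, Nd β σ h lam u z ∧
    (∫ y in Metric.closedBall (0 : SRE n) S, h ^ 2 * Gf u y) ≤ (1 + S ^ 2) ^ (1/2 + σ) * ∫ z, Nd β σ h lam u z ∧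
    (∫ y in Metric.closedBall (0 : SRE n) S, Aw y ^ (-(1/2) : ℝ) * Qf h lam u y) ≤ ∫ z, Nd β σ h lam u z ∧
    (∫ y in Metric.closedBall (0 : SRE n) S, ‖ff V h lam t u y‖ ^ 2) ≤
      ∫ z, Aw z ^ (1/2 + σ + 2 * β) * ‖ff V h lam t u z‖ ^ 2 := by
  have gen : ∀ (f G : SRE n → ℝ), IntegrableOn f (Metric.closedBall (0 : SRE n) S) → Integrable G → (∀ z, 0 ≤ G z) →
      (∀ z, ‖z‖ ≤ S → f z ≤ G z) → ∫ y in Metric.closedBall (0 : SRE n) S, f y ≤ ∫ z, G z := by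
    intro f G hf hG h0 hfG
    refine (setIntegral_mono_on hf hG.integrableOn measurableSet_closedBall
      fun z hz => hfG z (by simpa using hz)).trans ?_
    exact setIntegral_le_integral hG (ae_of_all _ h0)
  have N0 : ∀ z, 0 ≤ Nd β σ h lam u z := fun z => by
    have := Aw_pos z; have := Qf_nonneg h lam u z; have := Gf_nonneg u z
    unfold Nd; positivity
  have Ni := Nd_int β σ h lam u
  have key : ∀ z : SRE n, ‖z‖ ≤ S → h ^ 2 * Gf u z + ‖u z‖ ^ 2 ≤ (1 + S ^ 2) ^ (1/2 + σ) * Nd β σ h lam u z := by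
    intro z hz
    have hA := Aw_pos z
    have q := Qf_nonneg h lam u z
    have g := Gf_nonneg u z
    have h1 : Aw z ≤ 1 + S ^ 2 := by unfold Aw; gcongr
    have h2 : Aw z ^ (1/2 + σ) ≤ (1 + S ^ 2) ^ (1/2 + σ) := Real.rpow_le_rpow hA.le h1 (by positivity)
    have h3 : Aw z ^ (-(1/2) - σ) * (h ^ 2 * Gf u z + ‖u z‖ ^ 2) ≤ Nd β σ h lam u z := by
      unfold Nd
      have : 0 ≤ Aw z ^ (β - 1/2) * Qf h lam u z := by positivity
      linarith
    have h4 : Aw z ^ (1/2 + σ) * Aw z ^ (-(1/2) - σ) = 1 := by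
      rw [← Real.rpow_add hA, show 1/2 + σ + (-(1/2) - σ) = 0 by ring, Real.rpow_zero]
    calc h ^ 2 * Gf u z + ‖u z‖ ^ 2 = Aw z ^ (1/2 + σ) * (Aw z ^ (-(1/2) - σ) * (h ^ 2 * Gf u z + ‖u z‖ ^ 2)) := by
          rw [← mul_assoc, h4, one_mul]
      _ ≤ (1 + S ^ 2) ^ (1/2 + σ) * Nd β σ h lam u z := by gcongr
  have cb : ∀ f : SRE n → ℝ, Continuous f → IntegrableOn f (Metric.closedBall (0 : SRE n) S) := fun f hf =>
    hf.continuousOn.integrableOn_compact (isCompact_closedBall _ _)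
  have cG : Continuous (Gf u) := continuous_finsetSum _ fun j _ => (dj j u).continuous.norm.pow 2
  have P : 0 ≤ (1 + S ^ 2) ^ (1/2 + σ) := by positivity
  refine ⟨?_, ?_, ?_, ?_⟩
  · rw [← integral_const_mul]
    refine gen _ _ (sr_isq u).integrableOn (Ni.const_mul _) (fun z => mul_nonneg P (N0 z)) fun z hz => ?_
    have := key z hz
    have := mul_nonneg (sq_nonneg h) (Gf_nonneg u z)
    linarith
  · rw [← integral_const_mul]
    refine gen _ _ (cb _ (continuous_const.mul cG)) (Ni.const_mul _) (fun z => mul_nonneg P (N0 z)) fun z hz => ?_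
    have := key z hz
    have := sq_nonneg ‖u z‖
    linarith
  · refine gen _ _ (sr_int_Q _ h lam u).integrableOn Ni N0 fun z hz => ?_
    have hA := Aw_pos z; have q := Qf_nonneg h lam u z; have g := Gf_nonneg u z
    have h1 : Aw z ^ (-(1/2) : ℝ) ≤ Aw z ^ (β - 1/2) := Real.rpow_le_rpow_of_exponent_le (Aw_one_le z) (by linarith)
    have h2 : 0 ≤ Aw z ^ (-(1/2) - σ) * (h ^ 2 * Gf u z + ‖u z‖ ^ 2) := by positivity
    unfold Nd
    have := mul_le_mul_of_nonneg_right h1 q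
    linarith
  · refine gen _ _ (sr_isq _).integrableOn (sr_int_sq _ _) (fun z => ?_) fun z hz => ?_
    · have hA := Aw_pos z; positivity
    · exact le_mul_of_one_le_left (sq_nonneg _) (Real.one_le_rpow (Aw_one_le z) (by positivity))

theorem ell_num {r Cg Cv C U G X Φ P N : ℝ} (hr : 0 < r) (hr1 : r ≤ 1) (hCg : 0 ≤ Cg) (hN : 0 ≤ N) (hC : 0 ≤ C)
    (hX : 0 ≤ X) (hU : U ≤ C * X) (hG : G ≤ C * X) (hΦ : Φ ≤ P) :
    4 * (Φ + 4 * N * (r ^ 4) ^ 2 * (Cg / (r ^ 3) ^ 2) * G + (r ^ 4) ^ 4 * (Cg / (r ^ 3) ^ 4) * U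
      + (Cv * r ^ 3) ^ 2 * U) ≤ 4 * P + r * (4 * C * (4 * N * Cg + Cg + Cv ^ 2)) * X := by
  have p : ∀ k : ℕ, 1 ≤ k → r ^ k ≤ r := fun k hk => by
    simpa using pow_le_pow_of_le_one hr.le hr1 hk
  have e1 : 4 * N * (r ^ 4) ^ 2 * (Cg / (r ^ 3) ^ 2) = 4 * N * Cg * r ^ 2 := by field_simp
  have e2 : (r ^ 4) ^ 4 * (Cg / (r ^ 3) ^ 4) = Cg * r ^ 4 := by field_simp
  have e3 : (Cv * r ^ 3) ^ 2 = Cv ^ 2 * r ^ 6 := by ring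
  rw [e1, e2, e3]
  have t1 : 4 * N * Cg * r ^ 2 * G ≤ 4 * N * Cg * r * (C * X) := by
    have := p 2 (by norm_num)
    calc _ ≤ 4 * N * Cg * r ^ 2 * (C * X) := by gcongr
      _ ≤ _ := by gcongr
  have t2 : Cg * r ^ 4 * U ≤ Cg * r * (C * X) := by
    have := p 4 (by norm_num)
    calc _ ≤ Cg * r ^ 4 * (C * X) := by gcongr
      _ ≤ _ := by gcongr
  have t3 : Cv ^ 2 * r ^ 6 * U ≤ Cv ^ 2 * r * (C * X) := by
    have := p 6 (by norm_num)
    calc _ ≤ Cv ^ 2 * r ^ 6 * (C * X) := by gcongr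
      _ ≤ _ := by gcongr
  nlinarith

theorem tr_num {r Cg Cv C U Q X Φ P N lam b M K θ D : ℝ} (hr : 0 < r) (hr1 : r ≤ 1) (hCg : 0 ≤ Cg) (hN : 0 ≤ N)
    (hC : 0 ≤ C) (hX : 0 ≤ X) (hU0 : 0 ≤ U) (hU : U ≤ C * X) (hQ : Q ≤ X) (hΦ : Φ ≤ P) (hl0 : 0 ≤ lam) (hl : lam ≤ b)
    (hM : 0 ≤ M) (hK : 0 ≤ K) (hθ : 0 < θ) (hD : 0 ≤ D) :
    D * (3 * (2 * Q + N * (r ^ 4) ^ 2 * (Cg / (r ^ 3) ^ 2) * U + N * lam * (2 * r ^ 3) ^ 2 * U))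
      + M * (θ * U + (θ * (r ^ 4) ^ 2)⁻¹ * Φ)
      + (M / r ^ 4 * ((r ^ 3) ^ 2 * U + ((r ^ 3) ^ 2)⁻¹ * ((Cv * (r ^ 3) ^ 2) ^ 2 * U))
      + N * (r ^ 4 * K * ((r ^ 3)⁻¹ * U + r ^ 3 * (Cg / (r ^ 3) ^ 2 * U)))) ≤
    (6 * D + M * θ * C + r * (D * (3 * (N * Cg * C + N * b * 4 * C)) + M * (1 + Cv ^ 2) * C
      + N * K * (1 + Cg) * C)) * X + M / θ * (P / (r ^ 4) ^ 2) := by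
  have p : ∀ k : ℕ, 1 ≤ k → r ^ k ≤ r := fun k hk => by
    simpa using pow_le_pow_of_le_one hr.le hr1 hk
  have hb : 0 ≤ b := hl0.trans hl
  have e1 : N * (r ^ 4) ^ 2 * (Cg / (r ^ 3) ^ 2) * U = N * Cg * r ^ 2 * U := by field_simp
  have e2 : M / r ^ 4 * ((r ^ 3) ^ 2 * U + ((r ^ 3) ^ 2)⁻¹ * ((Cv * (r ^ 3) ^ 2) ^ 2 * U))
      = M * (1 + Cv ^ 2) * r ^ 2 * U := by field_simp
  have e3 : N * (r ^ 4 * K * ((r ^ 3)⁻¹ * U + r ^ 3 * (Cg / (r ^ 3) ^ 2 * U))) = N * K * (1 + Cg) * r * U := by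
    field_simp
  rw [e1, e2, e3]
  have hr2 := p 2 (by norm_num)
  have hr6 := p 6 (by norm_num)
  have t1 : N * Cg * r ^ 2 * U ≤ N * Cg * r * (C * X) := by gcongr
  have t2 : N * lam * (2 * r ^ 3) ^ 2 * U ≤ N * b * (4 * r) * (C * X) := by
    calc _ = N * lam * (4 * r ^ 6) * U := by ring
      _ ≤ _ := by gcongr
  have t3 : M * (1 + Cv ^ 2) * r ^ 2 * U ≤ M * (1 + Cv ^ 2) * r * (C * X) := by gcongr
  have t4 : N * K * (1 + Cg) * r * U ≤ N * K * (1 + Cg) * r * (C * X) := by gcongr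
  have t5 : M * (θ * U + (θ * (r ^ 4) ^ 2)⁻¹ * Φ) ≤ M * (θ * (C * X) + (θ * (r ^ 4) ^ 2)⁻¹ * P) := by gcongr
  have t6 : D * (3 * (2 * Q + N * Cg * r ^ 2 * U + N * lam * (2 * r ^ 3) ^ 2 * U)) ≤
      D * (3 * (2 * X + N * Cg * r * (C * X) + N * b * (4 * r) * (C * X))) := by gcongr
  refine (add_le_add (add_le_add t6 t5) (add_le_add t3 t4)).trans (le_of_eq ?_)
  field_simp
  ring

end

section
open Filter MeasureTheory SchwartzMap LineDeriv FourierTransform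

variable {n : ℕ}

set_option maxHeartbeats 2000000 in
theorem sr_interior {V : SRE n → ℝ} {γ Cv : ℝ} (H : VB V γ Cv) {Φ : ℝ → SRE n × SRE n → SRE n × SRE n}
    (F : IsFl V Φ) {a b δ₀ R : ℝ} (hab : a ≤ b) (hδ : 0 < δ₀) (hδa : δ₀ < a) (hR : 1 ≤ R)
    (hesc : ∀ y, pE V y ∈ Set.Icc (a - δ₀) (b + δ₀) → Tendsto (fun t => ‖(Φ t y).1‖) atTop atTop)
    {β σ : ℝ} (hβ : 0 ≤ β) (hσ : 0 ≤ σ) {η : ℝ} (hη : 0 < η) :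
    ∃ C h₀ : ℝ, 0 < C ∧ 0 < h₀ ∧ h₀ ≤ 1 ∧ ∀ h, 0 < h → h ≤ h₀ → ∀ lam ∈ Set.Icc a b, ∀ t, 0 < t →
      ∀ u : 𝓢(SRE n, ℂ), ∫ z in Metric.closedBall (0 : SRE n) R, ‖u z‖ ^ 2 ≤
        η * (∫ z, Nd β σ h lam u z) + C / h ^ 2 * ∫ z, Aw z ^ (1/2 + σ + 2 * β) * ‖ff V h lam t u z‖ ^ 2 := by
  have ha : 0 < a := by linarith
  obtain ⟨a0, L, aL, a00, a01, as, alow⟩ := a0_exists H (R := R) hab hδ (by linarith)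
  obtain ⟨T, T0, hT⟩ := F.dyn H (R0 := R + 2) (by linarith) hesc
  obtain ⟨Cm, hCm, hN⟩ := F.escape H (by linarith) T0 hT aL a00 a01 as
  obtain ⟨Cg, hCg, hW⟩ := Win_exists n
  have hb : 0 < b := by linarith
  obtain ⟨N, hc⟩ : ∃ N : ℕ, max 1 (36 * Cm / (a * η)) ≤ ∑ i ∈ Finset.range N, 1 / ((i : ℝ) + 1) :=
    (Real.tendsto_sum_range_one_div_nat_succ_atTop.eventually_ge_atTop _).exists
  obtain ⟨bb, m, K, S, S0, RS, bL, bb0, bcs, bS, mc, m0, mC, ms, bfd⟩ := hN N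
  obtain ⟨c, hcc⟩ : ∃ c, c = ∑ i ∈ Finset.range N, 1 / ((i : ℝ) + 1) := ⟨_, rfl⟩
  rw [← hcc] at hc bfd
  have c1 : 1 ≤ c := (le_max_left _ _).trans hc
  have c2 : 36 * Cm / (a * η) ≤ c := (le_max_right _ _).trans hc
  have c0 : 0 < c := by linarith
  obtain ⟨M, M0, hM⟩ : ∃ M : ℝ, 0 ≤ M ∧ ∀ y, bb y ≤ M := by
    obtain ⟨M, hM⟩ := bL.continuous.bounded_above_of_compact_support bcs
    exact ⟨M, (norm_nonneg _).trans (hM 0), fun y => (le_abs_self _).trans (hM y)⟩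
  obtain ⟨C, hCe⟩ : ∃ C : ℝ, C = (1 + (S + 1) ^ 2) ^ (1/2 + σ) := ⟨_, rfl⟩
  have C0 : 0 < C := by rw [hCe]; positivity
  obtain ⟨θ, hθe⟩ : ∃ θ : ℝ, θ = η / (3 * (M * C + 1)) := ⟨_, rfl⟩
  have θ0 : 0 < θ := by rw [hθe]; positivity
  have θ1 : M * θ * C ≤ η / 3 := by
    rw [hθe]
    have : M * (η / (3 * (M * C + 1))) * C = η / 3 * (M * C / (M * C + 1)) := by field_simp
    rw [this]
    have : M * C / (M * C + 1) ≤ 1 := (div_le_one (by positivity)).2 (by linarith)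
    nlinarith
  obtain ⟨K1, hK1⟩ : ∃ K1 : ℝ, K1 = 2 * Cm / a * (3 * (n * Cg * C + n * b * 4 * C)) + M * (1 + Cv ^ 2) * C
      + n * K * (1 + Cg) * C := ⟨_, rfl⟩
  obtain ⟨K2, hK2⟩ : ∃ K2 : ℝ, K2 = 4 * C * (4 * n * Cg + Cg + Cv ^ 2) := ⟨_, rfl⟩
  have K10 : 0 ≤ K1 := by rw [hK1]; positivity
  have K20 : 0 ≤ K2 := by rw [hK2]; positivity
  obtain ⟨K0, hK0⟩ : ∃ K0 : ℝ, K0 = K1 + 4 / δ₀ ^ 2 * K2 := ⟨_, rfl⟩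
  have K00 : 0 ≤ K0 := by rw [hK0]; positivity
  obtain ⟨r0, hr0⟩ : ∃ r0 : ℝ, r0 = min 1 (η / (3 * (K0 + 1))) := ⟨_, rfl⟩
  have r00 : 0 < r0 := by rw [hr0]; positivity
  have r01 : r0 ≤ 1 := by rw [hr0]; exact min_le_left _ _
  have r02 : r0 * K0 ≤ η / 3 := by
    have h1 : r0 ≤ η / (3 * (K0 + 1)) := by rw [hr0]; exact min_le_right _ _
    calc _ ≤ η / (3 * (K0 + 1)) * K0 := by gcongr
      _ = η / 3 * (K0 / (K0 + 1)) := by field_simp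
      _ ≤ η / 3 * 1 := by gcongr; exact (div_le_one (by positivity)).2 (by linarith)
      _ = _ := mul_one _
  refine ⟨M / θ + 16 / δ₀ ^ 2, r0 ^ 4, by positivity, by positivity, pow_le_one₀ r00.le r01, ?_⟩
  intro h hh hhr lam hlam t ht u
  obtain ⟨r, hr, hrh⟩ : ∃ r : ℝ, 0 < r ∧ r ^ 4 = h := ⟨√(√h), by positivity, by
    rw [show 4 = 2 * 2 from rfl, pow_mul, Real.sq_sqrt (by positivity), Real.sq_sqrt hh.le]⟩
  have hrr : r ≤ r0 := by
    rw [← hrh] at hhr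
    exact le_of_pow_le_pow_left₀ (by norm_num) r00.le hhr
  have hr1 := hrr.trans r01
  have hh1 : h ≤ 1 := hhr.trans (pow_le_one₀ r00.le r01)
  have d0 : 0 < r ^ 3 := by positivity
  have d1 : r ^ 3 ≤ 1 := pow_le_one₀ hr.le hr1
  obtain ⟨g, W⟩ := hW (r ^ 3) d0
  obtain ⟨ia, est⟩ := tr_est H W d0 d1 hh ht ha hlam.1 θ0 u bL bcs bb0 bS hM M0 mc m0 hCm mC
    (fun y hy => ⟨by linarith [(ms y hy).1], (ms y hy).2⟩) aL.continuous a00 a01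
    (fun y hy => (as y hy).1.trans RS) bfd
  have E := ell H W d1 h lam t u S
  obtain ⟨lU, lG, lQ, lP⟩ := loc_bd (V := V) hβ hσ h lam t u (S := S + 1) (by linarith)
  rw [← hCe] at lU lG
  have X0 : 0 ≤ ∫ z, Nd β σ h lam u z := integral_nonneg fun z => by
    have := Aw_pos z; have := Qf_nonneg h lam u z; have := Gf_nonneg u z
    unfold Nd; positivity
  have P0 : 0 ≤ ∫ z, Aw z ^ (1/2 + σ + 2 * β) * ‖ff V h lam t u z‖ ^ 2 := integral_nonneg fun z => by
    have := Aw_pos z; positivity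
  have U0 : 0 ≤ ∫ y in Metric.closedBall (0 : SRE n) (S + 1), ‖u y‖ ^ 2 := integral_nonneg fun y => by positivity
  generalize hX : ∫ z, Nd β σ h lam u z = X at *
  generalize hP : ∫ z, Aw z ^ (1/2 + σ + 2 * β) * ‖ff V h lam t u z‖ ^ 2 = P at *
  have low1 : ∫ z in Metric.closedBall (0 : SRE n) R, ‖u z‖ ^ 2 ≤
      (∫ p in DD n S, a0 (lsc (2 * Real.pi * h) p) * ‖FW g u p‖ ^ 2)
      + 4 / δ₀ ^ 2 * ∫ p in DD n S, |pE V (lsc (2 * Real.pi * h) p) - lam| ^ 2 * ‖FW g u p‖ ^ 2 := by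
    refine (low W d1 u R).trans ?_
    have iF := (fw_bd W.cs (fun w hw => (W.s0 w hw).trans d1) u (R + 1)).1
    have iE := E.int.const_mul (4 / δ₀ ^ 2)
    rw [← integral_const_mul, ← integral_add ia iE]
    have sub : DD n (R + 1) ⊆ DD n S :=
      Set.prod_mono (Metric.closedBall_subset_closedBall (by linarith)) subset_rfl
    have nn : ∀ p, 0 ≤ a0 (lsc (2 * Real.pi * h) p) * ‖FW g u p‖ ^ 2
        + 4 / δ₀ ^ 2 * (|pE V (lsc (2 * Real.pi * h) p) - lam| ^ 2 * ‖FW g u p‖ ^ 2) := fun p =>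
      add_nonneg (mul_nonneg (a00 _) (sq_nonneg _)) (by positivity)
    refine le_trans (setIntegral_mono_on iF ((ia.add iE).mono_set sub) (DD_meas _) fun p hp => ?_)
      (setIntegral_mono_set (ia.add iE) (ae_of_all _ nn) (ae_of_all _ sub))
    have hp1 : ‖(lsc (2 * Real.pi * h) p).1‖ ≤ R + 1 := by
      rw [lsc_apply]; simpa using hp.1
    have := mul_le_mul_of_nonneg_right (alow _ hp1 lam hlam) (sq_nonneg ‖FW g u p‖)
    rw [one_mul, add_mul, mul_assoc (4 / δ₀ ^ 2)] at this
    exact this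
  have E2 := E.le
  rw [← hrh] at E2 est low1
  try rw [← hrh] at lG
  try rw [← hrh] at lQ
  try rw [← hrh] at lP
  have E3 := E2.trans (ell_num (Cv := Cv) (N := n) hr hr1 hCg.le (Nat.cast_nonneg n) C0.le X0 lU lG lP)
  rw [Finset.sum_const, Finset.card_univ, Fintype.card_fin, nsmul_eq_mul] at est
  have est2 := est.trans (tr_num (Cv := Cv) (N := n) (b := b) hr hr1 hCg.le (Nat.cast_nonneg n) C0.le X0 U0 lU lQ lP
    (ha.le.trans hlam.1) hlam.2 M0 K.coe_nonneg θ0 (show 0 ≤ 2 * Cm / a by positivity))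
  rw [← hK1] at est2
  rw [← hK2] at E3
  generalize (∫ p in DD n S, a0 (lsc (2 * Real.pi * r ^ 4) p) * ‖FW g u p‖ ^ 2) = A0 at *
  generalize (∫ p in DD n S, |pE V (lsc (2 * Real.pi * r ^ 4) p) - lam| ^ 2 * ‖FW g u p‖ ^ 2) = E0 at *
  rw [hrh] at est2
  refine low1.trans ?_
  have Ph : P ≤ P / h ^ 2 := by
    rw [le_div_iff₀ (by positivity)]
    exact mul_le_of_le_one_right P0 (pow_le_one₀ hh.le hh1)
  have PP : 0 ≤ P / h ^ 2 := by positivity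
  have s1 : A0 ≤ (η / 3 + η / 3 + r * K1) * X + M / θ * (P / h ^ 2) := by
    have q1 : c * A0 ≤ c * ((η / 3 + η / 3 + r * K1) * X + M / θ * (P / h ^ 2)) := by
      refine est2.trans ?_
      have w1 : 6 * (2 * Cm / a) ≤ c * (η / 3) := by
        rw [div_le_iff₀ (by positivity)] at c2
        rw [← mul_div_assoc, div_le_iff₀ ha]
        linarith
      have w2 : M * θ * C ≤ c * (η / 3) := θ1.trans (le_mul_of_one_le_left (by positivity) c1)
      have w3 : r * K1 ≤ c * (r * K1) := le_mul_of_one_le_left (by positivity) c1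
      have w4 : M / θ * (P / h ^ 2) ≤ c * (M / θ * (P / h ^ 2)) := le_mul_of_one_le_left (by positivity) c1
      calc _ ≤ (c * (η / 3) + c * (η / 3) + c * (r * K1)) * X + c * (M / θ * (P / h ^ 2)) := by gcongr
        _ = _ := by ring
    exact le_of_mul_le_mul_left q1 c0
  have s2 : 4 / δ₀ ^ 2 * E0 ≤ 16 / δ₀ ^ 2 * (P / h ^ 2) + r * (4 / δ₀ ^ 2 * K2) * X := by
    calc _ ≤ 4 / δ₀ ^ 2 * (4 * (P / h ^ 2) + r * K2 * X) := by gcongr; linarith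
      _ = _ := by ring
  have s3 : r * K0 ≤ η / 3 := (mul_le_mul_of_nonneg_right hrr K00).trans r02
  rw [hK0] at s3
  have s4 := mul_le_mul_of_nonneg_right s3 X0
  calc _ ≤ _ := add_le_add s1 s2
    _ = (η / 3 + η / 3) * X + r * (K1 + 4 / δ₀ ^ 2 * K2) * X + (M / θ + 16 / δ₀ ^ 2) / h ^ 2 * P := by ring
    _ ≤ _ := by linarith

end

section
open Filter MeasureTheory SchwartzMap LineDeriv FourierTransform

variable {n : ℕ}

theorem lap_slap (u : 𝓢(SRE n, ℂ)) (z : SRE n) : euclideanLaplacian (⇑u) z = slap u z := by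
  rw [slap_apply]
  unfold euclideanLaplacian
  refine Finset.sum_congr rfl fun j _ => ?_
  unfold dj
  rw [SchwartzMap.lineDerivOp_apply_eq_fderiv]
  congr 2

theorem elp_of {p q : SRE n → ℝ} {K : ℝ} (hK : 0 ≤ K) (pc : Continuous p) (qc : Continuous q)
    (pi : Integrable (fun z => p z ^ 2)) (qi : Integrable (fun z => q z ^ 2))
    (hpq : ∫ z, p z ^ 2 ≤ K ^ 2 * ∫ z, q z ^ 2) :
    eLpNorm p 2 volume ≤ ENNReal.ofReal K * eLpNorm q 2 volume := by
  have mp : MemLp p 2 volume := (memLp_two_iff_integrable_sq pc.aestronglyMeasurable).2 pi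
  have mq : MemLp q 2 volume := (memLp_two_iff_integrable_sq qc.aestronglyMeasurable).2 qi
  rw [mp.eLpNorm_eq_integral_rpow_norm (by norm_num) (by norm_num),
    mq.eLpNorm_eq_integral_rpow_norm (by norm_num) (by norm_num), ← ENNReal.ofReal_mul hK]
  have e : ∀ x : ℝ, ‖x‖ ^ (ENNReal.toReal 2) = x ^ 2 := fun x => by simp
  simp only [e]
  apply ENNReal.ofReal_le_ofReal
  have e2 : (ENNReal.toReal 2)⁻¹ = 1 / 2 := by norm_num
  rw [e2, ← Real.sqrt_eq_rpow, ← Real.sqrt_eq_rpow]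
  refine (Real.sqrt_le_sqrt hpq).trans ?_
  rw [Real.sqrt_mul (sq_nonneg K), Real.sqrt_sq hK]

theorem sr_large {V : SRE n → ℝ} (hV : V.HasTemperateGrowth) (h lam t : ℝ) (ht : 1 ≤ t)
    (u : 𝓢(SRE n, ℂ)) : ∫ z, ‖u z‖ ^ 2 ≤ ∫ z, ‖ff V h lam t u z‖ ^ 2 := by
  obtain ⟨i, e⟩ := sr_D2 hV h lam t 0 u
  have iu := sr_isq u
  have ik := sr_isq (ff V h lam t u)
  have : ∫ z, (‖u z‖ ^ 2 - ‖ff V h lam t u z‖ ^ 2) ≤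
      ∫ z, -2 * (- (t * Aw z ^ (0:ℝ) * ‖u z‖ ^ 2)
      - Aw z ^ (0:ℝ) * inner ℝ (Complex.I * u z) (ff V h lam t u z)
      + 2 * (0:ℝ) * Aw z ^ ((0:ℝ) - 1) * (h ^ 2 * inner ℝ (Complex.I * u z) (Zf u z)))
        := by
    refine integral_mono (iu.sub ik) (i.const_mul (-2)) fun z => ?_
    have q := (abs_le.1 (abs_real_inner_le_norm (Complex.I * u z) (ff V h lam t u z))).1
    rw [norm_mul, Complex.norm_I, one_mul] at q
    simp only [Real.rpow_zero, mul_one, one_mul, mul_zero, zero_mul, add_zero]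
    have q2 := mul_le_mul_of_nonneg_right ht (sq_nonneg ‖u z‖)
    nlinarith [sq_nonneg (‖u z‖ - ‖ff V h lam t u z‖)]
  rw [integral_sub iu ik, integral_const_mul, e, mul_zero] at this
  linarith

theorem sr_main {V : SRE n → ℝ} {γ Cv : ℝ} (H : VB V γ Cv) {a b δ₀ : ℝ} (ha : 0 < a) (hab : a ≤ b)
    (hδ₀ : 0 < δ₀)
    (hnt : ∀ z ζ : ℝ → SRE n,
      (∀ t : ℝ, HasDerivAt z ((2 : ℝ) • ζ t) t) →
      (∀ t : ℝ, HasDerivAt ζ (-(gradient V (z t))) t) →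
      (∃ μ ∈ Set.Icc a b, |‖ζ 0‖ ^ 2 + V (z 0) - μ| ≤ δ₀) →
      Tendsto (fun t => ‖z t‖) atTop atTop ∧
        Tendsto (fun t => ‖z t‖) atBot atTop)
    {σ : ℝ} (hσ : 0 < σ) (hσ4 : σ ≤ 1 / 4) (hσγ : σ + σ < γ / 2) :
    ∃ C h₀ : ℝ, 0 < C ∧ 0 < h₀ ∧ h₀ ≤ 1 ∧ ∀ h : ℝ, 0 < h → h ≤ h₀ → ∀ lam ∈ Set.Icc a b,
      ∀ t : ℝ, 0 < t → t ≤ 1 → ∀ u : 𝓢(SRE n, ℂ),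
      ∫ z, Aw z ^ (-(1 / 2) - σ) * ‖u z‖ ^ 2 ≤
        C / h ^ 2 * ∫ z, Aw z ^ (1 / 2 + σ + 2 * σ) * ‖ff V h lam t u z‖ ^ 2 := by
  obtain ⟨Φ, f0, f1, f2, f3⟩ := flow_exists H
  have F : IsFl V Φ := ⟨f0, f1, f2, f3⟩
  set δ := min δ₀ (a / 2) with hδ
  have d0 : 0 < δ := lt_min hδ₀ (by positivity)
  have d1 : δ < a := (min_le_right _ _).trans_lt (by linarith)
  have d2 : δ ≤ δ₀ := min_le_left _ _
  have hesc : ∀ y, pE V y ∈ Set.Icc (a - δ) (b + δ) → Tendsto (fun t => ‖(Φ t y).1‖) atTop atTop := by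
    intro y hy
    refine (hnt (fun t => (Φ t y).1) (fun t => (Φ t y).2) (fun t => (f1 y t).fst) (fun t => (f1 y t).snd)
      ⟨max a (min b (pE V y)), ⟨le_max_left _ _, max_le hab (min_le_left _ _)⟩, ?_⟩).1
    rw [f0]
    change |pE V y - _| ≤ _
    rw [abs_le]
    obtain ⟨h1, h2⟩ := hy
    rcases le_total b (pE V y) with q | q
    · rw [min_eq_left q, max_eq_right hab]; constructor <;> linarith
    · rw [min_eq_right q]
      rcases le_total a (pE V y) with q' | q'
      · rw [max_eq_right q']; constructor <;> linarith
      · rw [max_eq_left q']; constructor <;> linarith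
  obtain ⟨C1, R, h1, C10, R1, h10, P⟩ := propA H.temp γ Cv H.hVb H.hVd a b ha σ σ hσ hσ4 hσ hσ4 hσγ
  obtain ⟨C2, h2, C20, h20, h21, Q⟩ := sr_interior H F hab d0 d1 R1 hesc hσ.le hσ.le
    (show 0 < 1 / (2 * C1) by positivity)
  refine ⟨2 * (C1 * C2 + C1), min h1 h2, by positivity, lt_min h10 h20, (min_le_right _ _).trans h21,
    fun h hh hhm lam hlam t ht ht1 u => ?_⟩
  have k1 := hhm.trans (min_le_left _ _)
  have k2 := hhm.trans (min_le_right _ _)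
  have p := P h hh (k2.trans h21) k1 lam hlam t ht ht1 u
  have q := Q h hh k2 lam hlam t ht u
  have m : ∫ z, Aw z ^ (-(1 / 2) - σ) * ‖u z‖ ^ 2 ≤ ∫ z, Nd σ σ h lam u z := by
    refine integral_mono (sr_int_sq _ _) (Nd_int _ _ _ _ _) fun z => ?_
    have := Aw_pos z; have := Qf_nonneg h lam u z; have := Gf_nonneg u z
    have e1 : 0 ≤ Aw z ^ (σ - 1/2) * Qf h lam u z := by positivity
    have e2 : 0 ≤ Aw z ^ (-(1 / 2) - σ) * (h ^ 2 * Gf u z) := by positivity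
    simp only [Nd]
    linarith
  refine m.trans ?_
  generalize (∫ z, Aw z ^ (1 / 2 + σ + 2 * σ) * ‖ff V h lam t u z‖ ^ 2) = Y at *
  generalize (∫ z, Nd σ σ h lam u z) = X at *
  generalize (∫ z in Metric.closedBall (0 : SRE n) R, ‖u z‖ ^ 2) = U at *
  have := mul_le_mul_of_nonneg_left q C10.le
  have e : C1 * (1 / (2 * C1) * X + C2 / h ^ 2 * Y) = X / 2 + C1 * C2 / h ^ 2 * Y := by
    field_simp
  rw [e] at this
  have e3 : 2 * (C1 * C2 + C1) / h ^ 2 * Y = 2 * (C1 * C2 / h ^ 2 * Y) + 2 * (C1 / h ^ 2 * Y) := by ring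
  rw [e3]
  linarith

end

/-- The main theorem in the Euclidean model: the uniform semiclassical resolvent
estimate `‖(1+|z|)^{−1/2−ε} u‖ ≤ C h⁻¹ ‖(1+|z|)^{1/2+ε}(−h²Δu + Vu − (λ+it)u)‖` in
`L²(ℝⁿ)`, uniformly for `h ∈ (0, h₀)`, `λ` in a compact non-trapping energy interval
`I = [a,b] ⊂ (0,∞)` and `t > 0`, stated as an a priori estimate on Schwartz
functions. -/
theorem semiclassical_resolvent_estimate (n : ℕ) (hn : 1 ≤ n)
    (V : EuclideanSpace ℝ (Fin n) → ℝ) (hV : IsLongRangePotential V)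
    (a b : ℝ) (ha : 0 < a) (hab : a ≤ b)
    (δ₀ : ℝ) (hδ₀ : 0 < δ₀)
    (hnt : ∀ z ζ : ℝ → EuclideanSpace ℝ (Fin n),
      (∀ t : ℝ, HasDerivAt z ((2 : ℝ) • ζ t) t) →
      (∀ t : ℝ, HasDerivAt ζ (-(gradient V (z t))) t) →
      (∃ μ ∈ Set.Icc a b, |‖ζ 0‖ ^ 2 + V (z 0) - μ| ≤ δ₀) →
      Tendsto (fun t => ‖z t‖) atTop atTop ∧
        Tendsto (fun t => ‖z t‖) atBot atTop)
    (ε : ℝ) (hε : 0 < ε) :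
    ∃ C : ℝ, 0 < C ∧ ∃ h₀ : ℝ, 0 < h₀ ∧
      ∀ h : ℝ, h ∈ Set.Ioo 0 h₀ → ∀ lam ∈ Set.Icc a b, ∀ t : ℝ, 0 < t →
        ∀ u : SchwartzMap (EuclideanSpace ℝ (Fin n)) ℂ,
          eLpNorm (fun z => (1 + ‖z‖) ^ (-(1 / 2 : ℝ) - ε) * ‖u z‖) 2 volume ≤
            ENNReal.ofReal (C / h) *
              eLpNorm (fun z => (1 + ‖z‖) ^ ((1 / 2 : ℝ) + ε) *
                ‖-((h : ℂ) ^ 2) * euclideanLaplacian (⇑u) z + (V z : ℂ) * u z -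
                  ((lam : ℂ) + (t : ℂ) * Complex.I) * u z‖) 2 volume := by
  obtain ⟨γ, Cv, H⟩ := VB_of hV
  have g0 := H.g0
  obtain ⟨σ, hσ, s1, s2, s3⟩ : ∃ σ : ℝ, 0 < σ ∧ σ ≤ 1 / 8 ∧ σ ≤ γ / 8 ∧ σ ≤ ε / 8 :=
    ⟨min (1 / 8) (min (γ / 8) (ε / 8)), by positivity, min_le_left _ _,
      (min_le_right _ _).trans (min_le_left _ _), (min_le_right _ _).trans (min_le_right _ _)⟩
  obtain ⟨C, h₀, C0, h00, h01, M⟩ := sr_main H ha hab hδ₀ hnt hσ (by linarith) (by linarith)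
  refine ⟨Real.sqrt C + 1, by positivity, h₀, h00, fun h hh lam hlam t ht u => ?_⟩
  obtain ⟨hh0, hh1⟩ := hh
  have hle1 : h ≤ 1 := hh1.le.trans h01
  have fe : (fun z => (1 + ‖z‖) ^ ((1 / 2 : ℝ) + ε) *
                ‖-((h : ℂ) ^ 2) * euclideanLaplacian (⇑u) z + (V z : ℂ) * u z -
                  ((lam : ℂ) + (t : ℂ) * Complex.I) * u z‖)
      = fun z => (1 + ‖z‖) ^ ((1 / 2 : ℝ) + ε) * ‖ff V h lam t u z‖ := by
    funext z
    rw [ff_apply H.temp, lap_slap]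
  rw [fe]
  have p1 : ∀ z : SRE n, (1:ℝ) ≤ 1 + ‖z‖ := fun z => by linarith [norm_nonneg z]
  have p0 : ∀ z : SRE n, (0:ℝ) < 1 + ‖z‖ := fun z => by linarith [p1 z]
  have A1 : ∀ z : SRE n, Aw z ≤ (1 + ‖z‖) ^ 2 := fun z => by unfold Aw; nlinarith [norm_nonneg z]
  have A2 : ∀ z : SRE n, (1 + ‖z‖) ^ 2 ≤ 2 * Aw z := fun z => by
    unfold Aw; nlinarith [sq_nonneg (1 - ‖z‖)]
  have wc : ∀ (s : ℝ) (f : SchwartzMap (SRE n) ℂ), Continuous fun z => (1 + ‖z‖) ^ s * ‖f z‖ := fun s f =>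
    ((continuous_const.add continuous_norm).rpow_const fun z => Or.inl (p0 z).ne').mul f.continuous.norm
  have sqe : ∀ (s : ℝ) (z : SRE n) (c : ℝ), ((1 + ‖z‖) ^ s * c) ^ 2 = ((1 + ‖z‖) ^ 2) ^ s * c ^ 2 := by
    intro s z c
    rw [mul_pow, ← Real.rpow_natCast_mul (p0 z).le, ← Real.rpow_mul_natCast (p0 z).le, mul_comm s]
  have b1 : ∀ (z : SRE n) (c : ℝ), ((1 + ‖z‖) ^ (-(1 / 2 : ℝ) - ε) * c) ^ 2 ≤ Aw z ^ (-(1 / 2 : ℝ) - σ) * c ^ 2 := by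
    intro z c
    rw [sqe]
    gcongr
    refine (Real.rpow_le_rpow_of_nonpos (Aw_pos z) (A1 z) (by linarith)).trans ?_
    exact Real.rpow_le_rpow_of_exponent_le (Aw_one_le z) (by linarith)
  have b2 : ∀ (z : SRE n) (c : ℝ), Aw z ^ (1 / 2 + σ + 2 * σ) * c ^ 2 ≤ ((1 + ‖z‖) ^ ((1 / 2 : ℝ) + ε) * c) ^ 2 := by
    intro z c
    rw [sqe]
    gcongr
    refine (Real.rpow_le_rpow_of_exponent_le (Aw_one_le z)
      (show 1 / 2 + σ + 2 * σ ≤ (1 / 2 : ℝ) + ε by linarith)).trans ?_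
    exact Real.rpow_le_rpow (Aw_pos z).le (A1 z) (by linarith)
  have b3 : ∀ (z : SRE n) (c : ℝ), ((1 + ‖z‖) ^ ((1 / 2 : ℝ) + ε) * c) ^ 2 ≤ 2 ^ ((1 / 2 : ℝ) + ε) * (Aw z ^ ((1 / 2 : ℝ) + ε) * c ^ 2) := by
    intro z c
    rw [sqe, ← mul_assoc, ← Real.mul_rpow (by norm_num) (Aw_pos z).le]
    gcongr
    exact A2 z
  set f := ff V h lam t u with hf
  have c1 := wc (-(1 / 2 : ℝ) - ε) u
  have c2 := wc ((1 / 2 : ℝ) + ε) f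
  have i1 : Integrable fun z => ((1 + ‖z‖) ^ (-(1 / 2 : ℝ) - ε) * ‖u z‖) ^ 2 :=
    (sr_int_sq (-(1 / 2 : ℝ) - σ) u).mono' (c1.pow 2).aestronglyMeasurable
      (ae_of_all _ fun z => by rw [Real.norm_of_nonneg (sq_nonneg _)]; exact b1 z _)
  have i2 : Integrable fun z => ((1 + ‖z‖) ^ ((1 / 2 : ℝ) + ε) * ‖f z‖) ^ 2 :=
    ((sr_int_sq ((1 / 2 : ℝ) + ε) f).const_mul (2 ^ ((1 / 2 : ℝ) + ε))).mono' (c2.pow 2).aestronglyMeasurable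
      (ae_of_all _ fun z => by rw [Real.norm_of_nonneg (sq_nonneg _)]; exact b3 z _)
  refine elp_of (by positivity) c1 c2 i1 i2 ?_
  have J0 : 0 ≤ ∫ z, ((1 + ‖z‖) ^ ((1 / 2 : ℝ) + ε) * ‖f z‖) ^ 2 := integral_nonneg fun z => sq_nonneg _
  have m1 : ∫ z, ((1 + ‖z‖) ^ (-(1 / 2 : ℝ) - ε) * ‖u z‖) ^ 2 ≤ ∫ z, Aw z ^ (-(1 / 2 : ℝ) - σ) * ‖u z‖ ^ 2 :=
    integral_mono i1 (sr_int_sq _ _) fun z => b1 z _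
  have m2 : ∫ z, Aw z ^ (1 / 2 + σ + 2 * σ) * ‖f z‖ ^ 2 ≤ ∫ z, ((1 + ‖z‖) ^ ((1 / 2 : ℝ) + ε) * ‖f z‖) ^ 2 :=
    integral_mono (sr_int_sq _ _) i2 fun z => b2 z _
  have hs := Real.sqrt_nonneg C
  have hC := Real.sq_sqrt C0.le
  rcases le_total t 1 with ht1 | ht1
  · refine m1.trans ((M h hh0 hh1.le lam hlam t ht ht1 u).trans ?_)
    rw [← hf]
    refine (mul_le_mul_of_nonneg_left m2 (by positivity)).trans (mul_le_mul_of_nonneg_right ?_ J0)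
    rw [div_pow]
    gcongr
    nlinarith
  · have m3 : ∫ z, Aw z ^ (-(1 / 2 : ℝ) - σ) * ‖u z‖ ^ 2 ≤ ∫ z, ‖u z‖ ^ 2 :=
      integral_mono (sr_int_sq _ _) (sr_isq u) fun z =>
        mul_le_of_le_one_left (sq_nonneg _) (Real.rpow_le_one_of_one_le_of_nonpos (Aw_one_le z) (by linarith))
    have m4 : ∫ z, ‖f z‖ ^ 2 ≤ ∫ z, Aw z ^ (1 / 2 + σ + 2 * σ) * ‖f z‖ ^ 2 :=
      integral_mono (sr_isq f) (sr_int_sq _ _) fun z =>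
        le_mul_of_one_le_left (sq_nonneg _) (Real.one_le_rpow (Aw_one_le z) (by linarith))
    have m5 := sr_large H.temp h lam t ht1 u
    refine (m1.trans (m3.trans (m5.trans (m4.trans m2)))).trans (le_mul_of_one_le_left J0 ?_)
    refine one_le_pow₀ ?_
    rw [le_div_iff₀ hh0]
    linarith
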